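/- Let Σ be a non-singular fan in ℝ^n satisfying conditions (2.9.1) and (2.9.2), and let D = (d_1,…,d_r) be positive integers with ∑_k d_k n_k ≠ 0. With j_D = j_{D_0} ∘ s_{D,D_0} : Pol*_D(S¹,X_Σ) → ΩU(K_Σ) as in the construction for this case, the map i_D = (Ωq_Σ) ∘ j_D : Pol*_D(S¹,X_Σ) → ΩX_Σ induces an isomorphism (i_D)_* : π_k(Pol*_D(S¹,X_Σ)) → π_k(ΩX_Σ) ≅ π_{k+1}(X_Σ) for every 2 ≤ k ≤ d(D,Σ) = 2(r_min(Σ)−1)·d_min − 2. -/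

import Mathlib

open scoped BigOperators
attribute [local instance] Classical.propDecidable

noncomputable section

namespace Toric


/-! ### Cones and fans -/

/-- The real vector associated to an integer vector. -/
def zr {n : ℕ} (v : Fin n → ℤ) : Fin n → ℝ := fun i => (v i : ℝ)

/-- A convex rational polyhedral cone in `ℝ^n`. -/
def IsRatCone {n : ℕ} (σ : Set (Fin n → ℝ)) : Prop :=
  ∃ s : Finset (Fin n → ℤ),
    σ = {x | ∃ lam : (Fin n → ℤ) → ℝ, (∀ v, 0 ≤ lam v) ∧ x = ∑ v ∈ s, lam v • zr v}

/-- A cone is strongly convex if `σ ∩ (-σ) = {0}`. -/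
def StronglyConvex {n : ℕ} (σ : Set (Fin n → ℝ)) : Prop := σ ∩ (-σ) = {0}

/-- `τ` is a face of `σ`, cut out by a linear form nonnegative on `σ`. -/
def IsFaceOf {n : ℕ} (τ σ : Set (Fin n → ℝ)) : Prop :=
  ∃ L : (Fin n → ℝ) →ₗ[ℝ] ℝ, (∀ x ∈ σ, 0 ≤ L x) ∧ τ = σ ∩ {x | L x = 0}

/-- A fan in `ℝ^n`: a finite collection of strongly convex rational polyhedral cones,
closed under taking faces, such that the intersection of two cones is a face of each;
we also require that it strictly contains `{0}`. -/
structure Fan (n : ℕ) where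
  cones : Set (Set (Fin n → ℝ))
  finite : cones.Finite
  ratCone : ∀ σ ∈ cones, IsRatCone σ
  stronglyConvex : ∀ σ ∈ cones, StronglyConvex σ
  face_mem : ∀ σ ∈ cones, ∀ τ, IsFaceOf τ σ → τ ∈ cones
  inter_face : ∀ σ ∈ cones, ∀ τ ∈ cones, IsFaceOf (σ ∩ τ) σ
  zero_mem : ({0} : Set (Fin n → ℝ)) ∈ cones
  nontrivial : cones ≠ {({0} : Set (Fin n → ℝ))}

/-- A fan is complete if its cones cover `ℝ^n`. -/
def Fan.Complete {n : ℕ} (F : Fan n) : Prop := ⋃₀ F.cones = Set.univ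

/-- A fan is non-singular if each of its cones is spanned by part of a `ℤ`-basis of `ℤ^n`. -/
def Fan.NonSingular {n : ℕ} (F : Fan n) : Prop :=
  ∀ σ ∈ F.cones, ∃ (b : Module.Basis (Fin n) ℤ (Fin n → ℤ)) (s : Finset (Fin n)),
    σ = {x | ∃ lam : Fin n → ℝ, (∀ i, 0 ≤ lam i) ∧ x = ∑ i ∈ s, lam i • zr (b i)}

/-- The ray (one-dimensional cone) generated by a vector. -/
def ray {n : ℕ} (v : Fin n → ℝ) : Set (Fin n → ℝ) := {x | ∃ t : ℝ, 0 ≤ t ∧ x = t • v}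

/-- The cone spanned by the vectors `n_i`, `i ∈ s`. -/
def coneIdx {n r : ℕ} (N : Fin r → Fin n → ℤ) (s : Finset (Fin r)) : Set (Fin n → ℝ) :=
  {x | ∃ lam : Fin r → ℝ, (∀ i, 0 ≤ lam i) ∧ x = ∑ i ∈ s, lam i • zr (N i)}

/-- A point of `ℝ^n` lying in the lattice `ℤ^n`. -/
def IsLatticePoint {n : ℕ} (x : Fin n → ℝ) : Prop := ∀ i, ∃ m : ℤ, x i = (m : ℝ)

/-- `N 1, …, N r` is the (complete, repetition-free) list of primitive generators of the
one-dimensional cones of the fan `F`. -/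
structure IsPrimGens {n r : ℕ} (F : Fan n) (N : Fin r → Fin n → ℤ) : Prop where
  ray_mem : ∀ k, ray (zr (N k)) ∈ F.cones
  ne_zero : ∀ k, N k ≠ 0
  primitive : ∀ k, ray (zr (N k)) ∩ {x | IsLatticePoint x}
      = {x | ∃ c : ℕ, x = (c : ℝ) • zr (N k)}
  inj : Function.Injective N
  complete : ∀ σ ∈ F.cones, Module.finrank ℝ (Submodule.span ℝ σ) = 1 →
      ∃ k, σ = ray (zr (N k))

/-- Condition (2.9.1): a positive integral relation among the primitive generators. -/
def Cond1 {n r : ℕ} (N : Fin r → Fin n → ℤ) : Prop :=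
  ∃ d : Fin r → ℕ, (∀ k, 0 < d k) ∧ ∑ k, (d k : ℤ) • N k = 0

/-- Condition (2.9.2): the primitive generators span `ℤ^n` over `ℤ`. -/
def Cond2 {n r : ℕ} (N : Fin r → Fin n → ℤ) : Prop :=
  Submodule.span ℤ (Set.range N) = ⊤

/-- The underlying simplicial complex `K_Σ` of a fan. -/
def KC {n r : ℕ} (F : Fan n) (N : Fin r → Fin n → ℤ) : Set (Finset (Fin r)) :=
  {s | coneIdx N s ∈ F.cones}

/-- A primitive set: it spans no cone of the fan, but every proper subset does. -/
def PrimitiveSet {r : ℕ} (K : Set (Finset (Fin r))) (s : Finset (Fin r)) : Prop :=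
  s ∉ K ∧ ∀ t ⊂ s, t ∈ K

/-- `r_min`: the minimal cardinality of a primitive set. -/
def rmin {r : ℕ} (K : Set (Finset (Fin r))) : ℕ :=
  sInf {m | ∃ s : Finset (Fin r), PrimitiveSet K s ∧ s.card = m}

/-- `d_min = min {d_1, …, d_r}`. -/
def dmin {r : ℕ} (D : Fin r → ℕ) : ℕ := sInf (Set.range D)

/-- The stability dimension `d(D,Σ) = 2(r_min − 1) d_min − 2`. -/
def dBound {r : ℕ} (K : Set (Finset (Fin r))) (D : Fin r → ℕ) : ℤ :=
  2 * ((rmin K : ℤ) - 1) * (dmin D : ℤ) - 2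

/-- The connectivity bound `C_D(Σ) = 2(r_min − 1) d_min − 1`. -/
def CBound {r : ℕ} (K : Set (Finset (Fin r))) (D : Fin r → ℕ) : ℤ :=
  2 * ((rmin K : ℤ) - 1) * (dmin D : ℤ) - 1

/-! ### Coordinate subspaces, `U(K)`, `G_Σ` and the toric quotient -/

/-- The coordinate subspace `L_σ ⊆ ℂ^r`. -/
def LSub {r : ℕ} (σ : Finset (Fin r)) : Set (Fin r → ℂ) := {x | ∀ i ∈ σ, x i = 0}

/-- The complement `U(K)` of the coordinate subspace arrangement of type `K`. -/
def UK {r : ℕ} (K : Set (Finset (Fin r))) : Set (Fin r → ℂ) :=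
  (⋃ σ ∈ {s : Finset (Fin r) | s ∉ K}, LSub σ)ᶜ

lemma mem_UK {r : ℕ} {K : Set (Finset (Fin r))} {x : Fin r → ℂ} :
    x ∈ UK K ↔ ∀ σ : Finset (Fin r), σ ∉ K → ∃ i ∈ σ, x i ≠ 0 := by
  constructor
  · intro h σ hσ
    by_contra hc
    push_neg at hc
    exact h (Set.mem_biUnion hσ (fun i hi => hc i hi))
  · intro h hx
    rcases Set.mem_iUnion₂.1 hx with ⟨σ, hσ, hxσ⟩
    rcases h σ hσ with ⟨i, hi, hne⟩
    exact hne (hxσ i hi)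

/-- The group `G_Σ` (as a subset of `ℂ^r`). -/
def GSet {n r : ℕ} (N : Fin r → Fin n → ℤ) : Set (Fin r → ℂ) :=
  {μ | (∀ k, μ k ≠ 0) ∧ ∀ m : Fin n → ℤ, ∏ k, μ k ^ (∑ j, N k j * m j) = 1}

/-- The orbit relation of the `G_Σ`-action on `U(K_Σ)`. -/
def toricRel {n r : ℕ} (N : Fin r → Fin n → ℤ) (K : Set (Finset (Fin r)))
    (x y : ↥(UK K)) : Prop :=
  ∃ μ ∈ GSet N, (fun i => μ i * (x : Fin r → ℂ) i) = (y : Fin r → ℂ)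

/-- The toric variety `X_Σ = U(K_Σ)/G_Σ`, as a topological quotient. -/
def XS {n r : ℕ} (N : Fin r → Fin n → ℤ) (K : Set (Finset (Fin r))) : Type :=
  Quot (toricRel N K)

instance {n r : ℕ} (N : Fin r → Fin n → ℤ) (K : Set (Finset (Fin r))) :
    TopologicalSpace (XS N K) :=
  instTopologicalSpaceQuot

/-- The quotient map `q_Σ : U(K_Σ) → X_Σ`. -/
def qmap {n r : ℕ} (N : Fin r → Fin n → ℤ) (K : Set (Finset (Fin r))) :
    ↥(UK K) → XS N K :=
  Quot.mk (toricRel N K)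

/-- `q_Σ` as a continuous map. -/
def qCont {n r : ℕ} (N : Fin r → Fin n → ℤ) (K : Set (Finset (Fin r))) :
    C(↥(UK K), XS N K) :=
  ⟨qmap N K, continuous_quot_mk⟩

lemma coneIdx_empty {n r : ℕ} (N : Fin r → Fin n → ℤ) :
    coneIdx N (∅ : Finset (Fin r)) = ({0} : Set (Fin n → ℝ)) := by
  ext x
  constructor
  · rintro ⟨lam, -, hx⟩
    simpa using hx
  · intro hx
    exact ⟨0, fun i => le_refl 0, by simpa using hx⟩

lemma empty_mem_KC {n r : ℕ} (F : Fan n) (N : Fin r → Fin n → ℤ) :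
    (∅ : Finset (Fin r)) ∈ KC F N := by
  show coneIdx N ∅ ∈ F.cones
  rw [coneIdx_empty]
  exact F.zero_mem

/-- The point `(1,…,1)`. -/
def onesC {r : ℕ} : Fin r → ℂ := fun _ => 1

lemma ones_mem_UK {r : ℕ} {K : Set (Finset (Fin r))} (h : (∅ : Finset (Fin r)) ∈ K) :
    (onesC : Fin r → ℂ) ∈ UK K := by
  rw [mem_UK]
  intro σ hσ
  rcases Finset.nonempty_iff_ne_empty.2 (fun he : σ = ∅ => hσ (by rw [he]; exact h)) with ⟨i, hi⟩
  exact ⟨i, hi, one_ne_zero⟩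

/-- The base point `(1,…,1)` of `U(K_Σ)`. -/
def onesUK {r : ℕ} {K : Set (Finset (Fin r))} (h : (∅ : Finset (Fin r)) ∈ K) : ↥(UK K) :=
  ⟨onesC, ones_mem_UK h⟩

/-- The base point `[1,…,1]` of `X_Σ`. -/
def baseX {n r : ℕ} (N : Fin r → Fin n → ℤ) (K : Set (Finset (Fin r)))
    (h : (∅ : Finset (Fin r)) ∈ K) : XS N K :=
  qmap N K (onesUK h)



/-! ### Spaces of tuples of monic polynomials -/

/-- The monic polynomial `z^d + a_{d-1} z^{d-1} + ⋯ + a_0` with coefficient data `a`. -/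
def toPoly {d : ℕ} (a : Fin d → ℂ) : Polynomial ℂ :=
  Polynomial.X ^ d + ∑ i : Fin d, Polynomial.C (a i) * Polynomial.X ^ (i : ℕ)

/-- The space `Pol*_D(S¹, X_Σ)` of `r`-tuples of monic polynomials of multidegree `D`
(in coefficient coordinates) such that for every `σ ∉ K` the polynomials `{f_i : i ∈ σ}`
have no common real root. -/
def PolSp {r : ℕ} (K : Set (Finset (Fin r))) (D : Fin r → ℕ) :
    Set (∀ k : Fin r, Fin (D k) → ℂ) :=
  {f | ∀ σ : Finset (Fin r), σ ∉ K → ∀ t : ℝ,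
        ∃ k ∈ σ, (toPoly (f k)).eval (t : ℂ) ≠ 0}

lemma polEval_mem_UK {r : ℕ} {K : Set (Finset (Fin r))} {D : Fin r → ℕ}
    (f : ↥(PolSp K D)) (t : ℝ) :
    (fun k => (toPoly (f.1 k)).eval (t : ℂ)) ∈ UK K :=
  mem_UK.2 fun σ hσ => f.2 σ hσ t

/-! ### Loop spaces and induced maps on homotopy groups -/

/-- The loop space `Ω X = Map*(S¹, X)` with `S¹ = ℝ ∪ {∞}` (the one-point
compactification of `ℝ`), based at `x₀`. -/
def Loop (X : Type*) [TopologicalSpace X] (x₀ : X) : Type _ :=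
  {γ : C(OnePoint ℝ, X) // γ OnePoint.infty = x₀}

instance {X : Type*} [TopologicalSpace X] (x₀ : X) : TopologicalSpace (Loop X x₀) :=
  instTopologicalSpaceSubtype

/-- The constant loop, base point of `Ω X`. -/
def Loop.const {X : Type*} [TopologicalSpace X] (x₀ : X) : Loop X x₀ :=
  ⟨ContinuousMap.const _ x₀, rfl⟩

/-- A based continuous map induces a continuous map of loop spaces. -/
def loopMap {X Y : Type*} [TopologicalSpace X] [TopologicalSpace Y] {x₀ : X} {y₀ : Y}
    (f : C(X, Y)) (hf : f x₀ = y₀) : C(Loop X x₀, Loop Y y₀) where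
  toFun γ := ⟨f.comp γ.1, by simp [γ.2, hf]⟩
  continuous_toFun := by
    apply Continuous.subtype_mk
    exact (ContinuousMap.continuous_postcomp f).comp continuous_subtype_val

/-- The map induced by a continuous map on homotopy groups (`π_q`). -/
def piMap (q : ℕ) {X Y : Type*} [TopologicalSpace X] [TopologicalSpace Y]
    (f : C(X, Y)) (x : X) :
    HomotopyGroup (Fin q) X x → HomotopyGroup (Fin q) Y (f x) :=
  Quotient.map
    (fun p => ⟨f.comp p.1, fun y hy => by
      show f (p.1 y) = f x
      rw [p.2 y hy]⟩)
    (fun p₁ p₂ h => h.elim fun H => ⟨H.compContinuousMap f⟩)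

/-- `f` is a homotopy equivalence through dimension `d`: it induces isomorphisms on
`π_k` for all `k ≤ d` (at every base point). -/
def HomotopyEquivThrough {X Y : Type*} [TopologicalSpace X] [TopologicalSpace Y]
    (f : C(X, Y)) (d : ℤ) : Prop :=
  ∀ (x : X) (k : ℕ), (k : ℤ) ≤ d → Function.Bijective (piMap k f x)

/-- A genuine homotopy equivalence. -/
def IsHtpyEquiv {X Y : Type*} [TopologicalSpace X] [TopologicalSpace Y]
    (f : C(X, Y)) : Prop :=
  ∃ g : C(Y, X), (f.comp g).Homotopic (ContinuousMap.id Y) ∧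
    (g.comp f).Homotopic (ContinuousMap.id X)

/-! ### `i_D`, lifts, and stabilization maps -/

/-- `j : Pol*_D → Ω U(K_Σ)` is a lift of `i_D` through `Ω q_Σ`, i.e. `Ω q_Σ ∘ j = i_D`:
for every tuple `f` and real `t`, the loop `j f` at time `t` lies over the point
`[f_1(t), …, f_r(t)]` of `X_Σ` (and at `∞` over `[1,…,1]`, automatically). -/
def IsLiftOfID {n r : ℕ} (N : Fin r → Fin n → ℤ) (K : Set (Finset (Fin r)))
    (hE : (∅ : Finset (Fin r)) ∈ K) (D : Fin r → ℕ)
    (j : ↥(PolSp K D) → Loop ↥(UK K) (onesUK hE)) : Prop :=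
  ∀ (f : ↥(PolSp K D)) (t : ℝ),
    qmap N K ((j f).1 (t : OnePoint ℝ)) =
      qmap N K ⟨fun k => (toPoly (f.1 k)).eval (t : ℂ), polEval_mem_UK f t⟩

/-- `i : Pol*_D → Ω X_Σ` is the map `i_D` given by evaluation. -/
def IsID {n r : ℕ} (N : Fin r → Fin n → ℤ) (K : Set (Finset (Fin r)))
    (hE : (∅ : Finset (Fin r)) ∈ K) (D : Fin r → ℕ)
    (i : ↥(PolSp K D) → Loop (XS N K) (baseX N K hE)) : Prop :=
  ∀ (f : ↥(PolSp K D)) (t : ℝ),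
    (i f).1 (t : OnePoint ℝ) =
      qmap N K ⟨fun k => (toPoly (f.1 k)).eval (t : ℂ), polEval_mem_UK f t⟩

/-- `φ` is an admissible parameter for the stabilization maps: a homeomorphism of `ℂ`
onto the half plane `{Re < bound}` carrying `ℝ` onto `(-∞, bound)`. -/
def AdmissiblePhi (bound : ℝ) (φ : ℂ → ℂ) : Prop :=
  Continuous φ ∧ Function.Injective φ ∧ IsOpenMap φ ∧
    Set.range φ = {w : ℂ | w.re < bound} ∧
    φ '' {z : ℂ | z.im = 0} = {z : ℂ | z.im = 0 ∧ z.re < bound}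

/-- The defining property of the stabilization map
`s_{D,D'}(f)_k = φ(f_k) · (z - x_k)^{d'_k - d_k}`, where `φ(f)` denotes the monic
polynomial whose roots are the images under `φ` of the roots of `f`. -/
def StabSpec {r : ℕ} (K : Set (Finset (Fin r))) (φ : ℂ → ℂ) (xpt : Fin r → ℂ)
    (D D' : Fin r → ℕ) (s : ↥(PolSp K D) → ↥(PolSp K D')) : Prop :=
  ∀ (f : ↥(PolSp K D)) (k : Fin r),
    toPoly ((s f).1 k) =
      (((toPoly (f.1 k)).roots.map φ).map
        fun α => Polynomial.X - Polynomial.C α).prod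
        * (Polynomial.X - Polynomial.C (xpt k)) ^ (D' k - D k)

/-- The general defining property of the map `j_D : Pol*_D → Ω U(K_Σ)`:
when `∑ d_k n_k = 0` it is a lift of `i_D` through `Ω q_Σ`, and otherwise it is the
composite `j_{D₀} ∘ s_{D,D₀}` for a suitable `D₀ = m₀ D*` as in condition (2.9.1). -/
def IsJD {n r : ℕ} (N : Fin r → Fin n → ℤ) (K : Set (Finset (Fin r)))
    (hE : (∅ : Finset (Fin r)) ∈ K) (D : Fin r → ℕ)
    (j : C(↥(PolSp K D), Loop ↥(UK K) (onesUK hE))) : Prop :=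
  ((∑ k, (D k : ℤ) • N k = 0) ∧ IsLiftOfID N K hE D j) ∨
  ((∑ k, (D k : ℤ) • N k ≠ 0) ∧
    ∃ (dstar : Fin r → ℕ) (m₀ : ℕ),
      (∀ k, 0 < dstar k) ∧ (∑ k, (dstar k : ℤ) • N k = 0) ∧
      (∀ k, D k < m₀ * dstar k) ∧
      ∃ (φ : ℂ → ℂ) (xpt : Fin r → ℂ),
        AdmissiblePhi ((∑ k, D k : ℕ) : ℝ) φ ∧
        (∀ k, ((∑ k, D k : ℕ) : ℝ) < (xpt k).re) ∧ Function.Injective xpt ∧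
        ∃ (j₀ : C(↥(PolSp K fun k => m₀ * dstar k), Loop ↥(UK K) (onesUK hE)))
          (s₀ : C(↥(PolSp K D), ↥(PolSp K fun k => m₀ * dstar k))),
          IsLiftOfID N K hE _ j₀ ∧ StabSpec K φ xpt D _ s₀ ∧ j = j₀.comp s₀)

/-! ### Stabilized (colimit) spaces -/

/-- The multidegree `D + t·e`. -/
def Dt {r : ℕ} (D : Fin r → ℕ) (t : ℕ) : Fin r → ℕ := fun k => D k + t

/-- Carrier of the stabilized space: the disjoint union of the `Pol*_{D+te}`. -/
def ColCar {r : ℕ} (K : Set (Finset (Fin r))) (D : Fin r → ℕ) : Type :=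
  Σ t : ℕ, ↥(PolSp K (Dt D t))

instance {r : ℕ} (K : Set (Finset (Fin r))) (D : Fin r → ℕ) :
    TopologicalSpace (ColCar K D) := by
  unfold ColCar; infer_instance

/-- The identifications generating the colimit along the stabilization maps. -/
def ColRel {r : ℕ} (K : Set (Finset (Fin r))) (D : Fin r → ℕ)
    (s : ∀ t : ℕ, ↥(PolSp K (Dt D t)) → ↥(PolSp K (Dt D (t + 1)))) :
    ColCar K D → ColCar K D → Prop :=
  fun a b => b = ⟨a.1 + 1, s a.1 a.2⟩

/-- The stabilized space `Pol^Σ_{D+∞} = colim_t Pol*_{D+te}(S¹, X_Σ)`. -/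
def PolColim {r : ℕ} (K : Set (Finset (Fin r))) (D : Fin r → ℕ)
    (s : ∀ t : ℕ, ↥(PolSp K (Dt D t)) → ↥(PolSp K (Dt D (t + 1)))) : Type :=
  Quot (ColRel K D s)

instance {r : ℕ} (K : Set (Finset (Fin r))) (D : Fin r → ℕ)
    (s : ∀ t : ℕ, ↥(PolSp K (Dt D t)) → ↥(PolSp K (Dt D (t + 1)))) :
    TopologicalSpace (PolColim K D s) :=
  instTopologicalSpaceQuot

/-- Admissibility of a family of stabilization maps `s_{D+te}`. -/
def AdmissibleStabFamily {r : ℕ} (K : Set (Finset (Fin r))) (D : Fin r → ℕ)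
    (s : ∀ t : ℕ, ↥(PolSp K (Dt D t)) → ↥(PolSp K (Dt D (t + 1)))) : Prop :=
  ∀ t : ℕ, ∃ (φ : ℂ → ℂ) (xpt : Fin r → ℂ),
    AdmissiblePhi ((∑ k, Dt D t k : ℕ) : ℝ) φ ∧
    (∀ k, ((∑ k, Dt D t k : ℕ) : ℝ) < (xpt k).re) ∧ Function.Injective xpt ∧
    StabSpec K φ xpt (Dt D t) (Dt D (t + 1)) (s t)


section Part1
/-! ### Part A/B: compression framework -/

abbrev Bl (E : Type*) [NormedAddCommGroup E] : Set E := Metric.closedBall (0:E) 1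
abbrev Sp (E : Type*) [NormedAddCommGroup E] : Set E := Metric.sphere (0:E) 1
abbrev II : Set ℝ := Set.Icc (0:ℝ) 1

section framework
set_option linter.unusedSectionVars false
variable {E : Type*} [NormedAddCommGroup E] [NormedSpace ℝ E]
variable {P Q Z : Type*} [TopologicalSpace P] [TopologicalSpace Q] [TopologicalSpace Z]

lemma mem_Bl {x : E} : x ∈ Bl E ↔ ‖x‖ ≤ 1 := by simp [Bl]
lemma mem_Sp {x : E} : x ∈ Sp E ↔ ‖x‖ = 1 := by simp [Sp]
lemma Sp_sub_Bl : Sp E ⊆ Bl E := Metric.sphere_subset_closedBall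
lemma zero_mem_II : (0:ℝ) ∈ II := by simp [II]
lemma one_mem_II : (1:ℝ) ∈ II := by simp [II]

/-- gluing on two closed pieces -/
lemma glue_contOn {X Y : Type*} [TopologicalSpace X] [TopologicalSpace Y]
    {f f₁ f₂ : X → Y} {s s₁ s₂ : Set X} (hs₁ : IsClosed s₁) (hs₂ : IsClosed s₂)
    (hcov : s ⊆ s₁ ∪ s₂) (h₁ : ContinuousOn f₁ (s ∩ s₁)) (h₂ : ContinuousOn f₂ (s ∩ s₂))
    (e₁ : ∀ x ∈ s ∩ s₁, f x = f₁ x) (e₂ : ∀ x ∈ s ∩ s₂, f x = f₂ x) : ContinuousOn f s := by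
  have h₁' : ContinuousOn f (s ∩ s₁) := h₁.congr e₁
  have h₂' : ContinuousOn f (s ∩ s₂) := h₂.congr e₂
  intro x hx
  have key : ∀ {t : Set X}, IsClosed t → ContinuousOn f (s ∩ t) → ContinuousWithinAt f (s ∩ t) x := by
    intro t ht hf
    by_cases hxt : x ∈ t
    · exact hf x ⟨hx, hxt⟩
    · have : x ∉ closure (s ∩ t) := fun h => hxt (ht.closure_subset_iff.2 Set.inter_subset_right h)
      exact continuousWithinAt_of_notMem_closure this
  have : ContinuousWithinAt f ((s ∩ s₁) ∪ (s ∩ s₂)) x := (key hs₁ h₁').union (key hs₂ h₂')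
  refine this.mono ?_
  intro y hy
  rcases hcov hy with h | h
  · exact Or.inl ⟨hy, h⟩
  · exact Or.inr ⟨hy, h⟩

/-- Compression property. -/
def Comp (E : Type*) [NormedAddCommGroup E] (j : P → Z) : Prop :=
  ∀ (g : E → Z) (β : E → P), ContinuousOn g (Bl E) → ContinuousOn β (Sp E) →
    (∀ a ∈ Sp E, j (β a) = g a) →
    ∃ (G : E → P) (H : ℝ × E → Z), ContinuousOn G (Bl E) ∧ (∀ a ∈ Sp E, G a = β a) ∧
      ContinuousOn H (II ×ˢ Bl E) ∧ (∀ x ∈ Bl E, H (0, x) = g x) ∧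
      (∀ x ∈ Bl E, H (1, x) = j (G x)) ∧ ∀ τ ∈ II, ∀ a ∈ Sp E, H (τ, a) = g a

/-- Homotopy of pairs over `j`. -/
def PH (j : P → Z) (g : E → Z) (β : E → P) (g' : E → Z) (β' : E → P) : Prop :=
  ∃ (H : ℝ × E → Z) (h : ℝ × E → P), ContinuousOn H (II ×ˢ Bl E) ∧ ContinuousOn h (II ×ˢ Sp E) ∧
    (∀ x ∈ Bl E, H (0, x) = g x) ∧ (∀ x ∈ Bl E, H (1, x) = g' x) ∧
    (∀ a ∈ Sp E, h (0, a) = β a) ∧ (∀ a ∈ Sp E, h (1, a) = β' a) ∧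
    ∀ τ ∈ II, ∀ a ∈ Sp E, H (τ, a) = j (h (τ, a))

lemma concat_contOn {Y : Type*} [TopologicalSpace Y] {s : Set E} {H₁ H₂ : ℝ × E → Y}
    (h₁ : ContinuousOn H₁ (II ×ˢ s)) (h₂ : ContinuousOn H₂ (II ×ˢ s))
    (e : ∀ x ∈ s, H₁ (1, x) = H₂ (0, x)) :
    ContinuousOn (fun p : ℝ × E => if p.1 ≤ 1/2 then H₁ (2 * p.1, p.2) else H₂ (2 * p.1 - 1, p.2))
      (II ×ˢ s) := by
  refine glue_contOn (s₁ := {p | p.1 ≤ 1/2}) (s₂ := {p | 1/2 ≤ p.1})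
    (f₁ := fun p => H₁ (2 * p.1, p.2)) (f₂ := fun p => H₂ (2 * p.1 - 1, p.2))
    (isClosed_le continuous_fst continuous_const) (isClosed_le continuous_const continuous_fst)
    (fun p _ => by simp only [Set.mem_union, Set.mem_ofPred_eq]; exact le_total _ _) ?_ ?_ ?_ ?_
  · refine h₁.comp (by fun_prop) ?_
    rintro ⟨t, x⟩ ⟨⟨⟨h0, h1⟩, hx⟩, ht⟩
    simp only [Set.mem_ofPred_eq] at ht h0
    exact ⟨⟨by simp; linarith, by simp; linarith⟩, hx⟩
  · refine h₂.comp (by fun_prop) ?_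
    rintro ⟨t, x⟩ ⟨⟨⟨h0, h1⟩, hx⟩, ht⟩
    simp only [Set.mem_ofPred_eq] at ht h1
    exact ⟨⟨by simp; linarith, by simp; linarith⟩, hx⟩
  · rintro ⟨t, x⟩ ⟨_, ht⟩
    simp only [Set.mem_ofPred_eq] at ht
    simp only [if_pos ht]
  · rintro ⟨t, x⟩ ⟨⟨_, hx⟩, ht⟩
    simp only [Set.mem_ofPred_eq] at ht
    by_cases h : t ≤ 1/2
    · have : t = 1/2 := le_antisymm h ht
      subst this
      simp only [le_refl, if_true]
      have := e x hx
      norm_num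
      exact this
    · simp only [if_neg h]

lemma PH.trans {j : P → Z} {g g' g'' : E → Z} {β β' β'' : E → P}
    (h₁ : PH j g β g' β') (h₂ : PH j g' β' g'' β'') : PH j g β g'' β'' := by
  obtain ⟨H₁, k₁, c1, c2, c3, c4, c5, c6, c7⟩ := h₁
  obtain ⟨H₂, k₂, d1, d2, d3, d4, d5, d6, d7⟩ := h₂
  refine ⟨_, _, concat_contOn c1 d1 (fun x hx => (c4 x hx).trans (d3 x hx).symm),
    concat_contOn c2 d2 (fun x hx => (c6 x hx).trans (d5 x hx).symm), ?_, ?_, ?_, ?_, ?_⟩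
  · intro x hx; norm_num; exact c3 x hx
  · intro x hx; norm_num; exact d4 x hx
  · intro x hx; norm_num; exact c5 x hx
  · intro x hx; norm_num; exact d6 x hx
  · rintro τ ⟨h0, h1⟩ a ha
    by_cases h : τ ≤ 1/2
    · simp only [if_pos h]
      exact c7 _ ⟨by linarith, by linarith⟩ a ha
    · simp only [if_neg h]
      exact d7 _ ⟨by linarith, by linarith⟩ a ha

/-- The pair `(g, β)` can be deformed into the image of `j`. -/
def Solv (j : P → Z) (g : E → Z) (β : E → P) : Prop :=
  ∃ G : E → P, ContinuousOn G (Bl E) ∧ PH j g β (fun x => j (G x)) G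

/-- collapse of the collar -/
def kap (x : E) : E := (max (1/2) ‖x‖)⁻¹ • x

lemma kap_cont : Continuous (kap : E → E) := by
  unfold kap
  refine Continuous.smul (Continuous.inv₀ (by fun_prop) ?_) continuous_id
  intro x; positivity

lemma kap_mem (x : E) : kap x ∈ Bl E := by
  rw [mem_Bl, kap, norm_smul, norm_inv, Real.norm_eq_abs, abs_of_pos (by positivity),
    inv_mul_le_iff₀ (by positivity)]
  simp

lemma kap_sp {x : E} (hx : 1/2 ≤ ‖x‖) : kap x ∈ Sp E := by
  rw [mem_Sp, kap, norm_smul, norm_inv, Real.norm_eq_abs, abs_of_pos (by positivity), max_eq_right hx,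
    inv_mul_cancel₀ (by linarith)]

lemma kap_eq {x : E} (hx : x ∈ Sp E) : kap x = x := by
  rw [mem_Sp] at hx
  rw [kap, hx]; norm_num

lemma Bl_convex_comb {x y : E} (hx : x ∈ Bl E) (hy : y ∈ Bl E) {σ : ℝ} (hσ : σ ∈ II) :
    (1 - σ) • x + σ • y ∈ Bl E :=
  (convex_closedBall (0:E) 1) hx hy (by linarith [hσ.2]) hσ.1 (by ring)

theorem comp_of_solv {j : P → Z} (hS : ∀ (g : E → Z) (β : E → P), ContinuousOn g (Bl E) →
    ContinuousOn β (Sp E) → (∀ a ∈ Sp E, j (β a) = g a) → Solv j g β) : Comp E j := by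
  intro g β hg hβ hgβ
  obtain ⟨G₁, hG₁, H, h, c1, c2, c3, c4, c5, c6, c7⟩ := hS g β hg hβ hgβ
  have kc := kap_cont (E := E)
  set T : E → ℝ := fun x => min 1 (2 - 2 * ‖x‖) with hT
  have Tc : Continuous T := by fun_prop
  have TII : ∀ x ∈ Bl E, T x ∈ II := by
    intro x hx
    rw [mem_Bl] at hx
    exact ⟨le_min zero_le_one (by linarith), min_le_left _ _⟩
  have T1 : ∀ x : E, ‖x‖ ≤ 1/2 → T x = 1 := fun x hx => min_eq_left (by linarith)
  have T0 : ∀ x ∈ Sp E, T x = 0 := by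
    intro x hx; rw [mem_Sp] at hx; simp [hT, hx]
  refine ⟨fun x => if ‖x‖ ≤ 1/2 then G₁ (kap x) else h (T x, kap x),
    fun p => H (p.1 * T p.2, (1 - p.1) • p.2 + p.1 • kap p.2), ?_, ?_, ?_, ?_, ?_, ?_⟩
  · refine glue_contOn (s₁ := {x | ‖x‖ ≤ 1/2}) (s₂ := {x | 1/2 ≤ ‖x‖})
      (f₁ := fun x => G₁ (kap x)) (f₂ := fun x => h (T x, kap x))
      (isClosed_le continuous_norm continuous_const) (isClosed_le continuous_const continuous_norm)
      (fun p _ => by simp only [Set.mem_union, Set.mem_ofPred_eq]; exact le_total _ _) ?_ ?_ ?_ ?_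
    · exact hG₁.comp kc.continuousOn (fun x _ => kap_mem x)
    · refine c2.comp (Tc.prodMk kc).continuousOn ?_
      rintro x ⟨hx, hx2⟩
      exact ⟨TII x hx, kap_sp hx2⟩
    · rintro x ⟨_, hx⟩
      exact if_pos hx
    · rintro x ⟨_, hx⟩
      by_cases h' : ‖x‖ ≤ 1/2
      · simp only [if_pos h']
        rw [T1 x h', c6 _ (kap_sp hx)]
      · simp only [if_neg h']
  · intro a ha
    have : ¬ ‖a‖ ≤ 1/2 := by rw [mem_Sp.1 ha]; norm_num
    simp only [if_neg this]
    rw [T0 a ha, kap_eq ha, c5 a ha]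
  · refine c1.comp ?_ ?_
    · apply Continuous.continuousOn; fun_prop
    · rintro ⟨t, x⟩ ⟨ht, hx⟩
      exact ⟨unitInterval.mul_mem ht (TII x hx), Bl_convex_comb hx (kap_mem x) ht⟩
  · intro x hx
    simp [c3 x hx]
  · intro x hx
    simp only [one_mul, sub_self, zero_smul, zero_add, one_smul]
    by_cases h' : ‖x‖ ≤ 1/2
    · simp only [if_pos h']
      rw [T1 x h', c4 _ (kap_mem x)]
    · simp only [if_neg h']
      exact c7 _ (TII x hx) _ (kap_sp (by linarith))
  · intro t ht a ha
    simp only [T0 a ha, kap_eq ha, mul_zero, ← add_smul]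
    simp [c3 a (Sp_sub_Bl ha)]

theorem solv_of_comp {j : P → Z} (hC : Comp E j) {g : E → Z} {β : E → P}
    (hg : ContinuousOn g (Bl E)) (hβ : ContinuousOn β (Sp E)) (h : ∀ a ∈ Sp E, j (β a) = g a) :
    Solv j g β := by
  obtain ⟨G, H, c1, c2, c3, c4, c5, c6⟩ := hC g β hg hβ h
  refine ⟨G, c1, H, fun p => β p.2, c3, hβ.comp continuousOn_snd (fun p hp => hp.2), c4, c5,
    fun _ _ => rfl, fun a ha => (c2 a ha).symm, ?_⟩
  intro τ hτ a ha
  rw [c6 τ hτ a ha, h a ha]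

lemma Solv.of_PH {j : P → Z} {g g' : E → Z} {β β' : E → P} (h : PH j g β g' β')
    (hs : Solv j g' β') : Solv j g β := by
  obtain ⟨G, hG, hp⟩ := hs
  exact ⟨G, hG, h.trans hp⟩

theorem Comp.comp {j₁ : P → Q} {j₂ : Q → Z} (h₂ : Comp E j₂) (h₁ : Comp E j₁)
    (hc₁ : Continuous j₁) (hc₂ : Continuous j₂) : Comp E (fun p => j₂ (j₁ p)) := by
  intro g β hg hβ hgβ
  obtain ⟨G, H, c1, c2, c3, c4, c5, c6⟩ :=
    h₂ g (fun x => j₁ (β x)) hg (hc₁.comp_continuousOn hβ) hgβ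
  obtain ⟨G', H', d1, d2, d3, d4, d5, d6⟩ := h₁ G β c1 hβ (fun a ha => (c2 a ha).symm)
  refine ⟨G', _, d1, d2, concat_contOn c3 (hc₂.comp_continuousOn d3) ?_, ?_, ?_, ?_⟩
  · intro x hx
    simp only [Function.comp]
    rw [c5 x hx, d4 x hx]
  · intro x hx; norm_num; exact c4 x hx
  · intro x hx; norm_num [Function.comp]; rw [d5 x hx]
  · rintro τ ⟨h0, h1⟩ a ha
    by_cases h : τ ≤ 1/2
    · simp only [if_pos h]
      exact c6 _ ⟨by linarith, by linarith⟩ a ha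
    · simp only [if_neg h, Function.comp]
      rw [d6 _ ⟨by linarith, by linarith⟩ a ha, c2 a ha]; exact hgβ a ha

theorem comp_of_inverse {j : P → Z} {i : Z → P} (hc₂ : Continuous i)
    (h1 : ∀ p, i (j p) = p) (h2 : ∀ z, j (i z) = z) : Comp E j := by
  intro g β hg hβ hgβ
  refine ⟨fun x => i (g x), fun p => g p.2, hc₂.comp_continuousOn hg, ?_,
    hg.comp continuousOn_snd (fun p hp => hp.2), fun _ _ => rfl, fun _ _ => (h2 _).symm,
    fun _ _ _ _ => rfl⟩
  intro a ha
  simp only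
  rw [← hgβ a ha, h1]

/-- homotopy extension -/
theorem hep {g : E → Z} {f : ℝ × E → Z} (hg : ContinuousOn g (Bl E))
    (hf : ContinuousOn f (II ×ˢ Sp E)) (e : ∀ a ∈ Sp E, f (0, a) = g a) :
    ∃ H : ℝ × E → Z, ContinuousOn H (II ×ˢ Bl E) ∧ (∀ x ∈ Bl E, H (0, x) = g x) ∧
      ∀ τ ∈ II, ∀ a ∈ Sp E, H (τ, a) = f (τ, a) := by
  refine ⟨fun p => if ‖p.2‖ ≤ (2 - p.1) / 2 then g ((2 / (2 - p.1)) • p.2) else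
    f (2 - (2 - p.1) / ‖p.2‖, ‖p.2‖⁻¹ • p.2), ?_, ?_, ?_⟩
  · refine glue_contOn (s₁ := {p | ‖p.2‖ ≤ (2 - p.1) / 2}) (s₂ := {p | (2 - p.1) / 2 ≤ ‖p.2‖})
      (f₁ := fun p => g ((2 / (2 - p.1)) • p.2))
      (f₂ := fun p => f (2 - (2 - p.1) / ‖p.2‖, ‖p.2‖⁻¹ • p.2))
      (isClosed_le (by fun_prop) (by fun_prop)) (isClosed_le (by fun_prop) (by fun_prop))
      (fun p _ => by simp only [Set.mem_union, Set.mem_ofPred_eq]; exact le_total _ _) ?_ ?_ ?_ ?_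
    · refine hg.comp ?_ ?_
      · refine ContinuousOn.smul (ContinuousOn.div continuousOn_const (by fun_prop) ?_) (by fun_prop)
        rintro ⟨t, x⟩ ⟨⟨⟨_, h1⟩, _⟩, _⟩
        simp only at h1 ⊢
        linarith
      · rintro ⟨t, x⟩ ⟨⟨⟨_, h1⟩, _⟩, h2⟩
        simp only [Set.mem_ofPred_eq] at h1 h2 ⊢
        have : 0 < 2 - t := by linarith
        rw [mem_Bl, norm_smul, Real.norm_eq_abs, abs_of_pos (by positivity), div_mul_eq_mul_div,
          div_le_one this]
        linarith
    · have pos : ∀ p ∈ (II ×ˢ Bl E) ∩ {p : ℝ × E | (2 - p.1) / 2 ≤ ‖p.2‖}, ‖p.2‖ ≠ 0 := by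
        rintro ⟨t, x⟩ ⟨⟨⟨_, h1⟩, _⟩, h2⟩
        simp only [Set.mem_ofPred_eq] at h1 h2 ⊢
        intro h; linarith
      refine hf.comp ?_ ?_
      · refine ContinuousOn.prodMk (ContinuousOn.sub continuousOn_const
          (ContinuousOn.div (by fun_prop) (by fun_prop) pos))
          (ContinuousOn.smul (ContinuousOn.inv₀ (by fun_prop) pos) (by fun_prop))
      · rintro ⟨t, x⟩ hh
        have hp := pos _ hh
        obtain ⟨⟨⟨h0, h1⟩, hx⟩, h2⟩ := hh
        simp only [Set.mem_ofPred_eq] at h0 h1 h2 hp ⊢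
        rw [mem_Bl] at hx
        have hp' : 0 < ‖x‖ := lt_of_le_of_ne (norm_nonneg _) (Ne.symm hp)
        refine ⟨⟨?_, ?_⟩, ?_⟩
        · simp only [sub_nonneg]; rw [div_le_iff₀ hp']; linarith
        · simp only
          have : 1 ≤ (2 - t) / ‖x‖ := by rw [le_div_iff₀ hp']; linarith
          linarith
        · rw [mem_Sp, norm_smul, norm_inv, norm_norm, inv_mul_cancel₀ hp]
    · rintro ⟨t, x⟩ ⟨_, h⟩
      exact if_pos h
    · rintro ⟨t, x⟩ ⟨⟨⟨_, h1⟩, hx⟩, h⟩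
      simp only [Set.mem_ofPred_eq] at h h1 hx ⊢
      by_cases h' : ‖x‖ ≤ (2 - t) / 2
      · have heq : ‖x‖ = (2 - t) / 2 := le_antisymm h' h
        have h2t : (2 - t) ≠ 0 := by linarith
        have hp : ‖x‖ ≠ 0 := by rw [heq]; exact div_ne_zero h2t two_ne_zero
        rw [if_pos h']
        have e1 : 2 - (2 - t) / ‖x‖ = 0 := by rw [heq]; field_simp; ring
        have e2 : 2 / (2 - t) = ‖x‖⁻¹ := by rw [heq, inv_div]
        rw [e1, e, e2]
        rw [mem_Sp, norm_smul, norm_inv, norm_norm, inv_mul_cancel₀ hp]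
      · rw [if_neg h']
  · intro x hx
    rw [mem_Bl] at hx
    have : ‖x‖ ≤ (2 - 0) / 2 := by linarith
    simp only [if_pos this]
    norm_num
  · intro t ht a ha
    have h1 := mem_Sp.1 ha
    simp only [h1]
    by_cases h : (1:ℝ) ≤ (2 - t) / 2
    · have : t = 0 := le_antisymm (by linarith) ht.1
      subst this
      norm_num
      rw [e a ha]
    · rw [if_neg h]; norm_num

end framework

end Part1

section Part2
/-! ### From compression to homotopy groups -/

def toCube {k : ℕ} (x : Fin k → ℝ) : Fin k → unitInterval :=
  fun i => Set.projIcc 0 1 zero_le_one ((x i + 1) / 2)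

def ofCube {k : ℕ} (y : Fin k → unitInterval) : Fin k → ℝ := fun i => 2 * (y i : ℝ) - 1

lemma toCube_cont {k : ℕ} : Continuous (toCube (k := k)) :=
  continuous_pi fun i => continuous_projIcc.comp (by fun_prop)

lemma ofCube_cont {k : ℕ} : Continuous (ofCube (k := k)) := by
  unfold ofCube
  fun_prop

lemma toCube_ofCube {k : ℕ} (y : Fin k → unitInterval) : toCube (ofCube y) = y := by
  funext i
  have : (ofCube y i + 1) / 2 = (y i : ℝ) := by simp [ofCube]
  rw [toCube, this]
  exact Set.projIcc_val _ (y i)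

lemma ofCube_mem {k : ℕ} (y : Fin k → unitInterval) : ofCube y ∈ Bl (Fin k → ℝ) := by
  rw [mem_Bl, pi_norm_le_iff_of_nonneg zero_le_one]
  intro i
  have h0 := (y i).2.1
  have h1 := (y i).2.2
  rw [Real.norm_eq_abs, abs_le]
  constructor <;> simp only [ofCube] <;> linarith

lemma exists_abs_one {k : ℕ} {x : Fin k → ℝ} (hx : x ∈ Sp (Fin k → ℝ)) : ∃ i, x i = 1 ∨ x i = -1 := by
  rw [mem_Sp] at hx
  by_contra hc
  push Not at hc
  have : ‖x‖ < 1 := by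
    rw [pi_norm_lt_iff one_pos]
    intro i
    have h1 := norm_le_pi_norm x i
    rw [hx] at h1
    refine lt_of_le_of_ne h1 ?_
    intro h
    rw [Real.norm_eq_abs, abs_eq zero_le_one] at h
    rcases h with h | h
    · exact (hc i).1 h
    · exact (hc i).2 h
  linarith

lemma toCube_one {k : ℕ} {x : Fin k → ℝ} {i : Fin k} (h : x i = 1) : toCube x i = 1 := by
  rw [toCube, h]; norm_num
lemma toCube_neg_one {k : ℕ} {x : Fin k → ℝ} {i : Fin k} (h : x i = -1) : toCube x i = 0 := by
  rw [toCube, h]; norm_num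

lemma toCube_bdry {k : ℕ} {x : Fin k → ℝ} (hx : x ∈ Sp (Fin k → ℝ)) :
    toCube x ∈ Cube.boundary (Fin k) := by
  obtain ⟨i, h | h⟩ := exists_abs_one hx
  · exact ⟨i, Or.inr (toCube_one h)⟩
  · exact ⟨i, Or.inl (toCube_neg_one h)⟩

lemma ofCube_sp {k : ℕ} {y : Fin k → unitInterval} {i : Fin k} (hy : y i = 0 ∨ y i = 1) :
    ofCube y ∈ Sp (Fin k → ℝ) := by
  rw [mem_Sp]
  refine le_antisymm (mem_Bl.1 (ofCube_mem y)) ?_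
  refine le_trans ?_ (norm_le_pi_norm _ i)
  rcases hy with h | h <;> simp [ofCube, h] ; norm_num

theorem piMap_surj {k : ℕ} {X Y : Type*} [TopologicalSpace X] [TopologicalSpace Y]
    (f : C(X, Y)) (x : X) (h : Comp (Fin k → ℝ) f) : Function.Surjective (piMap k f x) := by
  intro c
  induction c using Quotient.inductionOn with
  | _ p =>
    obtain ⟨G, H, c1, c2, c3, c4, c5, c6⟩ := h (fun y => p.1 (toCube y)) (fun _ => x)
      (by exact (p.1.continuous.comp toCube_cont).continuousOn) continuousOn_const
      (fun a ha => (p.2 _ (toCube_bdry ha)).symm)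
    have Gc : Continuous (fun y : Fin k → unitInterval => G (ofCube y)) :=
      c1.comp_continuous ofCube_cont ofCube_mem
    have Hc : Continuous (fun y : unitInterval × (Fin k → unitInterval) => H (y.1, ofCube y.2)) :=
      c3.comp_continuous (by have := ofCube_cont (k := k); fun_prop) (fun y => ⟨y.1.2, ofCube_mem _⟩)
    refine ⟨Quotient.mk _ ⟨⟨_, Gc⟩, ?_⟩, ?_⟩
    · rintro y ⟨i, hi⟩
      exact c2 _ (ofCube_sp hi)
    · refine Quotient.sound (Setoid.symm ?_)
      refine ⟨⟨⟨⟨_, Hc⟩, ?_, ?_⟩, ?_⟩⟩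
      · intro y
        show H (0, ofCube y) = p.1 y
        rw [c4 _ (ofCube_mem y), toCube_ofCube]
      · intro y
        show H (1, ofCube y) = f (G (ofCube y))
        rw [c5 _ (ofCube_mem y)]
      · rintro t y ⟨i, hi⟩
        show H (t, ofCube y) = p.1 y
        rw [c6 _ t.2 _ (ofCube_sp hi), toCube_ofCube]

theorem piMap_inj {k : ℕ} {X Y : Type*} [TopologicalSpace X] [TopologicalSpace Y]
    (f : C(X, Y)) (x : X) (h : Comp (Fin (k+1) → ℝ) f) : Function.Injective (piMap k f x) := by
  intro c₁ c₂ hc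
  induction c₁ using Quotient.inductionOn with
  | _ p₁ =>
  induction c₂ using Quotient.inductionOn with
  | _ p₂ =>
    obtain ⟨K⟩ := Quotient.exact hc
    let tl : (Fin (k+1) → ℝ) → (Fin k → unitInterval) := fun z i => toCube z i.succ
    have tlc : Continuous tl := by
      have := toCube_cont (k := k+1)
      fun_prop
    have hd : Continuous (fun z : Fin (k+1) → ℝ => toCube z 0) := by
      have := toCube_cont (k := k+1)
      fun_prop
    have K0 : ∀ y, K (0, y) = f (p₁.1 y) := fun y => K.apply_zero y
    have K1 : ∀ y, K (1, y) = f (p₂.1 y) := fun y => K.apply_one y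
    have Kb : ∀ t, ∀ y ∈ Cube.boundary (Fin k), K (t, y) = f x := by
      intro t y hy
      have := K.eq_fst t hy
      rw [this]
      show f (p₁.1 y) = f x
      rw [p₁.2 y hy]
    have side : ∀ a ∈ Sp (Fin (k+1) → ℝ), a 0 = 1 ∨ a 0 = -1 ∨ tl a ∈ Cube.boundary (Fin k) := by
      intro a ha
      obtain ⟨i, hi⟩ := exists_abs_one ha
      induction i using Fin.cases with
      | zero => tauto
      | succ i =>
        right; right
        rcases hi with hi | hi
        · exact ⟨i, Or.inr (toCube_one hi)⟩
        · exact ⟨i, Or.inl (toCube_neg_one hi)⟩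
    obtain ⟨G, -, c1, c2, -⟩ := h (fun z => K (toCube z 0, tl z))
      (fun z => if z 0 ≤ 0 then p₁.1 (tl z) else p₂.1 (tl z))
      (by exact (K.continuous.comp (hd.prodMk tlc)).continuousOn)
      (by
        refine glue_contOn (s₁ := {z | z 0 ≤ 0}) (s₂ := {z | 0 ≤ z 0})
          (f₁ := fun z => p₁.1 (tl z)) (f₂ := fun z => p₂.1 (tl z))
          (isClosed_le (by fun_prop) (by fun_prop)) (isClosed_le (by fun_prop) (by fun_prop))
          (fun p _ => by simp only [Set.mem_union, Set.mem_ofPred_eq]; exact le_total _ _)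
          (by fun_prop) (by fun_prop) ?_ ?_
        · rintro z ⟨_, hz⟩
          exact if_pos hz
        · rintro z ⟨hz, hz2⟩
          simp only [Set.mem_ofPred_eq] at hz2
          by_cases hz3 : z 0 ≤ 0
          · have hb : tl z ∈ Cube.boundary (Fin k) := by
              rcases side z hz with h | h | h
              · linarith
              · linarith
              · exact h
            rw [if_pos hz3]
            exact (p₁.2 _ hb).trans (p₂.2 _ hb).symm
          · rw [if_neg hz3])
      (by
        intro a ha
        rcases side a ha with h | h | h
        · have : ¬ a 0 ≤ 0 := by rw [h]; norm_num
          simp only [if_neg this]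
          rw [toCube_one h, K1]
        · have : a 0 ≤ 0 := by rw [h]; norm_num
          simp only [if_pos this]
          rw [toCube_neg_one h, K0]
        · rw [Kb _ _ h]
          have e1 : p₁.1 (tl a) = x := p₁.2 _ h
          have e2 : p₂.1 (tl a) = x := p₂.2 _ h
          simp only [e1, e2, ite_self])
    refine Quotient.sound ?_
    let J : unitInterval × (Fin k → unitInterval) → Fin (k+1) → unitInterval :=
      fun y => Fin.cons y.1 y.2
    have Jc : Continuous J := by
      refine continuous_pi fun i => ?_
      induction i using Fin.cases with
      | zero => exact continuous_fst
      | succ i => exact (continuous_apply i).comp continuous_snd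
    have Gc : Continuous (fun y : unitInterval × (Fin k → unitInterval) => G (ofCube (J y))) :=
      c1.comp_continuous (ofCube_cont.comp Jc) (fun y => ofCube_mem _)
    have tlJ : ∀ t y, tl (ofCube (J (t, y))) = y := by
      intro t y
      funext i
      show toCube (ofCube (J (t, y))) i.succ = y i
      rw [toCube_ofCube]; rfl
    refine ⟨⟨⟨⟨_, Gc⟩, ?_, ?_⟩, ?_⟩⟩
    · intro y
      show G (ofCube (J (0, y))) = p₁.1 y
      have e : ofCube (J (0, y)) 0 = -1 := by simp [ofCube, J]
      rw [c2 _ (ofCube_sp (i := 0) (Or.inl rfl)), tlJ, e, if_pos (by norm_num)]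
    · intro y
      show G (ofCube (J (1, y))) = p₂.1 y
      have e : ofCube (J (1, y)) 0 = 1 := by simp [ofCube, J]; norm_num
      rw [c2 _ (ofCube_sp (i := 0) (Or.inr rfl)), tlJ, e, if_neg (by norm_num)]
    · rintro t y ⟨i, hi⟩
      show G (ofCube (J (t, y))) = p₁.1 y
      rw [c2 _ (ofCube_sp (i := i.succ) hi), tlJ]
      have e1 : p₁.1 y = x := p₁.2 _ ⟨i, hi⟩
      have e2 : p₂.1 y = x := p₂.2 _ ⟨i, hi⟩
      simp only [e1, e2, ite_self]

end Part2

section Part3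
/-! ### Part D: local data -/

abbrev S1 := OnePoint ℝ
abbrev CM := C(S1, ℂ)

def eps (b : Bool) : ℂ := if b then Complex.I else 1
def sg (b : Bool) : ℝ := if b then -1 else 1
def top (b : Bool) : ℝ := if b then 0 else 1

lemma eps_ne (b : Bool) : eps b ≠ 0 := by cases b <;> simp [eps]

structure BD (d : ℕ) where
  ω : ℝ → ℂ
  θ : CM
  β : ℕ → CM
  ω_ne : ∀ t, ω t ≠ 0
  ω_smooth : ContDiff ℝ 1 ω
  θ_infty : θ OnePoint.infty = 1
  θ_coe : ∀ t : ℝ, θ (t : S1) = ω t / star (ω t)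
  β_coe : ∀ i ≤ d, ∀ t : ℝ, β i (t : S1) = ω t * (t : ℂ) ^ i
  β_infty : ∀ i < d, β i OnePoint.infty = 0
  β_top : β d OnePoint.infty = 1

namespace BD
variable {d : ℕ} (X : BD d)

def u (b : Bool) (t : ℝ) : ℂ := eps b * X.ω t
lemma u_ne (b : Bool) (t : ℝ) : X.u b t ≠ 0 := mul_ne_zero (eps_ne b) (X.ω_ne t)
lemma u_smooth (b : Bool) : ContDiff ℝ 1 (X.u b) := contDiff_const.mul X.ω_smooth

def R (b : Bool) (m : CM) : CM := m + (sg b : ℂ) • (X.θ * star m)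
def F (b : Bool) (m : CM) (t : ℝ) : ℝ := (m (t : S1) / X.u b t).re
def pv (_X : BD d) (b : Bool) (a : Fin d → ℝ) (t : ℝ) : ℝ := top b * t ^ d + ∑ i : Fin d, a i * t ^ (i : ℕ)
def pol (b : Bool) (a : Fin d → ℝ) : CM :=
  (top b : ℂ) • X.β d + ∑ i : Fin d, ((a i : ℂ) * eps b) • X.β i
def rep (b : Bool) (a : Fin d → ℝ) (m : CM) : CM := m - (1/2 : ℂ) • X.R b m + X.pol b a

lemma R_coe (b : Bool) (m : CM) (t : ℝ) : X.R b m (t : S1) = 2 * X.u b t * (X.F b m t : ℂ) := by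
  have hu := X.u_ne b t
  have hw := X.ω_ne t
  have hw' : star (X.ω t) ≠ 0 := by simpa using hw
  set w := m (t : S1) / X.u b t with hw0
  have hm : m (t : S1) = w * X.u b t := by rw [hw0, div_mul_cancel₀ _ hu]
  have h1 : (X.F b m t : ℂ) = (w + star w) / 2 := by
    show ((w.re : ℝ) : ℂ) = _
    rw [Complex.re_eq_add_conj]; rfl
  have h2 : X.R b m (t : S1) = m (t : S1) + (sg b : ℂ) * (X.ω t / star (X.ω t) * star (m (t : S1))) := by
    simp [R, X.θ_coe]
  rw [h2, hm, h1, star_mul', u, star_mul']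
  have : (sg b : ℂ) * star (eps b) = eps b := by cases b <;> simp [sg, eps]
  have h3 : (sg b : ℂ) * (X.ω t / star (X.ω t) * (star w * (star (eps b) * star (X.ω t))))
      = (sg b * star (eps b)) * X.ω t * star w := by field_simp
  rw [h3, this]; ring

lemma R_infty (b : Bool) {m : CM} (hm : m OnePoint.infty = 1) :
    X.R b m OnePoint.infty = 1 + (sg b : ℂ) := by
  simp [R, X.θ_infty, hm]

lemma R_cont (b : Bool) : Continuous (X.R b) := by
  unfold R
  exact continuous_id.add ((continuous_const.mul continuous_star).const_smul (sg b : ℂ))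

lemma pol_coe (b : Bool) (a : Fin d → ℝ) (t : ℝ) :
    X.pol b a (t : S1) = X.u b t * (X.pv b a t : ℂ) := by
  simp only [pol, pv, u, ContinuousMap.add_apply, ContinuousMap.smul_apply, ContinuousMap.coe_sum,
    Finset.sum_apply, smul_eq_mul, X.β_coe d le_rfl]
  have : ∀ i : Fin d, X.β i (t : S1) = X.ω t * (t : ℂ) ^ (i : ℕ) := fun i => X.β_coe i i.2.le t
  simp only [this]
  push_cast
  rw [mul_add, Finset.mul_sum]
  congr 1
  · cases b <;> simp [eps, top]
  · exact Finset.sum_congr rfl fun i _ => by ring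

lemma pol_infty (b : Bool) (a : Fin d → ℝ) : X.pol b a OnePoint.infty = top b := by
  simp [pol, X.β_top, X.β_infty]

lemma pol_cont (b : Bool) : Continuous (X.pol b) := by
  unfold pol; fun_prop

lemma F_add (b : Bool) (m m' : CM) (t : ℝ) : X.F b (m + m') t = X.F b m t + X.F b m' t := by
  simp [F, add_div]
lemma F_sub (b : Bool) (m m' : CM) (t : ℝ) : X.F b (m - m') t = X.F b m t - X.F b m' t := by
  simp [F, sub_div]
lemma F_smul (b : Bool) (c : ℝ) (m : CM) (t : ℝ) : X.F b (c • m) t = c * X.F b m t := by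
  simp [F, mul_div_assoc]
lemma F_sum (b : Bool) {ι : Type*} (s : Finset ι) (m : ι → CM) (t : ℝ) :
    X.F b (∑ i ∈ s, m i) t = ∑ i ∈ s, X.F b (m i) t := by
  induction s using Finset.induction_on with
  | empty => simp [F]
  | insert i s hi ih => rw [Finset.sum_insert hi, Finset.sum_insert hi, F_add, ih]

/-- value of the coordinate `b'` of `u_b * x` for `x` real. -/
lemma F_of_coe (b b' : Bool) {m : CM} {t : ℝ} {x : ℝ} (h : m (t : S1) = X.u b t * (x : ℂ)) :
    X.F b' m t = if b' = b then x else 0 := by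
  have hw := X.ω_ne t
  rw [F, h, u, u]
  have e1 : eps b * X.ω t * (x:ℂ) / (eps b' * X.ω t) = eps b / eps b' * x := by
    field_simp
  rw [e1]
  cases b <;> cases b' <;> simp [eps]

lemma F_pol (b b' : Bool) (a : Fin d → ℝ) (t : ℝ) :
    X.F b' (X.pol b a) t = if b' = b then X.pv b a t else 0 := X.F_of_coe b b' (X.pol_coe b a t)

lemma F_R (b b' : Bool) (m : CM) (t : ℝ) :
    X.F b' (X.R b m) t = if b' = b then 2 * X.F b m t else 0 :=
  X.F_of_coe b b' (by rw [R_coe]; push_cast; ring)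

lemma F_rep (b b' : Bool) (a : Fin d → ℝ) (m : CM) (t : ℝ) :
    X.F b' (X.rep b a m) t = if b' = b then X.pv b a t else X.F b' m t := by
  have : (1/2 : ℂ) • X.R b m = (1/2 : ℝ) • X.R b m := by
    ext x; simp
  rw [rep, F_add, F_sub, this, F_smul, F_pol, F_R]
  split_ifs with h
  · subst h; ring
  · ring

lemma rep_infty (b : Bool) (a : Fin d → ℝ) {m : CM} (hm : m OnePoint.infty = 1) :
    X.rep b a m OnePoint.infty = 1 := by
  have := X.R_infty b hm
  simp only [rep, ContinuousMap.add_apply, ContinuousMap.sub_apply, ContinuousMap.smul_apply, this,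
    pol_infty, hm]
  cases b <;> simp [sg, top]; norm_num

lemma coe_eq (m : CM) (t : ℝ) :
    m (t : S1) = X.ω t * ((X.F false m t : ℂ) + Complex.I * X.F true m t) := by
  have hw := X.ω_ne t
  have h : (X.F false m t : ℂ) + Complex.I * X.F true m t = m (t : S1) / X.ω t := by
    apply Complex.ext
    · simp [F, u, eps]
    · have : m (t : S1) / (Complex.I * X.ω t) = -Complex.I * (m (t : S1) / X.ω t) := by
        field_simp; simp
      simp [F, u, eps, this]
  rw [h, mul_div_cancel₀ _ hw]

lemma ne_zero_iff (m : CM) (t : ℝ) : m (t : S1) ≠ 0 ↔ ∃ b, X.F b m t ≠ 0 := by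
  constructor
  · intro h
    by_contra hc
    push Not at hc
    rw [X.coe_eq, hc, hc] at h
    simp at h
  · rintro ⟨b, hb⟩ h
    apply hb
    simp [F, h]

def IsP (b : Bool) (m : CM) : Prop := ∃ a : Fin d → ℝ, ∀ t : ℝ, X.F b m t = X.pv b a t

lemma pv_comb {b : Bool} (a a' : Fin d → ℝ) (t : ℝ) {σ τ : ℝ} (h : σ + τ = 1) :
    X.pv b (σ • a + τ • a') t = σ * X.pv b a t + τ * X.pv b a' t := by
  simp only [pv, Pi.add_apply, Pi.smul_apply, smul_eq_mul, add_mul, Finset.sum_add_distrib, mul_add,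
    Finset.mul_sum]
  obtain rfl : σ = 1 - τ := by linarith
  simp only [mul_assoc]
  ring

lemma isP_convex (b : Bool) : Convex ℝ {m | X.IsP b m} := by
  rintro m ⟨a, ha⟩ m' ⟨a', ha'⟩ σ τ _ _ h
  refine ⟨σ • a + τ • a', fun t => ?_⟩
  rw [F_add, F_smul, F_smul, ha, ha', X.pv_comb _ _ _ h]

end BD

end Part3

section Part4
/-! ### General position -/

lemma contDiff_det {V : Type*} [NormedAddCommGroup V] [NormedSpace ℝ V] {s : ℕ}
    {A : V → Matrix (Fin s) (Fin s) ℝ} (hA : ∀ i l, ContDiff ℝ 1 (fun x => A x i l)) :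
    ContDiff ℝ 1 (fun x => (A x).det) := by
  simp only [Matrix.det_apply']
  refine ContDiff.sum fun σ _ => contDiff_const.mul ?_
  exact contDiff_prod fun i _ => hA _ _

lemma gen_pos {J : Type*} [Fintype J] [Nonempty J] {E : Type*} [NormedAddCommGroup E]
    [NormedSpace ℝ E] [FiniteDimensional ℝ E] (f : J → E → ℝ → ℝ)
    (hf : ∀ j, ContDiff ℝ 1 (fun p : E × ℝ => f j p.1 p.2)) (s c : ℕ) (hs : 0 < s)
    (hdim : Module.finrank ℝ E + s < s * c) {δ : ℝ} (hδ : 0 < δ) :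
    ∃ v : J → Fin s → ℝ, ‖v‖ < δ ∧ ∀ (b : E) (t : Fin s → ℝ), StrictMono t →
      ¬ ∀ i, ∃ τ : Finset J, τ.card = c ∧ ∀ j ∈ τ, f j b (t i) + ∑ l, v j l * t i ^ (l : ℕ) = 0 := by
  let Tt := {τ : Fin s → Finset J // ∀ i, (τ i).card = c}
  let dom := fun τ : Tt => E × (Fin s → ℝ) × ({p : J × Fin s // p.1 ∉ τ.1 p.2} → ℝ)
  let S : ∀ τ : Tt, Set (dom τ) := fun τ => {p | StrictMono p.2.1}
  let y : ∀ τ : Tt, dom τ → J → Fin s → ℝ := fun τ p j i =>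
    if h : j ∈ τ.1 i then - f j p.1 (p.2.1 i) else p.2.2 ⟨(j, i), h⟩
  let Ψ : ∀ τ : Tt, dom τ → J → Fin s → ℝ := fun τ p j l =>
    (Matrix.det (Matrix.vandermonde p.2.1))⁻¹ * Matrix.cramer (Matrix.vandermonde p.2.1) (y τ p j) l
  have hdet : ∀ t : Fin s → ℝ, StrictMono t → (Matrix.vandermonde t).det ≠ 0 := fun t ht =>
    Matrix.det_vandermonde_ne_zero_iff.2 ht.injective
  have hconv : ∀ τ, Convex ℝ (S τ) := by
    rintro τ p hp p' hp' a b ha hb hab i j hij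
    have h1 : p.2.1 i < p.2.1 j := hp hij
    have h2 : p'.2.1 i < p'.2.1 j := hp' hij
    show a * p.2.1 i + b * p'.2.1 i < a * p.2.1 j + b * p'.2.1 j
    rcases ha.eq_or_lt with h | h
    · subst h
      have : b = 1 := by linarith
      subst this; linarith
    · have := mul_lt_mul_of_pos_left h1 h
      have := mul_le_mul_of_nonneg_left h2.le hb
      linarith
  have hsm : ∀ τ, ContDiffOn ℝ 1 (Ψ τ) (S τ) := by
    intro τ
    have hV : ∀ i l, ContDiff ℝ 1 (fun p : dom τ => Matrix.vandermonde p.2.1 i l) := by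
      intro i l
      simp only [Matrix.vandermonde_apply]
      fun_prop
    refine contDiffOn_pi.2 fun j => contDiffOn_pi.2 fun l => ?_
    refine ContDiffOn.mul (ContDiffOn.inv (contDiff_det hV).contDiffOn (fun p hp => hdet _ hp)) ?_
    simp only [Matrix.cramer_apply]
    refine (contDiff_det ?_).contDiffOn
    intro i l'
    simp only [Matrix.updateCol_apply]
    by_cases hl : l' = l
    · simp only [if_pos hl, y]
      by_cases h : j ∈ τ.1 i
      · simp only [dif_pos h]
        refine ContDiff.neg ?_
        have : ContDiff ℝ 1 (fun p : dom τ => (p.1, p.2.1 i)) := by fun_prop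
        exact (hf j).comp this
      · simp only [dif_neg h]
        fun_prop
    · simp only [if_neg hl]
      exact hV i l'
  have hcard : ∀ τ : Tt, Fintype.card {p : J × Fin s // p.1 ∉ τ.1 p.2} + s * c = Fintype.card J * s := by
    intro τ
    have h1 : Fintype.card {p : J × Fin s // p.1 ∈ τ.1 p.2} = s * c := by
      have e : {p : J × Fin s // p.1 ∈ τ.1 p.2} ≃ (Σ i : Fin s, {j // j ∈ τ.1 i}) :=
        { toFun := fun p => ⟨p.1.2, ⟨p.1.1, p.2⟩⟩
          invFun := fun p => ⟨(p.2.1, p.1), p.2.2⟩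
          left_inv := fun p => rfl
          right_inv := fun p => rfl }
      rw [Fintype.card_congr e, Fintype.card_sigma]
      simp [τ.2]
    have h2 := Fintype.card_subtype_compl (fun p : J × Fin s => p.1 ∈ τ.1 p.2)
    have h3 := Fintype.card_subtype_le (fun p : J × Fin s => p.1 ∈ τ.1 p.2)
    rw [Fintype.card_prod, Fintype.card_fin] at h2 h3
    omega
  set n0 : ℕ := Module.finrank ℝ E + s + Fintype.card J * s - s * c with hn0
  have hJ : 0 < Fintype.card J * s := Nat.mul_pos Fintype.card_pos hs
  have hn0lt : n0 < Fintype.card J * s := by omega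
  have hdimle : ∀ τ, dimH (Ψ τ '' S τ) ≤ n0 := by
    intro τ
    refine ((hsm τ).dimH_image_le (hconv τ) le_rfl).trans ?_
    refine (dimH_mono (Set.subset_univ _)).trans ?_
    rw [Real.dimH_univ_eq_finrank]
    have : Module.finrank ℝ (dom τ) = Module.finrank ℝ E + (s + Fintype.card {p : J × Fin s // p.1 ∉ τ.1 p.2}) := by
      rw [Module.finrank_prod, Module.finrank_prod, Module.finrank_fintype_fun_eq_card,
        Module.finrank_fintype_fun_eq_card, Fintype.card_fin]
    rw [this]
    have := hcard τ
    exact_mod_cast (by omega)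
  have hbad : dimH (⋃ τ : Tt, Ψ τ '' S τ) < Module.finrank ℝ (J → Fin s → ℝ) := by
    have hfr : Module.finrank ℝ (J → Fin s → ℝ) = Fintype.card J * s := by
      rw [Module.finrank_pi_fintype]; simp
    rw [hfr, dimH_iUnion]
    refine lt_of_le_of_lt (iSup_le hdimle) ?_
    exact_mod_cast hn0lt
  have hdense := dense_compl_of_dimH_lt_finrank hbad
  obtain ⟨v, hv, hvδ⟩ := hdense.exists_dist_lt 0 hδ
  refine ⟨v, by simpa using hvδ, ?_⟩
  intro b t ht hall
  choose τ hτ1 hτ2 using hall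
  apply hv
  refine Set.mem_iUnion.2 ⟨⟨τ, hτ1⟩, ⟨(b, t, fun p => ∑ l, v p.1.1 l * t p.1.2 ^ (l : ℕ)), ht, ?_⟩⟩
  funext j l
  have hy : y ⟨τ, hτ1⟩ (b, t, fun p => ∑ l, v p.1.1 l * t p.1.2 ^ (l : ℕ)) j
      = (Matrix.vandermonde t).mulVec (v j) := by
    funext i
    have e : (Matrix.vandermonde t).mulVec (v j) i = ∑ l, v j l * t i ^ (l : ℕ) := by
      simp [Matrix.mulVec, dotProduct, Matrix.vandermonde_apply, mul_comm]
    rw [e]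
    simp only [y]
    split_ifs with h
    · linarith [hτ2 i j h]
    · rfl
  show (Matrix.det (Matrix.vandermonde t))⁻¹ * Matrix.cramer (Matrix.vandermonde t) (y ⟨τ, hτ1⟩ _ j) l = v j l
  rw [hy, Matrix.cramer_eq_adjugate_mulVec, Matrix.mulVec_mulVec, Matrix.adjugate_mul,
    Matrix.smul_mulVec, Matrix.one_mulVec, Pi.smul_apply, smul_eq_mul, inv_mul_cancel_left₀ (hdet t ht)]

end Part4

section Part5
/-! ### Families -/

namespace BD
variable {d : ℕ} (X : BD d)

def pol0 (b : Bool) (a : Fin d → ℝ) : CM := X.pol b a - X.pol b 0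

lemma pv_zero_sub (b : Bool) (a : Fin d → ℝ) (t : ℝ) :
    X.pv b a t - X.pv b 0 t = ∑ i : Fin d, a i * t ^ (i : ℕ) := by simp [pv]

lemma F_pol0 (b b' : Bool) (a : Fin d → ℝ) (t : ℝ) :
    X.F b' (X.pol0 b a) t = if b' = b then ∑ i : Fin d, a i * t ^ (i : ℕ) else 0 := by
  rw [pol0, F_sub, F_pol, F_pol, ← X.pv_zero_sub b]
  split_ifs <;> simp

lemma pol0_infty (b : Bool) (a : Fin d → ℝ) : X.pol0 b a OnePoint.infty = 0 := by
  simp [pol0, pol_infty]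

lemma pol0_coe (b : Bool) (a : Fin d → ℝ) (t : ℝ) :
    X.pol0 b a (t : S1) = X.u b t * ((∑ i : Fin d, a i * t ^ (i : ℕ) : ℝ) : ℂ) := by
  rw [← X.pv_zero_sub b, pol0, ContinuousMap.sub_apply, pol_coe, pol_coe]
  push_cast; ring

lemma pol0_cont (b : Bool) : Continuous (X.pol0 b) := (X.pol_cont b).sub continuous_const

lemma pol0_zero (b : Bool) : X.pol0 b 0 = 0 := by simp [pol0]

end BD

def ext0 {s : ℕ} (d : ℕ) (v : Fin s → ℝ) : Fin d → ℝ :=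
  fun i => if h : (i : ℕ) < s then v ⟨i, h⟩ else 0

lemma ext0_sum {s d : ℕ} (hsd : s ≤ d) (v : Fin s → ℝ) (t : ℝ) :
    ∑ i : Fin d, ext0 d v i * t ^ (i : ℕ) = ∑ l : Fin s, v l * t ^ (l : ℕ) := by
  let g : ℕ → ℝ := fun i => (if h : i < s then v ⟨i, h⟩ else 0) * t ^ i
  have h1 : ∑ i : Fin d, ext0 d v i * t ^ (i : ℕ) = ∑ i ∈ Finset.range d, g i :=
    Fin.sum_univ_eq_sum_range g d
  have h2 : ∑ l : Fin s, v l * t ^ (l : ℕ) = ∑ i ∈ Finset.range s, g i := by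
    rw [← Fin.sum_univ_eq_sum_range g s]
    exact Finset.sum_congr rfl fun i _ => by simp [g]
  rw [h1, h2]
  symm
  refine Finset.sum_subset (Finset.range_mono hsd) ?_
  intro i _ hi
  simp only [Finset.mem_range] at hi
  simp [g, hi]

section fam
set_option linter.unusedSectionVars false
variable {r : ℕ} {K : Set (Finset (Fin r))} {D : Fin r → ℕ}

def GoodM (K : Set (Finset (Fin r))) (m : Fin r → CM) : Prop :=
  (∀ k, m k OnePoint.infty = 1) ∧ ∀ x, (fun k => m k x) ∈ UK K

def InP (X : ∀ k, BD (D k)) (m : Fin r → CM) : Prop := ∀ k c, (X k).IsP c (m k)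

lemma InP_convex (X : ∀ k, BD (D k)) : Convex ℝ {m | InP X m} := by
  rintro m hm m' hm' a b ha hb hab k c
  exact (X k).isP_convex c (hm k c) (hm' k c) ha hb hab

lemma goodM_of (X : ∀ k, BD (D k)) (hE : ∅ ∈ K) {m : Fin r → CM}
    (h1 : ∀ k, m k OnePoint.infty = 1)
    (h2 : ∀ (t : ℝ) (σ : Finset (Fin r)), σ ∉ K → ∃ k ∈ σ, ∃ c, (X k).F c (m k) t ≠ 0) : GoodM K m := by
  refine ⟨h1, fun x => ?_⟩
  induction x using OnePoint.rec with
  | infty =>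
    have : (fun k => m k OnePoint.infty) = onesC := by funext k; exact h1 k
    rw [this]; exact ones_mem_UK hE
  | coe t =>
    rw [mem_UK]
    intro σ hσ
    obtain ⟨k, hk, hc⟩ := h2 t σ hσ
    exact ⟨k, hk, ((X k).ne_zero_iff _ _).2 hc⟩

lemma GoodM.exists (X : ∀ k, BD (D k)) {m : Fin r → CM} (h : GoodM K m) (t : ℝ)
    {σ : Finset (Fin r)} (hσ : σ ∉ K) : ∃ k ∈ σ, ∃ c, (X k).F c (m k) t ≠ 0 := by
  obtain ⟨k, hk, hne⟩ := mem_UK.1 (h.2 t) σ hσ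
  exact ⟨k, hk, ((X k).ne_zero_iff _ _).1 hne⟩

lemma isOpen_UK (K : Set (Finset (Fin r))) : IsOpen (UK K) := by
  have : UK K = ⋂ σ ∈ {s : Finset (Fin r) | s ∉ K}, (LSub σ)ᶜ := by
    simp [UK, Set.compl_iUnion]
  rw [this]
  refine (Set.toFinite _).isOpen_biInter fun σ _ => ?_
  rw [isOpen_compl_iff]
  have : LSub σ = ⋂ i ∈ σ, {x : Fin r → ℂ | x i = 0} := by
    ext x; simp [LSub]
  rw [this]
  exact isClosed_biInter fun i _ => isClosed_eq (continuous_apply i) continuous_const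

lemma eval_cont : Continuous (fun p : (Fin r → CM) × S1 => fun k => p.1 k p.2) := by
  refine continuous_pi fun k => ?_
  exact ((continuous_apply k).comp continuous_fst).eval continuous_snd

lemma isOpen_O (K : Set (Finset (Fin r))) : IsOpen {m : Fin r → CM | ∀ x, (fun k => m k x) ∈ UK K} := by
  have hc : IsClosed {p : (Fin r → CM) × S1 | (fun k => p.1 k p.2) ∉ UK K} := by
    rw [← isOpen_compl_iff]
    have : {p : (Fin r → CM) × S1 | (fun k => p.1 k p.2) ∉ UK K}ᶜ
      = (fun p : (Fin r → CM) × S1 => fun k => p.1 k p.2) ⁻¹' UK K := by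
      ext p; simp
    rw [this]
    exact (isOpen_UK K).preimage eval_cont
  have := isClosedMap_fst_of_compactSpace _ hc
  rw [← isOpen_compl_iff] at this
  convert this using 1
  ext m
  simp

variable {E : Type*} [NormedAddCommGroup E] [NormedSpace ℝ E] [FiniteDimensional ℝ E]

lemma exists_eps {U : E → Fin r → CM} (hU : ContinuousOn U (Bl E)) (hg : ∀ b ∈ Bl E, GoodM K (U b)) :
    ∃ ε > 0, ∀ b ∈ Bl E, ∀ m : Fin r → CM, ‖m - U b‖ < ε → (∀ k, m k OnePoint.infty = 1) → GoodM K m := by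
  have hc : IsCompact (U '' Bl E) := (isCompact_closedBall (0:E) 1).image_of_continuousOn hU
  obtain ⟨ε, hε, h⟩ := hc.exists_thickening_subset_open (isOpen_O K) (by
    rintro _ ⟨b, hb, rfl⟩
    exact (hg b hb).2)
  refine ⟨ε, hε, fun b hb m hm h1 => ⟨h1, ?_⟩⟩
  apply h
  rw [Metric.mem_thickening_iff]
  exact ⟨U b, ⟨b, hb, rfl⟩, by rwa [dist_eq_norm]⟩

/-- homotopy in the function space -/
def HR (X : ∀ k, BD (D k)) (K : Set (Finset (Fin r))) (g g' : E → Fin r → CM) : Prop :=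
  ∃ H : ℝ × E → Fin r → CM, ContinuousOn H (II ×ˢ Bl E) ∧ (∀ x ∈ Bl E, H (0, x) = g x) ∧
    (∀ x ∈ Bl E, H (1, x) = g' x) ∧ (∀ τ ∈ II, ∀ x ∈ Bl E, GoodM K (H (τ, x))) ∧
    ∀ τ ∈ II, ∀ a ∈ Sp E, InP X (H (τ, a))

lemma HR.trans {X : ∀ k, BD (D k)} {g g' g'' : E → Fin r → CM} (h₁ : HR X K g g') (h₂ : HR X K g' g'') :
    HR X K g g'' := by
  obtain ⟨H₁, c1, c2, c3, c4, c5⟩ := h₁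
  obtain ⟨H₂, d1, d2, d3, d4, d5⟩ := h₂
  refine ⟨_, concat_contOn c1 d1 (fun x hx => (c3 x hx).trans (d2 x hx).symm), ?_, ?_, ?_, ?_⟩
  · intro x hx; norm_num; exact c2 x hx
  · intro x hx; norm_num; exact d3 x hx
  all_goals
    rintro τ ⟨h0, h1⟩ a ha
    by_cases h : τ ≤ 1/2
    · simp only [if_pos h]
      first
      | exact c4 _ ⟨by linarith, by linarith⟩ a ha
      | exact c5 _ ⟨by linarith, by linarith⟩ a ha
    · simp only [if_neg h]
      first
      | exact d4 _ ⟨by linarith, by linarith⟩ a ha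
      | exact d5 _ ⟨by linarith, by linarith⟩ a ha

lemma HR.segment {X : ∀ k, BD (D k)} {g g' : E → Fin r → CM} (hg : ContinuousOn g (Bl E))
    (hg' : ContinuousOn g' (Bl E))
    (h : ∀ τ ∈ II, ∀ x ∈ Bl E, GoodM K ((1 - τ) • g x + τ • g' x))
    (h1 : ∀ a ∈ Sp E, InP X (g a)) (h2 : ∀ a ∈ Sp E, InP X (g' a)) : HR X K g g' := by
  refine ⟨fun p => (1 - p.1) • g p.2 + p.1 • g' p.2, ?_, ?_, ?_, h, ?_⟩
  · have e1 : ContinuousOn (fun p : ℝ × E => g p.2) (II ×ˢ Bl E) := hg.comp continuousOn_snd (fun p hp => hp.2)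
    have e2 : ContinuousOn (fun p : ℝ × E => g' p.2) (II ×ˢ Bl E) := hg'.comp continuousOn_snd (fun p hp => hp.2)
    have e3 : ContinuousOn (fun p : ℝ × E => p.1) (II ×ˢ Bl E) := continuousOn_fst
    have e4 : ContinuousOn (fun p : ℝ × E => 1 - p.1) (II ×ˢ Bl E) := continuousOn_const.sub e3
    exact (e4.smul e1).add (e3.smul e2)
  · intro x _; simp
  · intro x _; simp
  · intro τ hτ a ha
    exact InP_convex X (h1 a ha) (h2 a ha) (by linarith [hτ.2]) hτ.1 (by ring)

structure St (X : ∀ k, BD (D k)) (K : Set (Finset (Fin r))) (U : E → Fin r → CM) : Prop where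
  cont : Continuous U
  smooth : ∀ k, ContDiff ℝ 1 (fun p : E × ℝ => U p.1 k (p.2 : S1))
  good : ∀ b ∈ Bl E, GoodM K (U b)
  bd : ∀ a ∈ Sp E, InP X (U a)

/-- general position -/
def GP (X : ∀ k, BD (D k)) (s c : ℕ) (U : E → Fin r → CM) : Prop :=
  ∀ (b : E) (t : Fin s → ℝ), StrictMono t →
    ¬ ∀ i, ∃ τ : Finset (Fin r × Bool), τ.card = c ∧ ∀ j ∈ τ, (X j.1).F j.2 (U b j.1) (t i) = 0

lemma smooth_F {X : ∀ k, BD (D k)} {U : E → Fin r → CM} (hU : St X K U) (k : Fin r) (c : Bool) :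
    ContDiff ℝ 1 (fun p : E × ℝ => (X k).F c (U p.1 k) p.2) := by
  have h1 : ContDiff ℝ 1 (fun p : E × ℝ => U p.1 k (p.2 : S1) / (X k).u c p.2) := by
    simp only [div_eq_mul_inv]
    exact (hU.smooth k).mul ((((X k).u_smooth c).comp contDiff_snd).inv (fun p => (X k).u_ne c _))
  exact Complex.reCLM.contDiff.comp h1

lemma step_gp (X : ∀ k, BD (D k)) {s c : ℕ} (hr : 0 < r) (hs : 0 < s) (hsD : ∀ k, s ≤ D k)
    (hdim : Module.finrank ℝ E + s < s * c) {U : E → Fin r → CM} (hU : St X K U) :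
    ∃ V : E → Fin r → CM, St X K V ∧ HR X K U V ∧ GP X s c V ∧
      ∀ k c', (∀ b ∈ Bl E, (X k).IsP c' (U b k)) → ∀ b ∈ Bl E, (X k).IsP c' (V b k) := by
  obtain ⟨ε, hε, hgood⟩ := exists_eps (K := K) hU.cont.continuousOn hU.good
  let W : (Fin r × Bool → Fin s → ℝ) → Fin r → CM := fun v k =>
    ∑ c' : Bool, (X k).pol0 c' (ext0 (D k) (v (k, c')))
  have hext : ∀ d, Continuous (ext0 (s := s) d) := by
    intro d
    refine continuous_pi fun i => ?_
    unfold ext0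
    split_ifs
    · fun_prop
    · fun_prop
  have Wc : Continuous W := by
    refine continuous_pi fun k => ?_
    refine continuous_finsetSum _ fun c' _ => ?_
    exact ((X k).pol0_cont c').comp ((hext _).comp (continuous_apply _))
  have W0 : W 0 = 0 := by
    funext k
    have : ext0 (D k) (0 : Fin s → ℝ) = 0 := by funext i; simp [ext0]
    show ∑ c' : Bool, (X k).pol0 c' (ext0 (D k) (0 : Fin s → ℝ)) = 0
    simp [this, BD.pol0_zero]
  obtain ⟨δ, hδ, hWδ⟩ := Metric.continuousAt_iff.1 (Wc.continuousAt (x := 0)) ε hε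
  have : Nonempty (Fin r × Bool) := ⟨(⟨0, hr⟩, true)⟩
  obtain ⟨v, hvδ, hv⟩ := gen_pos (fun (j : Fin r × Bool) b t => (X j.1).F j.2 (U b j.1) t)
    (fun j => smooth_F hU j.1 j.2) s c hs hdim hδ
  have hWn : ‖W v‖ < ε := by
    have := hWδ (x := v) (by simpa using hvδ)
    simpa [W0] using this
  have WF : ∀ k c' t, (X k).F c' (W v k) t = ∑ l, v (k, c') l * t ^ (l : ℕ) := by
    intro k c' t
    rw [BD.F_sum]
    simp only [BD.F_pol0, ext0_sum (hsD k)]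
    simp
  have Winf : ∀ k, W v k OnePoint.infty = 0 := by
    intro k
    simp [W, BD.pol0_infty]
  have hP : ∀ k c' m, (X k).IsP c' m → (X k).IsP c' (m + W v k) := by
    rintro k c' m ⟨a, ha⟩
    refine ⟨a + ext0 (D k) (v (k, c')), fun t => ?_⟩
    rw [BD.F_add, ha, WF, ← ext0_sum (hsD k)]
    simp [BD.pv, add_mul, Finset.sum_add_distrib, add_assoc]
  have hgV : ∀ τ ∈ II, ∀ b ∈ Bl E, GoodM K (U b + τ • W v) := by
    intro τ hτ b hb
    refine hgood b hb _ ?_ ?_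
    · rw [add_sub_cancel_left, norm_smul, Real.norm_eq_abs, abs_of_nonneg hτ.1]
      refine lt_of_le_of_lt (mul_le_of_le_one_left (norm_nonneg _) hτ.2) hWn
    · intro k
      simp [Winf, (hU.good b hb).1 k]
  have hbd : ∀ a ∈ Sp E, InP X (U a + W v) := fun a ha k c' => hP k c' _ (hU.bd a ha k c')
  refine ⟨fun b => U b + W v, ⟨hU.cont.add continuous_const, ?_, ?_, hbd⟩, ?_, ?_, ?_⟩
  · intro k
    refine (hU.smooth k).add ?_
    have : (fun p : E × ℝ => W v k (p.2 : S1)) = fun p : E × ℝ => ∑ c' : Bool, (X k).u c' p.2 *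
        ((∑ i, ext0 (D k) (v (k, c')) i * p.2 ^ (i : ℕ) : ℝ) : ℂ) := by
      funext p
      simp only [W, ContinuousMap.coe_sum, Finset.sum_apply, BD.pol0_coe]
    rw [this]
    refine ContDiff.sum fun c' _ => ?_
    have hsm : ContDiff ℝ 1 (fun p : E × ℝ => ∑ i, ext0 (D k) (v (k, c')) i * p.2 ^ (i : ℕ)) :=
      ContDiff.sum fun i _ => by fun_prop
    exact (((X k).u_smooth c').comp contDiff_snd).mul (Complex.ofRealCLM.contDiff.comp hsm)
  · intro b hb
    simpa using hgV 1 one_mem_II b hb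
  · refine HR.segment hU.cont.continuousOn (hU.cont.add continuous_const).continuousOn ?_ hU.bd hbd
    intro τ hτ b hb
    have : (1 - τ) • U b + τ • (U b + W v) = U b + τ • W v := by
      rw [smul_add, ← add_assoc, ← add_smul]; simp
    rw [this]
    exact hgV τ hτ b hb
  · intro b t ht hall
    apply hv b t ht
    intro i
    obtain ⟨τ, hτ1, hτ2⟩ := hall i
    refine ⟨τ, hτ1, fun j hj => ?_⟩
    have := hτ2 j hj
    simp only [Pi.add_apply, BD.F_add, WF] at this
    exact this
  · intro k c' h b hb
    exact hP k c' _ (h b hb)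

end fam

end Part5

section Part6
section fam
set_option linter.unusedSectionVars false
variable {r : ℕ} {K : Set (Finset (Fin r))} {D : Fin r → ℕ}
variable {E : Type*} [NormedAddCommGroup E] [NormedSpace ℝ E] [FiniteDimensional ℝ E]

/-- interpolation -/
lemma BD.exists_interp {d : ℕ} (X : BD d) (c : Bool) (T : Finset ℝ) (hT : T.card ≤ d) (f : ℝ → ℝ) :
    ∃ a : Fin d → ℝ, ∀ t ∈ T, X.pv c a t = f t := by
  let p := Lagrange.interpolate T id (fun t => f t - top c * t ^ d)
  have hinj : Set.InjOn (id : ℝ → ℝ) T := Function.injective_id.injOn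
  refine ⟨fun i => p.coeff i, fun t ht => ?_⟩
  have hdeg : p.degree < (d : WithBot ℕ) :=
    lt_of_lt_of_le (Lagrange.degree_interpolate_lt _ hinj) (by exact_mod_cast hT)
  have hev : p.eval t = f t - top c * t ^ d := Lagrange.eval_interpolate_at_node _ hinj ht
  have hsum : p.eval t = ∑ i : Fin d, p.coeff i * t ^ (i : ℕ) := by
    rw [Fin.sum_univ_eq_sum_range (fun i => p.coeff i * t ^ i) d]
    rcases Nat.eq_zero_or_pos d with h0 | h0
    · subst h0
      have : p = 0 := by
        apply Polynomial.degree_eq_bot.1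
        by_contra hc
        rw [Polynomial.degree_eq_bot] at hc
        have := Polynomial.zero_le_degree_iff.2 hc
        exact absurd hdeg (not_lt.2 (by exact_mod_cast this))
      simp [this]
    · refine Polynomial.eval_eq_sum_range' ?_ t
      by_cases hp : p = 0
      · rw [hp]; simpa using h0
      · exact (Polynomial.natDegree_lt_iff_degree_lt hp).2 hdeg
  rw [BD.pv, ← hsum, hev]; ring

/-- points where only the coordinate `j` can be nonzero -/
def YY (X : ∀ k, BD (D k)) (K : Set (Finset (Fin r))) (j : Fin r × Bool) (m : Fin r → CM) : Set ℝ :=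
  {t | ∃ σ : Finset (Fin r), σ ∉ K ∧ ∀ k ∈ σ, ∀ c, (k, c) ≠ j → (X k).F c (m k) t = 0}

lemma YY_ne (X : ∀ k, BD (D k)) {j : Fin r × Bool} {m : Fin r → CM} (hm : GoodM K m) {t : ℝ}
    (ht : t ∈ YY X K j m) : (X j.1).F j.2 (m j.1) t ≠ 0 := by
  obtain ⟨σ, hσ, h⟩ := ht
  obtain ⟨k, hk, c, hne⟩ := hm.exists X t hσ
  have : (k, c) = j := by
    by_contra hc
    exact hne (h k hk c hc)
  subst this
  exact hne

lemma YY_card (X : ∀ k, BD (D k)) {s ρ : ℕ} (hρ : ∀ σ : Finset (Fin r), σ ∉ K → ρ ≤ σ.card)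
    {U : E → Fin r → CM} (hGP : GP X s (2 * ρ - 1) U) (j : Fin r × Bool) (b : E) :
    ∃ T : Finset ℝ, (T : Set ℝ) = YY X K j (U b) ∧ T.card < s := by
  have key : ∀ T : Finset ℝ, (T : Set ℝ) ⊆ YY X K j (U b) → T.card ≠ s := by
    intro T hT hc
    refine hGP b (T.orderEmbOfFin hc) (T.orderEmbOfFin hc).strictMono ?_
    intro i
    obtain ⟨σ, hσ, h⟩ := hT (Finset.orderEmbOfFin_mem T hc i)
    have hcard : 2 * ρ - 1 ≤ ((σ ×ˢ (Finset.univ : Finset Bool)).erase j).card := by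
      have h1 := Finset.pred_card_le_card_erase (s := σ ×ˢ (Finset.univ : Finset Bool)) (a := j)
      rw [Finset.card_product] at h1
      have := hρ σ hσ
      simp only [Finset.card_univ, Fintype.card_bool] at h1
      omega
    obtain ⟨τ, hτ, hτc⟩ := Finset.exists_subset_card_eq hcard
    refine ⟨τ, hτc, fun j' hj' => ?_⟩
    have := hτ hj'
    rw [Finset.mem_erase, Finset.mem_product] at this
    exact h j'.1 this.2.1 j'.2 this.1
  have hfin : (YY X K j (U b)).Finite := by
    by_contra hinf
    obtain ⟨T, hT, hc⟩ := Set.Infinite.exists_subset_card_eq hinf s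
    exact key T hT hc
  refine ⟨hfin.toFinset, by simp, ?_⟩
  by_contra hc
  push Not at hc
  obtain ⟨T, hT, hTc⟩ := Finset.exists_subset_card_eq hc
  refine key T (fun t ht => ?_) hTc
  simpa using hT ht

lemma sel_local (X : ∀ k, BD (D k)) {s ρ : ℕ} (hsD : ∀ k, s ≤ D k)
    (hρ : ∀ σ : Finset (Fin r), σ ∉ K → ρ ≤ σ.card) (hρ2 : 2 ≤ ρ)
    {U : E → Fin r → CM} (hU : St X K U) (hGP : GP X s (2 * ρ - 1) U) (j : Fin r × Bool) (b : E) :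
    ∃ a : Fin (D j.1) → ℝ, ∀ᶠ b' in nhds b, b' ∈ Bl E → ∀ t ∈ YY X K j (U b'),
      0 < (X j.1).F j.2 (U b' j.1) t * (X j.1).pv j.2 a t := by
  by_cases hb : b ∈ Bl E
  swap
  · refine ⟨0, ?_⟩
    have : IsOpen (Bl E)ᶜ := Metric.isClosed_closedBall.isOpen_compl
    filter_upwards [this.mem_nhds hb] with b' hb' hb''
    exact absurd hb'' hb'
  obtain ⟨T, hT, hTc⟩ := YY_card X hρ hGP j b
  obtain ⟨a, ha⟩ := (X j.1).exists_interp j.2 T (hTc.le.trans (hsD _)) (fun t => (X j.1).F j.2 (U b j.1) t)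
  refine ⟨a, ?_⟩
  have evc : ∀ k c, Continuous (fun p : E × S1 => (X k).R c (U p.1 k) p.2) := by
    intro k c
    exact (((X k).R_cont c).comp ((continuous_apply k).comp (hU.cont.comp continuous_fst))).eval continuous_snd
  let W : Set (E × S1) := {p | p.1 ∈ Bl E} ∩
    ((⋃ σ ∈ {σ : Finset (Fin r) | σ ∉ K}, ⋂ k ∈ σ, ⋂ c : Bool, ⋂ _ : (k, c) ≠ j,
      {p | (X k).R c (U p.1 k) p.2 = 0}) ∩
      {p | (star ((X j.1).R j.2 (U p.1 j.1) p.2) * (X j.1).pol j.2 a p.2).re ≤ 0})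
  have hWc : IsClosed W := by
    refine IsClosed.inter (Metric.isClosed_closedBall.preimage continuous_fst) (IsClosed.inter ?_ ?_)
    · refine (Set.toFinite _).isClosed_biUnion fun σ _ => ?_
      refine isClosed_biInter fun k _ => isClosed_iInter fun c => isClosed_iInter fun _ => ?_
      exact isClosed_eq (evc k c) continuous_const
    · refine isClosed_le (Complex.continuous_re.comp ((continuous_star.comp (evc _ _)).mul ?_)) continuous_const
      exact ((X j.1).pol j.2 a).continuous.comp continuous_snd
  have hR0 : ∀ k c (m : CM) (t : ℝ), (X k).R c m (t : S1) = 0 ↔ (X k).F c m t = 0 := by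
    intro k c m t
    rw [BD.R_coe]
    have := (X k).u_ne c t
    simp [this]
  have hre : ∀ (m : CM) (t : ℝ), (star ((X j.1).R j.2 m t) * (X j.1).pol j.2 a t).re
      = 2 * ‖(X j.1).u j.2 t‖ ^ 2 * ((X j.1).F j.2 m t * (X j.1).pv j.2 a t) := by
    intro m t
    rw [BD.R_coe, BD.pol_coe]
    have : star (2 * (X j.1).u j.2 t * ((X j.1).F j.2 m t : ℂ)) * ((X j.1).u j.2 t * ((X j.1).pv j.2 a t : ℂ))
      = ((2 * ‖(X j.1).u j.2 t‖ ^ 2 * ((X j.1).F j.2 m t * (X j.1).pv j.2 a t) : ℝ) : ℂ) := by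
      have h1 : star ((X j.1).u j.2 t) * (X j.1).u j.2 t = ((‖(X j.1).u j.2 t‖ ^ 2 : ℝ) : ℂ) := by
        have := Complex.conj_mul' ((X j.1).u j.2 t)
        rw [Complex.ofReal_pow]; exact this
      push_cast at h1 ⊢
      rw [← h1]
      simp only [star_mul', Complex.star_def, Complex.conj_ofReal, map_ofNat]
      ring
    rw [this, Complex.ofReal_re]
  have hupos : ∀ t, 0 < 2 * ‖(X j.1).u j.2 t‖ ^ 2 := by
    intro t
    have := norm_pos_iff.2 ((X j.1).u_ne j.2 t)
    positivity
  have hmem : ∀ b' (t : ℝ), (b', (t : S1)) ∈ W ↔ b' ∈ Bl E ∧ t ∈ YY X K j (U b') ∧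
      ¬ 0 < (X j.1).F j.2 (U b' j.1) t * (X j.1).pv j.2 a t := by
    intro b' t
    simp only [W, Set.mem_inter_iff, Set.mem_ofPred_eq, Set.mem_iUnion, Set.mem_iInter, hR0, hre, YY,
      exists_prop, not_lt]
    have hiff : ∀ x : ℝ, 2 * ‖(X j.1).u j.2 t‖ ^ 2 * x ≤ 0 ↔ x ≤ 0 := by
      intro x
      constructor
      · intro h
        by_contra hx
        exact absurd (mul_pos (hupos t) (not_le.1 hx)) (not_lt.2 h)
      · exact fun h => mul_nonpos_of_nonneg_of_nonpos (hupos t).le h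
    rw [hiff]
  have hnot : ∀ x : S1, (b, x) ∉ W := by
    intro x
    induction x using OnePoint.rec with
    | infty =>
      intro hx
      simp only [W, Set.mem_inter_iff, Set.mem_ofPred_eq, Set.mem_iUnion, Set.mem_iInter, exists_prop] at hx
      obtain ⟨-, ⟨σ, hσ, h⟩, -⟩ := hx
      have h2 : 1 < σ.card := lt_of_lt_of_le (by omega) (hρ σ hσ)
      obtain ⟨k, hk, hne⟩ := Finset.exists_mem_ne h2 j.1
      have := h k hk false (fun he => hne (by rw [← he]))
      rw [(X k).R_infty false ((hU.good b hb).1 k)] at this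
      norm_num [sg] at this
    | coe t =>
      rw [hmem]
      rintro ⟨-, ht, hn⟩
      apply hn
      have htT : t ∈ T := by
        rw [← Finset.mem_coe, hT]; exact ht
      rw [ha t htT]
      exact mul_self_pos.2 (YY_ne X (hU.good b hb) ht)
  have hcl : IsClosed (Prod.fst '' W) := isClosedMap_fst_of_compactSpace _ hWc
  have hbn : b ∉ Prod.fst '' W := by
    rintro ⟨⟨b', x⟩, hp, rfl⟩
    exact hnot x hp
  filter_upwards [hcl.isOpen_compl.mem_nhds hbn] with b' hb' hb'' t ht
  by_contra hc
  exact hb' ⟨(b', (t : S1)), (hmem b' t).2 ⟨hb'', ht, hc⟩, rfl⟩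

open scoped Manifold ContDiff in
lemma sel_global (X : ∀ k, BD (D k)) {s ρ : ℕ} (hsD : ∀ k, s ≤ D k)
    (hρ : ∀ σ : Finset (Fin r), σ ∉ K → ρ ≤ σ.card) (hρ2 : 2 ≤ ρ)
    {U : E → Fin r → CM} (hU : St X K U) (hGP : GP X s (2 * ρ - 1) U) (j : Fin r × Bool) :
    ∃ a : E → Fin (D j.1) → ℝ, ContDiff ℝ 1 a ∧ ∀ b ∈ Bl E, ∀ t ∈ YY X K j (U b),
      0 < (X j.1).F j.2 (U b j.1) t * (X j.1).pv j.2 (a b) t := by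
  obtain ⟨g, hg⟩ := exists_contMDiffMap_forall_mem_convex_of_local_const (n := 1) (I := 𝓘(ℝ, E))
    (F := Fin (D j.1) → ℝ)
    (t := fun b => {a | b ∈ Bl E → ∀ t ∈ YY X K j (U b), 0 < (X j.1).F j.2 (U b j.1) t * (X j.1).pv j.2 a t})
    (by
      intro b a ha a' ha' σ τ hσ hτ h hb t ht
      have h1 := ha hb t ht
      have h2 := ha' hb t ht
      rw [BD.pv_comb _ _ _ _ h]
      have : (X j.1).F j.2 (U b j.1) t * (σ * (X j.1).pv j.2 a t + τ * (X j.1).pv j.2 a' t)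
        = σ * ((X j.1).F j.2 (U b j.1) t * (X j.1).pv j.2 a t)
          + τ * ((X j.1).F j.2 (U b j.1) t * (X j.1).pv j.2 a' t) := by ring
      rw [this]
      exact (convex_Ioi (0:ℝ)) h1 h2 hσ hτ h)
    (fun b => sel_local X hsD hρ hρ2 hU hGP j b)
  exact ⟨g, g.contMDiff.contDiff, hg⟩

lemma step_rep (X : ∀ k, BD (D k)) (hE : ∅ ∈ K) {s ρ : ℕ} (hsD : ∀ k, s ≤ D k)
    (hρ : ∀ σ : Finset (Fin r), σ ∉ K → ρ ≤ σ.card) (hρ2 : 2 ≤ ρ)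
    {U : E → Fin r → CM} (hU : St X K U) (hGP : GP X s (2 * ρ - 1) U) (j : Fin r × Bool) :
    ∃ V : E → Fin r → CM, St X K V ∧ HR X K U V ∧ (∀ b ∈ Bl E, (X j.1).IsP j.2 (V b j.1)) ∧
      ∀ k c', (∀ b ∈ Bl E, (X k).IsP c' (U b k)) → ∀ b ∈ Bl E, (X k).IsP c' (V b k) := by
  obtain ⟨a, hac, ha⟩ := sel_global X hsD hρ hρ2 hU hGP j
  obtain ⟨k₀, c₀⟩ := j
  simp only at a hac ha
  let V : E → Fin r → CM := fun b => Function.update (U b) k₀ ((X k₀).rep c₀ (a b) (U b k₀))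
  have V0 : ∀ b, V b k₀ = (X k₀).rep c₀ (a b) (U b k₀) := fun b => Function.update_self _ _ _
  have V1 : ∀ b k, k ≠ k₀ → V b k = U b k := fun b k hk => Function.update_of_ne hk _ _
  have FV : ∀ b k c t, (X k).F c (V b k) t = if (k, c) = (k₀, c₀) then (X k).pv c (Function.update (β := fun k => Fin (D k) → ℝ) (fun _ => 0) k₀ (a b) k) t
      else (X k).F c (U b k) t := by
    intro b k c t
    by_cases hk : k = k₀
    · subst hk
      rw [V0, BD.F_rep]
      by_cases hc : c = c₀
      · subst hc; simp
      · simp [hc]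
    · rw [V1 b k hk, if_neg (by intro h; exact hk (congrArg Prod.fst h))]
  have VP : ∀ b k c, (X k).IsP c (U b k) ∨ (k, c) = (k₀, c₀) → (X k).IsP c (V b k) := by
    intro b k c h
    by_cases hkc : (k, c) = (k₀, c₀)
    · exact ⟨_, fun t => by rw [FV, if_pos hkc]⟩
    · obtain ⟨a', ha'⟩ := h.resolve_right hkc
      exact ⟨a', fun t => by rw [FV, if_neg hkc, ha']⟩
  have Vinf : ∀ b ∈ Bl E, ∀ k, V b k OnePoint.infty = 1 := by
    intro b hb k
    by_cases hk : k = k₀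
    · subst hk
      rw [V0]; exact (X k).rep_infty _ _ ((hU.good b hb).1 k)
    · rw [V1 b k hk]; exact (hU.good b hb).1 k
  have hseg : ∀ τ ∈ II, ∀ b ∈ Bl E, GoodM K ((1 - τ) • U b + τ • V b) := by
    intro τ hτ b hb
    refine goodM_of X hE ?_ ?_
    · intro k
      simp [Vinf b hb k, (hU.good b hb).1 k]
    · intro t σ hσ
      have FS : ∀ k c, (X k).F c (((1 - τ) • U b + τ • V b) k) t
          = (1 - τ) * (X k).F c (U b k) t + τ * (X k).F c (V b k) t := by
        intro k c
        rw [Pi.add_apply, Pi.smul_apply, Pi.smul_apply, BD.F_add, BD.F_smul, BD.F_smul]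
      by_cases hY : ∃ k ∈ σ, ∃ c, (k, c) ≠ (k₀, c₀) ∧ (X k).F c (U b k) t ≠ 0
      · obtain ⟨k, hk, c, hne, hF⟩ := hY
        refine ⟨k, hk, c, ?_⟩
        rw [FS, FV, if_neg hne, ← add_mul]
        simpa using hF
      · push Not at hY
        have hYY : t ∈ YY X K (k₀, c₀) (U b) := ⟨σ, hσ, fun k hk c hne => hY k hk c hne⟩
        have hpos := ha b hb t hYY
        obtain ⟨k, hk, c, hF⟩ := (hU.good b hb).exists X t hσ
        have hkc : (k, c) = (k₀, c₀) := by
          by_contra hc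
          exact hF (hY k hk c hc)
        obtain ⟨rfl, rfl⟩ := Prod.mk.inj hkc
        refine ⟨k, hk, c, ?_⟩
        rw [FS, FV, if_pos rfl, Function.update_self]
        intro h0
        have h1 : (1 - τ) * ((X k).F c (U b k) t * (X k).F c (U b k) t)
            + τ * ((X k).F c (U b k) t * (X k).pv c (a b) t) = 0 := by
          linear_combination ((X k).F c (U b k) t) * h0
        have h2 := mul_self_pos.2 hF
        rcases hτ.1.eq_or_lt with h | h
        · subst h; linarith
        · have := mul_pos h hpos
          have := mul_nonneg (sub_nonneg.2 hτ.2) h2.le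
          linarith
  have hbd : ∀ x ∈ Sp E, InP X (V x) := fun x hx k c => VP x k c (Or.inl (hU.bd x hx k c))
  have Vc : Continuous V := by
    refine continuous_pi fun k => ?_
    by_cases hk : k = k₀
    · subst hk
      simp only [V0, BD.rep]
      have h1 : Continuous fun b => U b k := (continuous_apply k).comp hU.cont
      exact (h1.sub (((X k).R_cont c₀).comp h1 |>.const_smul (1/2 : ℂ))).add
        (((X k).pol_cont c₀).comp hac.continuous)
    · simp only [V1 _ k hk]
      exact (continuous_apply k).comp hU.cont
  refine ⟨V, ⟨Vc, ?_, ?_, hbd⟩, HR.segment hU.cont.continuousOn Vc.continuousOn hseg hU.bd hbd,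
    fun b _ => VP b k₀ c₀ (Or.inr rfl), fun k c h b hb => VP b k c (Or.inl (h b hb))⟩
  · intro k
    by_cases hk : k = k₀
    · subst hk
      have : (fun p : E × ℝ => V p.1 k (p.2 : S1)) = fun p : E × ℝ => U p.1 k (p.2 : S1)
          - (X k).u c₀ p.2 * ((X k).F c₀ (U p.1 k) p.2 : ℂ) + (X k).u c₀ p.2 * ((X k).pv c₀ (a p.1) p.2 : ℂ) := by
        funext p
        rw [V0]
        simp only [BD.rep, ContinuousMap.add_apply, ContinuousMap.sub_apply, ContinuousMap.smul_apply,
          BD.R_coe, BD.pol_coe, smul_eq_mul]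
        ring
      rw [this]
      have hu : ContDiff ℝ 1 (fun p : E × ℝ => (X k).u c₀ p.2) := ((X k).u_smooth c₀).comp contDiff_snd
      have hpv : ContDiff ℝ 1 (fun p : E × ℝ => (X k).pv c₀ (a p.1) p.2) := by
        unfold BD.pv
        refine ContDiff.add (by fun_prop) (ContDiff.sum fun i _ => ?_)
        have : ContDiff ℝ 1 (fun p : E × ℝ => a p.1 i) := (contDiff_apply ℝ ℝ i).comp (hac.comp contDiff_fst)
        exact this.mul (by fun_prop)
      exact ((hU.smooth k).sub (hu.mul (Complex.ofRealCLM.contDiff.comp (smooth_F hU k c₀)))).add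
        (hu.mul (Complex.ofRealCLM.contDiff.comp hpv))
    · simp only [V1 _ k hk]
      exact hU.smooth k
  · intro b hb
    simpa using hseg 1 one_mem_II b hb

lemma all_steps (X : ∀ k, BD (D k)) (hE : ∅ ∈ K) {s ρ : ℕ} (hr : 0 < r) (hs : 0 < s) (hsD : ∀ k, s ≤ D k)
    (hρ : ∀ σ : Finset (Fin r), σ ∉ K → ρ ≤ σ.card) (hρ2 : 2 ≤ ρ)
    (hdim : Module.finrank ℝ E < s * (2 * ρ - 2))
    {U : E → Fin r → CM} (hU : St X K U) :
    ∃ V : E → Fin r → CM, St X K V ∧ HR X K U V ∧ ∀ b ∈ Bl E, InP X (V b) := by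
  have hdim' : Module.finrank ℝ E + s < s * (2 * ρ - 1) := by
    obtain ⟨m, hm⟩ : ∃ m, 2 * ρ - 1 = m + 1 ∧ 2 * ρ - 2 = m := ⟨2 * ρ - 2, by omega, rfl⟩
    rw [hm.1, mul_add, mul_one]; rw [hm.2] at hdim; omega
  have key : ∀ T : Finset (Fin r × Bool), ∃ V : E → Fin r → CM, St X K V ∧ HR X K U V ∧
      ∀ j ∈ T, ∀ b ∈ Bl E, (X j.1).IsP j.2 (V b j.1) := by
    intro T
    induction T using Finset.induction_on with
    | empty =>
      refine ⟨U, hU, HR.segment hU.cont.continuousOn hU.cont.continuousOn ?_ hU.bd hU.bd, by simp⟩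
      intro τ hτ b hb
      rw [← add_smul]; simpa using hU.good b hb
    | insert j T _ ih =>
      obtain ⟨V, hV, hUV, hT⟩ := ih
      obtain ⟨V₁, hV₁, hVV₁, hGP, hP₁⟩ := step_gp X hr hs hsD hdim' hV
      obtain ⟨V₂, hV₂, hVV₂, hj, hP₂⟩ := step_rep X hE hsD hρ hρ2 hV₁ hGP j
      refine ⟨V₂, hV₂, (hUV.trans hVV₁).trans hVV₂, ?_⟩
      intro j' hj' b hb
      rcases Finset.mem_insert.1 hj' with rfl | h
      · exact hj b hb
      · exact hP₂ _ _ (hP₁ _ _ (hT j' h)) b hb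
  obtain ⟨V, h1, h2, h3⟩ := key Finset.univ
  exact ⟨V, h1, h2, fun b hb k c => h3 (k, c) (Finset.mem_univ _) b hb⟩

end fam

end Part6

section Part7
/-! ### Regularization -/

lemma sub_ne_of_im {w : ℂ} (hw : w.im ≠ 0) (t : ℝ) : (t : ℂ) - w ≠ 0 := by
  intro h
  apply hw
  have := congrArg Complex.im h
  simpa using this

open Filter Topology in
lemma tendsto_cw (w : ℂ) : Tendsto (fun t : ℝ => ((t : ℂ) - w)⁻¹) (cocompact ℝ) (𝓝 0) := by
  refine tendsto_inv₀_cobounded.comp ?_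
  rw [← Metric.cobounded_eq_cocompact]
  rw [← tendsto_norm_atTop_iff_cobounded]
  have h1 : Tendsto (fun t : ℝ => ‖t‖ - ‖w‖) (Bornology.cobounded ℝ) atTop :=
    tendsto_atTop_add_const_right _ (-‖w‖) tendsto_norm_cobounded_atTop
  refine tendsto_atTop_mono (fun t => ?_) h1
  have := norm_sub_norm_le (t : ℂ) w
  simpa using this

/-- the function `1/(t-w)` -/
def cw (w : ℂ) (hw : w.im ≠ 0) : CM :=
  OnePoint.continuousMapMk ⟨fun t : ℝ => ((t : ℂ) - w)⁻¹,
    (Complex.continuous_ofReal.sub continuous_const).inv₀ (sub_ne_of_im hw)⟩ 0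
    (by rw [Filter.coclosedCompact_eq_cocompact]; exact tendsto_cw w)

lemma cw_coe (w : ℂ) (hw : w.im ≠ 0) (t : ℝ) : cw w hw (t : S1) = ((t : ℂ) - w)⁻¹ := rfl
lemma cw_infty (w : ℂ) (hw : w.im ≠ 0) : cw w hw OnePoint.infty = 0 := rfl

lemma contDiff_cw (w : ℂ) (hw : w.im ≠ 0) : ContDiff ℝ 1 (fun t : ℝ => cw w hw (t : S1)) := by
  simp only [cw_coe]
  exact (Complex.ofRealCLM.contDiff.sub contDiff_const).inv (sub_ne_of_im hw)

def C1Alg : StarSubalgebra ℂ CM where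
  carrier := {m | ContDiff ℝ 1 (fun t : ℝ => m (t : S1))}
  mul_mem' := by
    intro a b ha hb
    simp only [Set.mem_ofPred_eq] at ha hb ⊢
    exact ContDiff.mul ha hb
  add_mem' := by
    intro a b ha hb
    simp only [Set.mem_ofPred_eq] at ha hb ⊢
    exact ContDiff.add ha hb
  algebraMap_mem' := by
    intro c
    simp only [Set.mem_ofPred_eq]
    exact contDiff_const
  star_mem' := by
    intro a ha
    simp only [Set.mem_ofPred_eq] at ha ⊢
    exact Complex.conjCLE.contDiff.comp ha

lemma mem_C1Alg {m : CM} : m ∈ C1Alg ↔ ContDiff ℝ 1 (fun t : ℝ => m (t : S1)) := Iff.rfl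

lemma C1_dense {m : CM} (hm : m OnePoint.infty = 1) {ε : ℝ} (hε : 0 < ε) :
    ∃ m' : CM, m' OnePoint.infty = 1 ∧ ContDiff ℝ 1 (fun t : ℝ => m' (t : S1)) ∧ ‖m' - m‖ < ε := by
  have hI : (-Complex.I).im ≠ 0 := by simp
  have hsep : C1Alg.SeparatesPoints := by
    intro x y hxy
    refine ⟨cw (-Complex.I) hI, ⟨_, contDiff_cw _ _, rfl⟩, ?_⟩
    induction x using OnePoint.rec with
    | infty =>
      induction y using OnePoint.rec with
      | infty => exact absurd rfl hxy
      | coe t =>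
        rw [cw_infty, cw_coe]
        exact (inv_ne_zero (sub_ne_of_im hI t)).symm
    | coe s =>
      induction y using OnePoint.rec with
      | infty =>
        rw [cw_infty, cw_coe]
        exact (inv_ne_zero (sub_ne_of_im hI s))
      | coe t =>
        rw [cw_coe, cw_coe]
        intro h
        apply hxy
        have := inv_injective h
        have h2 : (s : ℂ) = t := by linear_combination this
        exact congrArg _ (Complex.ofReal_injective h2)
  have htop := ContinuousMap.starSubalgebra_topologicalClosure_eq_top_of_separatesPoints C1Alg hsep
  have hcl : m ∈ closure (C1Alg : Set CM) := by
    have : m ∈ C1Alg.topologicalClosure := by rw [htop]; trivial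
    exact this
  obtain ⟨p, hp, hd⟩ := Metric.mem_closure_iff.1 hcl (ε / 2) (half_pos hε)
  rw [dist_eq_norm] at hd
  refine ⟨p + ContinuousMap.const _ (1 - p OnePoint.infty), ?_, ?_, ?_⟩
  · simp
  · exact ContDiff.add (mem_C1Alg.1 hp) contDiff_const
  · have h1 : ‖(ContinuousMap.const S1 (1 - p OnePoint.infty) : CM)‖ ≤ ‖m - p‖ := by
      rw [ContinuousMap.norm_le _ (norm_nonneg _)]
      intro x
      have := (m - p).norm_coe_le_norm OnePoint.infty
      simpa [hm] using this
    calc ‖p + ContinuousMap.const _ (1 - p OnePoint.infty) - m‖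
        = ‖ContinuousMap.const _ (1 - p OnePoint.infty) - (m - p)‖ := by congr 1; abel
      _ ≤ ‖(ContinuousMap.const S1 (1 - p OnePoint.infty) : CM)‖ + ‖m - p‖ := norm_sub_le _ _
      _ < ε := by linarith

lemma BD.C1_of_InP {d : ℕ} (X : BD d) {m : CM} (h : ∀ c, X.IsP c m) :
    ContDiff ℝ 1 (fun t : ℝ => m (t : S1)) := by
  obtain ⟨a, ha⟩ := h false
  obtain ⟨a', ha'⟩ := h true
  have hpv : ∀ c a, ContDiff ℝ 1 (fun t : ℝ => X.pv c a t) := by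
    intro c a
    unfold BD.pv
    refine ContDiff.add (by fun_prop) (ContDiff.sum fun i _ => by fun_prop)
  have : (fun t : ℝ => m (t : S1)) = fun t => X.ω t * ((X.pv false a t : ℂ) + Complex.I * (X.pv true a' t : ℂ)) := by
    funext t
    rw [X.coe_eq, ha, ha']
  rw [this]
  exact X.ω_smooth.mul ((Complex.ofRealCLM.contDiff.comp (hpv _ _)).add
    (contDiff_const.mul (Complex.ofRealCLM.contDiff.comp (hpv _ _))))

section fam
set_option linter.unusedSectionVars false
variable {r : ℕ} {K : Set (Finset (Fin r))} {D : Fin r → ℕ}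
variable {E : Type*} [NormedAddCommGroup E] [NormedSpace ℝ E] [FiniteDimensional ℝ E]

open scoped Manifold ContDiff in
lemma weights {ι : Type*} [Fintype ι] (N : ι → Set E) (hN : ∀ i, IsOpen (N i)) (hcov : Bl E ⊆ ⋃ i, N i) :
    ∃ w : E → ι → ℝ, ContDiff ℝ 1 w ∧ ∀ b ∈ Bl E, (∀ i, w b i ≠ 0 → b ∈ N i) ∧ (∀ i, 0 ≤ w b i) ∧
      ∑ i, w b i = 1 := by
  obtain ⟨g, hg⟩ := exists_contMDiffMap_forall_mem_convex_of_local_const (n := 1) (I := 𝓘(ℝ, E))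
    (F := ι → ℝ)
    (t := fun b => {w | b ∈ Bl E → (∀ i, w i ≠ 0 → b ∈ N i) ∧ (∀ i, 0 ≤ w i) ∧ ∑ i, w i = 1})
    (by
      intro b w hw w' hw' σ τ hσ hτ h hb
      obtain ⟨h1, h2, h3⟩ := hw hb
      obtain ⟨h1', h2', h3'⟩ := hw' hb
      refine ⟨fun i hi => ?_, fun i => ?_, ?_⟩
      · by_contra hc
        apply hi
        have e1 : w i = 0 := by by_contra h; exact hc (h1 i h)
        have e2 : w' i = 0 := by by_contra h; exact hc (h1' i h)
        simp [e1, e2]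
      · exact add_nonneg (mul_nonneg hσ (h2 i)) (mul_nonneg hτ (h2' i))
      · simp only [Pi.add_apply, Pi.smul_apply, smul_eq_mul, Finset.sum_add_distrib, ← Finset.mul_sum, h3, h3']
        linarith)
    (by
      intro b
      by_cases hb : b ∈ Bl E
      · obtain ⟨i, hi⟩ := Set.mem_iUnion.1 (hcov hb)
        refine ⟨Pi.single i 1, ?_⟩
        filter_upwards [(hN i).mem_nhds hi] with b' hb' _
        refine ⟨fun j hj => ?_, fun j => ?_, by simp⟩
        · by_cases h : j = i
          · subst h; exact hb'
          · simp [h] at hj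
        · by_cases h : j = i
          · subst h; simp
          · simp [h]
      · refine ⟨0, ?_⟩
        filter_upwards [Metric.isClosed_closedBall.isOpen_compl.mem_nhds hb] with b' hb' h
        exact absurd h hb')
  exact ⟨g, g.contMDiff.contDiff, hg⟩

lemma regularize (X : ∀ k, BD (D k)) {g : E → Fin r → CM} (hg : ContinuousOn g (Bl E))
    (hgood : ∀ b ∈ Bl E, GoodM K (g b)) (hbd : ∀ a ∈ Sp E, InP X (g a)) :
    ∃ U : E → Fin r → CM, St X K U ∧ HR X K g U := by
  let g' : E → Fin r → CM := fun x => g (kap x)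
  have hg'c : Continuous g' := hg.comp_continuous kap_cont kap_mem
  have hg'good : ∀ b, GoodM K (g' b) := fun b => hgood _ (kap_mem b)
  have hg'bd : ∀ b : E, 1/2 ≤ ‖b‖ → InP X (g' b) := fun b hb => hbd _ (kap_sp hb)
  have hSp : ∀ a ∈ Sp E, InP X (g' a) := fun a ha => hg'bd a (by rw [mem_Sp.1 ha]; norm_num)
  have h0 : HR X K g g' := by
    have hmem : ∀ p ∈ II ×ˢ Bl E, (1 - p.1) • p.2 + p.1 • kap p.2 ∈ Bl E := by
      rintro ⟨τ, x⟩ ⟨hτ, hx⟩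
      exact Bl_convex_comb hx (kap_mem x) hτ
    refine ⟨fun p => g ((1 - p.1) • p.2 + p.1 • kap p.2), ?_, ?_, ?_, ?_, ?_⟩
    · refine hg.comp ?_ hmem
      have := kap_cont (E := E)
      fun_prop
    · intro x _; simp
    · intro x _; simp [g']
    · intro τ hτ x hx
      exact hgood _ (hmem (τ, x) ⟨hτ, hx⟩)
    · intro τ hτ a ha
      simp only [kap_eq ha, ← add_smul]
      simpa using hbd a ha
  obtain ⟨ε, hε, hball⟩ := exists_eps hg'c.continuousOn (fun b (_ : b ∈ Bl E) => hg'good b)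
  have hpick : ∀ b : E, ∃ m : Fin r → CM, (∀ k, m k OnePoint.infty = 1) ∧
      (∀ k, ContDiff ℝ 1 (fun t : ℝ => m k (t : S1))) ∧ ‖m - g' b‖ < ε ∧ (1/2 < ‖b‖ → InP X m) := by
    intro b
    by_cases hb : 1/2 < ‖b‖
    · have hP := hg'bd b hb.le
      exact ⟨g' b, (hg'good b).1, fun k => (X k).C1_of_InP (hP k), by simpa using hε, fun _ => hP⟩
    · choose m hm1 hm2 hm3 using fun k => C1_dense ((hg'good b).1 k) hε
      refine ⟨m, hm1, hm2, ?_, fun h => absurd h hb⟩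
      rw [pi_norm_lt_iff hε]
      exact hm3
  choose m hm1 hm2 hm3 hm4 using hpick
  let N : E → Set E := fun b => {b' | ‖m b - g' b'‖ < ε} ∩ {b' | ‖b‖ ≤ 1/2 → ‖b'‖ < 1}
  have hNo : ∀ b, IsOpen (N b) := by
    intro b
    refine IsOpen.inter (isOpen_lt (continuous_const.sub hg'c).norm continuous_const) ?_
    by_cases hb : ‖b‖ ≤ 1/2
    · have : {b' : E | ‖b‖ ≤ 1/2 → ‖b'‖ < 1} = {b' | ‖b'‖ < 1} := by
        ext x; exact ⟨fun h => h hb, fun h _ => h⟩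
      rw [this]
      exact isOpen_lt continuous_norm continuous_const
    · have : {b' : E | ‖b‖ ≤ 1/2 → ‖b'‖ < 1} = Set.univ := by
        ext x; exact ⟨fun _ => trivial, fun _ h => absurd h hb⟩
      rw [this]; exact isOpen_univ
  have hself : ∀ b, b ∈ N b := fun b => ⟨hm3 b, fun (h : ‖b‖ ≤ 1/2) => lt_of_le_of_lt h (by norm_num)⟩
  obtain ⟨T, hT⟩ := (isCompact_closedBall (0:E) 1).elim_finite_subcover N hNo
    (fun b _ => Set.mem_iUnion.2 ⟨b, hself b⟩)
  obtain ⟨w, hwc, hw⟩ := weights (fun i : T => N i) (fun i => hNo i) (by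
    intro b hb
    obtain ⟨i, hi, h⟩ := Set.mem_iUnion₂.1 (hT hb)
    exact Set.mem_iUnion.2 ⟨⟨i, hi⟩, h⟩)
  let U : E → Fin r → CM := fun b => ∑ i : T, w b i • m i
  have Uc : Continuous U := by
    refine continuous_finsetSum _ fun i _ => ?_
    exact ((continuous_apply i).comp hwc.continuous).smul continuous_const
  have Umem : ∀ b ∈ Bl E, ∀ S : Set (Fin r → CM), Convex ℝ S → (∀ i : T, b ∈ N i → m i ∈ S) → U b ∈ S := by
    intro b hb S hS h
    obtain ⟨h1, h2, h3⟩ := hw b hb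
    have : U b = ∑ i ∈ Finset.univ.filter (fun i : T => w b i ≠ 0), w b i • m i := by
      rw [Finset.sum_filter_of_ne]
      intro i _ hi h0
      exact hi (by rw [h0, zero_smul])
    rw [this]
    refine hS.sum_mem (fun i _ => h2 i) ?_ (fun i hi => h i (h1 i (Finset.mem_filter.1 hi).2))
    rw [Finset.sum_filter_ne_zero, h3]
  have Uinf : ∀ b ∈ Bl E, ∀ k, U b k OnePoint.infty = 1 := by
    intro b hb
    refine Umem b hb {m | ∀ k, m k OnePoint.infty = 1} ?_ (fun i _ => hm1 i)
    intro x hx y hy σ τ _ _ h k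
    have hx := hx k
    have hy := hy k
    simp only [Pi.add_apply, Pi.smul_apply, ContinuousMap.add_apply, ContinuousMap.smul_apply, hx, hy]
    rw [← add_smul, h, one_smul]
  have Uball : ∀ b ∈ Bl E, U b ∈ Metric.ball (g' b) ε := by
    intro b hb
    refine Umem b hb _ (convex_ball _ _) (fun i hi => ?_)
    rw [mem_ball_iff_norm]; exact hi.1
  have USp : ∀ a ∈ Sp E, InP X (U a) := by
    intro a ha
    refine Umem a (Sp_sub_Bl ha) {m | InP X m} (InP_convex X) (fun i hi => ?_)
    refine hm4 i ?_
    by_contra h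
    have := hi.2 (not_lt.1 h)
    rw [mem_Sp.1 ha] at this
    exact lt_irrefl _ this
  have hseg : ∀ τ ∈ II, ∀ b ∈ Bl E, GoodM K ((1 - τ) • g' b + τ • U b) := by
    intro τ hτ b hb
    refine hball b hb _ ?_ ?_
    · have h1 := convex_ball (g' b) ε (Metric.mem_ball_self hε) (Uball b hb) (sub_nonneg.2 hτ.2) hτ.1 (by ring)
      rwa [mem_ball_iff_norm] at h1
    · intro k
      simp [Uinf b hb k, (hg'good b).1 k]
  refine ⟨U, ⟨Uc, ?_, fun b hb => by simpa using hseg 1 one_mem_II b hb, USp⟩,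
    h0.trans (HR.segment hg'c.continuousOn Uc.continuousOn hseg hSp USp)⟩
  intro k
  have : (fun p : E × ℝ => U p.1 k (p.2 : S1)) = fun p : E × ℝ => ∑ i : T, w p.1 i • m i k (p.2 : S1) := by
    funext p
    simp [U]
  rw [this]
  refine ContDiff.sum fun i _ => ?_
  have e1 : ContDiff ℝ 1 (fun p : E × ℝ => w p.1 i) := (contDiff_apply ℝ ℝ i).comp (hwc.comp contDiff_fst)
  have e2 : ContDiff ℝ 1 (fun p : E × ℝ => m i k (p.2 : S1)) := (hm2 i k).comp contDiff_snd
  exact e1.smul e2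

/-- Core in the function space. -/
theorem core_M (X : ∀ k, BD (D k)) (hE : ∅ ∈ K) {s ρ : ℕ} (hr : 0 < r) (hs : 0 < s) (hsD : ∀ k, s ≤ D k)
    (hρ : ∀ σ : Finset (Fin r), σ ∉ K → ρ ≤ σ.card) (hρ2 : 2 ≤ ρ)
    (hdim : Module.finrank ℝ E < s * (2 * ρ - 2))
    {g : E → Fin r → CM} (hg : ContinuousOn g (Bl E))
    (hgood : ∀ b ∈ Bl E, GoodM K (g b)) (hbd : ∀ a ∈ Sp E, InP X (g a)) :
    ∃ V : E → Fin r → CM, Continuous V ∧ (∀ b ∈ Bl E, GoodM K (V b)) ∧ HR X K g V ∧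
      ∀ b ∈ Bl E, InP X (V b) := by
  obtain ⟨U, hU, h1⟩ := regularize X hg hgood hbd
  obtain ⟨V, hV, h2, h3⟩ := all_steps X hE hr hs hsD hρ hρ2 hdim hU
  exact ⟨V, hV.cont, hV.good, h1.trans h2, h3⟩

end fam

end Part7

section Part8
section framework2
set_option linter.unusedSectionVars false
variable {E : Type*} [NormedAddCommGroup E] [NormedSpace ℝ E]
variable {P Q Z : Type*} [TopologicalSpace P] [TopologicalSpace Q] [TopologicalSpace Z]

theorem comp_of_homotopic {J : P × ℝ → Z} (hJ : Continuous J) (h1 : Comp E (fun p => J (p, 1))) :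
    Comp E (fun p => J (p, 0)) := by
  have hm : Comp E J := by
    refine comp_of_solv ?_
    intro g β hg hβ hgβ
    let h : ℝ × E → P × ℝ := fun q => ((β q.2).1, (1 - q.1) * (β q.2).2 + q.1)
    have hβ' : ContinuousOn (fun q : ℝ × E => β q.2) (II ×ˢ Sp E) :=
      hβ.comp continuousOn_snd (fun q hq => hq.2)
    have hh : ContinuousOn h (II ×ˢ Sp E) := by
      have e1 := continuous_fst.comp_continuousOn hβ'
      have e2 := continuous_snd.comp_continuousOn hβ'
      exact e1.prodMk (((continuousOn_const.sub continuousOn_fst).mul e2).add continuousOn_fst)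
    obtain ⟨H, c1, c2, c3⟩ := hep (f := fun q => J (h q)) hg (hJ.comp_continuousOn hh)
      (fun a ha => by simpa [h] using hgβ a ha)
    have hg' : ContinuousOn (fun x => H (1, x)) (Bl E) :=
      c1.comp (by fun_prop) (fun x hx => ⟨one_mem_II, hx⟩)
    have hβ1 : ContinuousOn (fun x => (β x).1) (Sp E) := continuous_fst.comp_continuousOn hβ
    obtain ⟨G, hG, K, k, d1, d2, d3, d4, d5, d6, d7⟩ := solv_of_comp h1 hg' hβ1 (fun a ha => by
      have := c3 1 one_mem_II a ha
      simpa [h] using this.symm)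
    refine Solv.of_PH (g' := fun x => H (1, x)) (β' := fun x => ((β x).1, (1:ℝ)))
      ⟨H, h, c1, hh, c2, fun _ _ => rfl, fun a _ => by simp [h], fun a _ => by simp [h], c3⟩ ?_
    refine ⟨fun x => (G x, 1), hG.prodMk continuousOn_const, K, fun q => (k q, 1), d1,
      d2.prodMk continuousOn_const, d3, d4, ?_, ?_, d7⟩
    · intro a ha; simp only; rw [d5 a ha]
    · intro a ha; simp only; rw [d6 a ha]
  have hi : Comp E (fun p : P => ((p, 0) : P × ℝ)) := by
    intro g β hg hβ hgβ
    refine ⟨fun x => (g x).1, fun q => ((g q.2).1, (1 - q.1) * (g q.2).2),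
      continuous_fst.comp_continuousOn hg, ?_, ?_, ?_, ?_, ?_⟩
    · intro a ha; simp only; rw [← hgβ a ha]
    · have hg' : ContinuousOn (fun q : ℝ × E => g q.2) (II ×ˢ Bl E) :=
        hg.comp continuousOn_snd (fun q hq => hq.2)
      exact (continuous_fst.comp_continuousOn hg').prodMk
        ((continuousOn_const.sub continuousOn_fst).mul (continuous_snd.comp_continuousOn hg'))
    · intro x _; simp
    · intro x _; simp
    · intro τ _ a ha; simp only; rw [← hgβ a ha]; simp
  exact Comp.comp hm hi (by fun_prop) hJ

end framework2

/-! ### Loops -/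
section loops
set_option linter.unusedSectionVars false
variable {r : ℕ} {K : Set (Finset (Fin r))} {D : Fin r → ℕ}

abbrev LU (hE : (∅ : Finset (Fin r)) ∈ K) := Loop ↥(UK K) (onesUK hE)

def mkLoop (hE : ∅ ∈ K) (m : Fin r → CM) (h : GoodM K m) : LU hE :=
  ⟨⟨fun x => ⟨fun k => m k x, h.2 x⟩, by
    refine Continuous.subtype_mk ?_ _
    exact continuous_pi fun k => (m k).continuous⟩, by
    apply Subtype.ext
    funext k
    exact h.1 k⟩

def emb (hE : ∅ ∈ K) (γ : LU hE) : Fin r → CM := fun k =>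
  ⟨fun x => (γ.1 x).1 k, (continuous_apply k).comp (continuous_subtype_val.comp γ.1.continuous)⟩

lemma emb_apply (hE : ∅ ∈ K) (γ : LU hE) (k : Fin r) (x : S1) : emb hE γ k x = (γ.1 x).1 k := rfl

lemma emb_good (hE : ∅ ∈ K) (γ : LU hE) : GoodM K (emb hE γ) := by
  refine ⟨fun k => ?_, fun x => (γ.1 x).2⟩
  rw [emb_apply, γ.2]; rfl

lemma emb_mkLoop (hE : ∅ ∈ K) (m : Fin r → CM) (h : GoodM K m) : emb hE (mkLoop hE m h) = m := rfl

lemma mkLoop_emb (hE : ∅ ∈ K) (γ : LU hE) : mkLoop hE (emb hE γ) (emb_good hE γ) = γ := rfl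

lemma emb_inj (hE : ∅ ∈ K) {γ γ' : LU hE} (h : emb hE γ = emb hE γ') : γ = γ' := by
  rw [← mkLoop_emb hE γ, ← mkLoop_emb hE γ']
  congr 1

lemma emb_isInducing (hE : ∅ ∈ K) : Topology.IsInducing (emb hE) := by
  let A : LU hE → C(S1, Fin r → ℂ) := fun γ => (⟨Subtype.val, continuous_subtype_val⟩ : C(↥(UK K), Fin r → ℂ)).comp γ.1
  have hA : Topology.IsInducing A := by
    have h1 := (ContinuousMap.isEmbedding_postcomp (X := S1) (⟨Subtype.val, continuous_subtype_val⟩ : C(↥(UK K), Fin r → ℂ))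
      Topology.IsEmbedding.subtypeVal).isInducing
    exact h1.comp Topology.IsInducing.subtypeVal
  let B : C(S1, Fin r → ℂ) → Fin r → CM := fun γ k => ⟨fun x => γ x k, (continuous_apply k).comp γ.continuous⟩
  let B' : (Fin r → CM) → C(S1, Fin r → ℂ) := fun m => ⟨fun x k => m k x, continuous_pi fun k => (m k).continuous⟩
  have hB : Continuous B := by
    refine continuous_pi fun k => ?_
    exact ContinuousMap.continuous_postcomp (⟨fun x : Fin r → ℂ => x k, continuous_apply k⟩ : C(Fin r → ℂ, ℂ))
  have hB' : Continuous B' := by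
    refine ContinuousMap.continuous_of_continuous_uncurry _ ?_
    exact eval_cont
  have hBi : Topology.IsInducing B := (Function.LeftInverse.isEmbedding (f := B') (g := B) (fun γ => rfl) hB' hB).isInducing
  exact hBi.comp hA

lemma emb_cont (hE : ∅ ∈ K) : Continuous (emb hE) := (emb_isInducing hE).continuous

/-- the tuple of functions attached to a polynomial tuple -/
def lamM (X : ∀ k, BD (D k)) (f : ∀ k : Fin r, Fin (D k) → ℂ) : Fin r → CM :=
  fun k => (X k).β (D k) + ∑ i : Fin (D k), f k i • (X k).β i

lemma toPoly_eval {d : ℕ} (a : Fin d → ℂ) (t : ℂ) :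
    (toPoly a).eval t = t ^ d + ∑ i : Fin d, a i * t ^ (i : ℕ) := by
  simp [toPoly, Polynomial.eval_finsetSum]

lemma lamM_coe (X : ∀ k, BD (D k)) (f : ∀ k : Fin r, Fin (D k) → ℂ) (k : Fin r) (t : ℝ) :
    lamM X f k (t : S1) = (X k).ω t * (toPoly (f k)).eval (t : ℂ) := by
  rw [toPoly_eval, lamM]
  simp only [ContinuousMap.add_apply, ContinuousMap.coe_sum, Finset.sum_apply, ContinuousMap.smul_apply,
    smul_eq_mul]
  have : ∀ i : Fin (D k), (X k).β i (t : S1) = (X k).ω t * (t : ℂ) ^ (i : ℕ) := fun i => (X k).β_coe i i.2.le t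
  simp only [this, (X k).β_coe _ le_rfl, mul_add, Finset.mul_sum]
  congr 1
  exact Finset.sum_congr rfl fun i _ => by ring

lemma lamM_infty (X : ∀ k, BD (D k)) (f : ∀ k : Fin r, Fin (D k) → ℂ) (k : Fin r) :
    lamM X f k OnePoint.infty = 1 := by
  simp [lamM, (X k).β_top, (X k).β_infty]

lemma lamM_good (X : ∀ k, BD (D k)) (hE : ∅ ∈ K) (f : ∀ k : Fin r, Fin (D k) → ℂ) :
    GoodM K (lamM X f) ↔ f ∈ PolSp K D := by
  constructor
  · intro h σ hσ t
    obtain ⟨k, hk, hne⟩ := mem_UK.1 (h.2 t) σ hσ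
    refine ⟨k, hk, ?_⟩
    rw [lamM_coe] at hne
    exact right_ne_zero_of_mul hne
  · intro h
    refine ⟨lamM_infty X f, fun x => ?_⟩
    induction x using OnePoint.rec with
    | infty =>
      have : (fun k => lamM X f k OnePoint.infty) = onesC := by funext k; exact lamM_infty X f k
      rw [this]; exact ones_mem_UK hE
    | coe t =>
      rw [mem_UK]
      intro σ hσ
      obtain ⟨k, hk, hne⟩ := h σ hσ t
      refine ⟨k, hk, ?_⟩
      rw [lamM_coe]
      exact mul_ne_zero ((X k).ω_ne t) hne

lemma lamM_cont (X : ∀ k, BD (D k)) : Continuous (lamM X) := by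
  refine continuous_pi fun k => ?_
  unfold lamM
  refine continuous_const.add (continuous_finsetSum _ fun i _ => ?_)
  have h : Continuous fun f : (∀ k : Fin r, Fin (D k) → ℂ) => f k i := by fun_prop
  exact h.smul continuous_const

def Lam (X : ∀ k, BD (D k)) (hE : ∅ ∈ K) (f : ↥(PolSp K D)) : LU hE :=
  mkLoop hE (lamM X f.1) ((lamM_good X hE f.1).2 f.2)

lemma Lam_cont (X : ∀ k, BD (D k)) (hE : (∅ : Finset (Fin r)) ∈ K) : Continuous (Lam X hE) := by
  rw [(emb_isInducing hE).continuous_iff]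
  exact (lamM_cont X).comp continuous_subtype_val

/-- linear part -/
def lamL (X : ∀ k, BD (D k)) : (∀ k : Fin r, Fin (D k) → ℂ) →ₗ[ℂ] (Fin r → CM) where
  toFun f := fun k => ∑ i : Fin (D k), f k i • (X k).β i
  map_add' f g := by
    funext k
    simp [add_smul, Finset.sum_add_distrib]
  map_smul' c f := by
    funext k
    simp [Finset.smul_sum, smul_smul]

lemma poly_zero_of_real {d : ℕ} (c : Fin d → ℂ) (h : ∀ t : ℝ, ∑ i : Fin d, c i * (t : ℂ) ^ (i : ℕ) = 0) : c = 0 := by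
  have hp : (∑ i : Fin d, Polynomial.C (c i) * Polynomial.X ^ (i : ℕ) : Polynomial ℂ) = 0 := by
    refine Polynomial.eq_zero_of_infinite_isRoot _ ?_
    refine Set.Infinite.mono (s := Set.range ((↑) : ℝ → ℂ)) ?_ (Set.infinite_range_of_injective Complex.ofReal_injective)
    rintro _ ⟨t, rfl⟩
    simp only [Set.mem_ofPred_eq, Polynomial.IsRoot]
    rw [Polynomial.eval_finsetSum, ← h t]
    simp
  funext i
  have := congrArg (fun p => Polynomial.coeff p (i : ℕ)) hp
  simp only [Polynomial.finsetSum_coeff, Polynomial.coeff_C_mul, Polynomial.coeff_X_pow, Polynomial.coeff_zero] at this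
  rw [Finset.sum_eq_single i] at this
  · simpa using this
  · intro j _ hj
    rw [if_neg (fun h => hj (Fin.ext h.symm)), mul_zero]
  · simp

lemma lamL_inj (X : ∀ k, BD (D k)) : Function.Injective (lamL X) := by
  rw [← LinearMap.ker_eq_bot, LinearMap.ker_eq_bot']
  intro f hf
  funext k
  refine poly_zero_of_real (f k) fun t => ?_
  have := congrArg (fun m : Fin r → CM => m k (t : S1)) hf
  simp only [lamL, LinearMap.coe_mk, AddHom.coe_mk, ContinuousMap.coe_sum, Finset.sum_apply,
    ContinuousMap.smul_apply, Pi.zero_apply, ContinuousMap.zero_apply, smul_eq_mul] at this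
  have h2 : ∀ i : Fin (D k), (X k).β i (t : S1) = (X k).ω t * (t : ℂ) ^ (i : ℕ) := fun i => (X k).β_coe i i.2.le t
  simp only [h2] at this
  have h3 : (X k).ω t * ∑ i : Fin (D k), f k i * (t : ℂ) ^ (i : ℕ) = 0 := by
    rw [Finset.mul_sum, ← this]
    exact Finset.sum_congr rfl fun i _ => by ring
  exact (mul_eq_zero.1 h3).resolve_left ((X k).ω_ne t)

lemma lamM_isInducing (X : ∀ k, BD (D k)) : Topology.IsInducing (lamM X) := by
  have h1 := (LinearMap.isClosedEmbedding_of_injective (f := lamL X) (LinearMap.ker_eq_bot.2 (lamL_inj X))).isInducing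
  have h2 : lamM X = (Homeomorph.addLeft (fun k => (X k).β (D k))) ∘ lamL X := rfl
  rw [h2]
  exact (Homeomorph.isInducing _).comp h1

lemma lamM_inj (X : ∀ k, BD (D k)) : Function.Injective (lamM X) := by
  intro f g h
  apply lamL_inj X
  exact add_left_cancel (a := fun k => (X k).β (D k)) h

lemma InP_lamM (X : ∀ k, BD (D k)) (f : ∀ k : Fin r, Fin (D k) → ℂ) : InP X (lamM X f) := by
  intro k c
  have hF : ∀ t : ℝ, (lamM X f k (t : S1)) / (X k).ω t = (t : ℂ) ^ (D k) + ∑ i : Fin (D k), f k i * (t : ℂ) ^ (i : ℕ) := by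
    intro t
    rw [lamM_coe, toPoly_eval, mul_div_cancel_left₀ _ ((X k).ω_ne t)]
  have hre : ∀ (t : ℝ) (i : ℕ) (z : ℂ), (z * (t : ℂ) ^ i) = ((z.re * t ^ i : ℝ) : ℂ) + ((z.im * t ^ i : ℝ) : ℂ) * Complex.I := by
    intro t i z
    conv_lhs => rw [← Complex.re_add_im z]
    push_cast; ring
  have hS : ∀ t : ℝ, (t : ℂ) ^ (D k) + ∑ i : Fin (D k), f k i * (t : ℂ) ^ (i : ℕ)
      = ((t ^ (D k) + ∑ i : Fin (D k), (f k i).re * t ^ (i : ℕ) : ℝ) : ℂ)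
        + ((∑ i : Fin (D k), (f k i).im * t ^ (i : ℕ) : ℝ) : ℂ) * Complex.I := by
    intro t
    simp only [hre]
    push_cast
    rw [Finset.sum_add_distrib, Finset.sum_mul]
    ring
  cases c with
  | false =>
    refine ⟨fun i => (f k i).re, fun t => ?_⟩
    have : (X k).u false t = (X k).ω t := by simp [BD.u, eps]
    rw [BD.F, this, hF, hS]
    have hq : ∀ a b : ℝ, ((a : ℂ) + (b : ℂ) * Complex.I).re = a := by intro a b; simp
    rw [hq]
    simp [BD.pv, top]
  | true =>
    refine ⟨fun i => (f k i).im, fun t => ?_⟩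
    have h1 : (X k).u true t = Complex.I * (X k).ω t := by simp [BD.u, eps]
    have h2 : lamM X f k (t : S1) / (Complex.I * (X k).ω t) = -Complex.I * (lamM X f k (t : S1) / (X k).ω t) := by
      have := (X k).ω_ne t
      field_simp; simp
    rw [BD.F, h1, h2, hF, hS]
    have hq : ∀ a b : ℝ, (-Complex.I * ((a : ℂ) + (b : ℂ) * Complex.I)).re = b := by intro a b; simp
    rw [hq]
    simp [BD.pv, top]

lemma exists_of_InP (X : ∀ k, BD (D k)) {m : Fin r → CM} (h1 : ∀ k, m k OnePoint.infty = 1) (h : InP X m) :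
    ∃ f, lamM X f = m := by
  choose a ha using fun k => h k false
  choose a' ha' using fun k => h k true
  refine ⟨fun k i => (a k i : ℂ) + Complex.I * (a' k i : ℂ), ?_⟩
  funext k
  ext x
  induction x using OnePoint.rec with
  | infty => rw [lamM_infty, h1]
  | coe t =>
    rw [lamM_coe, (X k).coe_eq, ha, ha', toPoly_eval]
    congr 1
    simp only [BD.pv, top]
    push_cast
    simp only [add_mul, Finset.sum_add_distrib, Finset.mul_sum]
    simp [mul_assoc, add_assoc, Finset.mul_sum]

theorem comp_Lam {E : Type*} [NormedAddCommGroup E] [NormedSpace ℝ E] [FiniteDimensional ℝ E]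
    (X : ∀ k, BD (D k)) (hE : ∅ ∈ K) {s ρ : ℕ} (hr : 0 < r) (hs : 0 < s) (hsD : ∀ k, s ≤ D k)
    (hρ : ∀ σ : Finset (Fin r), σ ∉ K → ρ ≤ σ.card) (hρ2 : 2 ≤ ρ)
    (hdim : Module.finrank ℝ E < s * (2 * ρ - 2)) : Comp E (Lam X hE) := by
  refine comp_of_solv ?_
  intro g β hg hβ hgβ
  have hbd : ∀ a ∈ Sp E, emb hE (g a) = lamM X (β a).1 := by
    intro a ha
    rw [← hgβ a ha]; rfl
  obtain ⟨V, hVc, hVg, ⟨H, c1, c2, c3, c4, c5⟩, hVP⟩ := core_M (K := K) X hE hr hs hsD hρ hρ2 hdim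
    (g := fun x => emb hE (g x)) ((emb_cont hE).comp_continuousOn hg) (fun b _ => emb_good hE _)
    (fun a ha => by rw [hbd a ha]; exact InP_lamM X _)
  let Lift : (Fin r → CM) → ∀ k : Fin r, Fin (D k) → ℂ := fun m => if h : ∃ f, lamM X f = m then h.choose else 0
  have hLift : ∀ m, GoodM K m → InP X m → lamM X (Lift m) = m := by
    intro m hm hP
    have h := exists_of_InP X hm.1 hP
    simp only [Lift, dif_pos h]
    exact h.choose_spec
  have hLift' : ∀ m, GoodM K m → InP X m → Lift m ∈ PolSp K D := by
    intro m hm hP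
    rw [← lamM_good X hE, hLift m hm hP]; exact hm
  by_cases hne : Nonempty ↥(PolSp K D)
  swap
  · -- vacuous
    exfalso
    have h0 : (0 : E) ∈ Bl E := by simp
    exact hne ⟨⟨_, hLift' (V 0) (hVg 0 h0) (hVP 0 h0)⟩⟩
  let L : (Fin r → CM) → ↥(PolSp K D) := fun m => if h : Lift m ∈ PolSp K D then ⟨Lift m, h⟩ else hne.some
  have hL : ∀ m, GoodM K m → InP X m → lamM X (L m).1 = m := by
    intro m hm hP
    simp only [L, dif_pos (hLift' m hm hP)]
    exact hLift m hm hP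
  have hLc : ContinuousOn L {m | GoodM K m ∧ InP X m} := by
    rw [((lamM_isInducing X).comp Topology.IsInducing.subtypeVal).continuousOn_iff]
    refine continuousOn_id.congr ?_
    intro m hm
    exact hL m hm.1 hm.2
  let Mk : (Fin r → CM) → LU hE := fun m => if h : GoodM K m then mkLoop hE m h else g 0
  have hMk : ∀ m, GoodM K m → emb hE (Mk m) = m := by
    intro m hm
    simp only [Mk, dif_pos hm]; rfl
  have hMkc : ContinuousOn Mk {m | GoodM K m} := by
    rw [(emb_isInducing hE).continuousOn_iff]
    exact continuousOn_id.congr (fun m hm => hMk m hm)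
  refine ⟨fun x => L (V x), hLc.comp hVc.continuousOn (fun x hx => ⟨hVg x hx, hVP x hx⟩),
    fun p => Mk (H p), fun p => L (H p), ?_, ?_, ?_, ?_, ?_, ?_, ?_⟩
  · exact hMkc.comp c1 (fun p hp => c4 p.1 hp.1 p.2 hp.2)
  · exact hLc.comp (c1.mono (Set.prod_mono le_rfl Sp_sub_Bl))
      (fun p hp => ⟨c4 p.1 hp.1 p.2 (Sp_sub_Bl hp.2), c5 p.1 hp.1 p.2 hp.2⟩)
  · intro x hx
    apply emb_inj
    rw [hMk _ (c4 0 zero_mem_II x hx), c2 x hx]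
  · intro x hx
    apply emb_inj
    rw [hMk _ (c4 1 one_mem_II x hx), c3 x hx]
    exact (hL _ (hVg x hx) (hVP x hx)).symm
  · intro a ha
    apply Subtype.ext
    apply lamM_inj X
    rw [hL _ (c4 0 zero_mem_II a (Sp_sub_Bl ha)) (c5 0 zero_mem_II a ha), c2 a (Sp_sub_Bl ha)]; exact hbd a ha
  · intro a ha
    simp only
    rw [c3 a (Sp_sub_Bl ha)]
  · intro τ hτ a ha
    apply emb_inj
    rw [hMk _ (c4 τ hτ a (Sp_sub_Bl ha))]
    exact (hL _ (c4 τ hτ a (Sp_sub_Bl ha)) (c5 τ hτ a ha)).symm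

end loops

end Part8

section Part9
lemma negI_im : (-Complex.I).im ≠ 0 := by simp

lemma I_im_ne : Complex.I.im ≠ 0 := by rw [Complex.I_im]; exact one_ne_zero

def Cc : CM := cw (-Complex.I) negI_im
def Aa : CM := 1 - Complex.I • Cc
def Bz (z : ℂ) : CM := 1 - (z + Complex.I) • Cc

lemma tI_ne (t : ℝ) : (t : ℂ) + Complex.I ≠ 0 := by
  have := sub_ne_of_im negI_im t
  simpa using this

lemma Cc_coe (t : ℝ) : Cc (t : S1) = ((t : ℂ) + Complex.I)⁻¹ := by
  rw [Cc, cw_coe, sub_neg_eq_add]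
lemma Aa_coe (t : ℝ) : Aa (t : S1) = (t : ℂ) / ((t : ℂ) + Complex.I) := by
  have := tI_ne t
  simp only [Aa, ContinuousMap.sub_apply, ContinuousMap.one_apply, ContinuousMap.smul_apply, Cc_coe, smul_eq_mul]
  field_simp; ring
lemma Bz_coe (z : ℂ) (t : ℝ) : Bz z (t : S1) = ((t : ℂ) - z) / ((t : ℂ) + Complex.I) := by
  have := tI_ne t
  simp only [Bz, ContinuousMap.sub_apply, ContinuousMap.one_apply, ContinuousMap.smul_apply, Cc_coe, smul_eq_mul]
  field_simp; ring
lemma Cc_infty : Cc OnePoint.infty = 0 := rfl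
lemma Aa_infty : Aa OnePoint.infty = 1 := by simp [Aa, Cc_infty]
lemma Bz_infty (z : ℂ) : Bz z OnePoint.infty = 1 := by simp [Bz, Cc_infty]

def bet (d e : ℕ) (z : ℂ) (i : ℕ) : CM := Aa ^ i * Bz z ^ e * Cc ^ (d - i)

def omz (d e : ℕ) (z : ℂ) (t : ℝ) : ℂ := ((t : ℂ) - z) ^ e * (((t : ℂ) + Complex.I)⁻¹) ^ (d + e)

lemma bet_coe (d e : ℕ) (z : ℂ) (i : ℕ) (hi : i ≤ d) (t : ℝ) :
    bet d e z i (t : S1) = omz d e z t * (t : ℂ) ^ i := by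
  obtain ⟨j, rfl⟩ := Nat.exists_eq_add_of_le hi
  simp only [bet, omz, ContinuousMap.mul_apply, ContinuousMap.pow_apply, Cc_coe, Aa_coe, Bz_coe, div_eq_mul_inv,
    mul_pow, Nat.add_sub_cancel_left, pow_add]
  ring

lemma bet_infty (d e : ℕ) (z : ℂ) (i : ℕ) (hi : i < d) : bet d e z i OnePoint.infty = 0 := by
  have : d - i ≠ 0 := by omega
  simp [bet, Cc_infty, this]
lemma bet_top (d e : ℕ) (z : ℂ) : bet d e z d OnePoint.infty = 1 := by
  simp [bet, Aa_infty, Bz_infty]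

lemma omz_ne (d e : ℕ) (z : ℂ) (hz : z.im ≠ 0) (t : ℝ) : omz d e z t ≠ 0 :=
  mul_ne_zero (pow_ne_zero _ (sub_ne_of_im hz t)) (pow_ne_zero _ (inv_ne_zero (tI_ne t)))

lemma conj_im_ne {z : ℂ} (hz : z.im ≠ 0) : (star z).im ≠ 0 := by simpa using hz

def Vz (z : ℂ) (hz : z.im ≠ 0) : CM := 1 + (star z - z) • cw (star z) (conj_im_ne hz)

lemma Vz_coe (z : ℂ) (hz : z.im ≠ 0) (t : ℝ) : Vz z hz (t : S1) = ((t : ℂ) - z) / star ((t : ℂ) - z) := by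
  have h := sub_ne_of_im (conj_im_ne hz) t
  have h2 : star ((t : ℂ) - z) = (t : ℂ) - star z := by simp
  rw [h2]
  simp only [Vz, ContinuousMap.add_apply, ContinuousMap.one_apply, ContinuousMap.smul_apply, cw_coe, smul_eq_mul]
  field_simp; ring

def BDz (d e : ℕ) (z : ℂ) (hz : z.im ≠ 0) : BD d where
  ω := omz d e z
  θ := Vz z hz ^ e * Vz Complex.I I_im_ne ^ (d + e)
  β := bet d e z
  ω_ne := omz_ne d e z hz
  ω_smooth := by
    unfold omz
    exact ((Complex.ofRealCLM.contDiff.sub contDiff_const).pow _).mul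
      (((Complex.ofRealCLM.contDiff.add contDiff_const).inv tI_ne).pow _)
  θ_infty := by simp [Vz, cw_infty]
  θ_coe := by
    intro t
    have h1 := tI_ne t
    have h2 := sub_ne_of_im hz t
    have h3 : (t : ℂ) - Complex.I = star ((t : ℂ) + Complex.I) := by simp [sub_eq_add_neg]
    rw [ContinuousMap.mul_apply, ContinuousMap.pow_apply, ContinuousMap.pow_apply, Vz_coe, Vz_coe, h3, star_star, omz]
    generalize (t : ℂ) + Complex.I = v at h1
    generalize (t : ℂ) - z = u at h2
    rw [star_mul', star_pow, star_pow, star_inv₀]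
    have h4 : star u ≠ 0 := by simpa using h2
    have h5 : star v ≠ 0 := by simpa using h1
    generalize star u = u' at h4
    generalize star v = v' at h5
    rw [div_pow, div_pow, inv_pow, inv_pow]
    field_simp
  β_coe := fun i hi t => bet_coe d e z i hi t
  β_infty := fun i hi => bet_infty d e z i hi
  β_top := bet_top d e z

variable {r : ℕ} {K : Set (Finset (Fin r))} {D e : Fin r → ℕ}

def lamZ (e : Fin r → ℕ) (z : Fin r → ℂ) (f : ∀ k : Fin r, Fin (D k) → ℂ) : Fin r → CM :=
  fun k => bet (D k) (e k) (z k) (D k) + ∑ i : Fin (D k), f k i • bet (D k) (e k) (z k) i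

lemma lamZ_eq (z : Fin r → ℂ) (hz : ∀ k, (z k).im ≠ 0) (f : ∀ k : Fin r, Fin (D k) → ℂ) :
    lamZ e z f = lamM (fun k => BDz (D k) (e k) (z k) (hz k)) f := rfl

lemma lamZ_coe (z : Fin r → ℂ) (f : ∀ k : Fin r, Fin (D k) → ℂ) (k : Fin r) (t : ℝ) :
    lamZ e z f k (t : S1) = (((t : ℂ) + Complex.I)⁻¹) ^ (D k + e k) *
      (((t : ℂ) - z k) ^ (e k) * (toPoly (f k)).eval (t : ℂ)) := by
  rw [toPoly_eval, lamZ]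
  simp only [ContinuousMap.add_apply, ContinuousMap.coe_sum, Finset.sum_apply, ContinuousMap.smul_apply,
    smul_eq_mul]
  have : ∀ i : Fin (D k), bet (D k) (e k) (z k) i (t : S1) = omz (D k) (e k) (z k) t * (t : ℂ) ^ (i : ℕ) :=
    fun i => bet_coe _ _ _ i i.2.le t
  simp only [this, bet_coe _ _ _ _ le_rfl, omz]
  rw [← mul_assoc, mul_add, mul_comm ((((t : ℂ) + Complex.I)⁻¹) ^ (D k + e k)), Finset.mul_sum]
  congr 1
  exact Finset.sum_congr rfl fun i _ => by ring

lemma lamZ_infty (z : Fin r → ℂ) (f : ∀ k : Fin r, Fin (D k) → ℂ) (k : Fin r) :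
    lamZ e z f k OnePoint.infty = 1 := by
  simp [lamZ, bet_top, bet_infty]

lemma bet_cont (d e i : ℕ) : Continuous (fun z => bet d e z i) := by
  unfold bet Bz
  fun_prop

lemma lamZ_cont (e : Fin r → ℕ) :
    Continuous (fun p : (∀ k : Fin r, Fin (D k) → ℂ) × (Fin r → ℂ) => lamZ e p.2 p.1) := by
  refine continuous_pi fun k => ?_
  unfold lamZ
  have hk : Continuous fun p : (∀ k : Fin r, Fin (D k) → ℂ) × (Fin r → ℂ) => p.2 k := by fun_prop
  refine ((bet_cont _ _ _).comp hk).add (continuous_finsetSum _ fun i _ => ?_)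
  have h : Continuous fun p : (∀ k : Fin r, Fin (D k) → ℂ) × (Fin r → ℂ) => p.1 k i := by fun_prop
  exact h.smul ((bet_cont _ _ _).comp hk)

/-- polynomials all of whose roots have real part less than a bound -/
def Pol' (K : Set (Finset (Fin r))) (D : Fin r → ℕ) (b : ℝ) : Set (∀ k : Fin r, Fin (D k) → ℂ) :=
  {f | f ∈ PolSp K D ∧ ∀ k, ∀ w : ℂ, (toPoly (f k)).eval w = 0 → w.re < b}

lemma lamZ_good {b : ℝ} (hE : ∅ ∈ K) (hρ : ∀ σ : Finset (Fin r), σ ∉ K → 2 ≤ σ.card) {z : Fin r → ℂ}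
    (hz : ∀ k, b < (z k).re) (hzi : ∀ k l : Fin r, ∀ t : ℝ, z k = t → z l = t → k = l)
    {f : ∀ k : Fin r, Fin (D k) → ℂ} (hf : f ∈ Pol' K D b) : GoodM K (lamZ e z f) := by
  refine ⟨lamZ_infty z f, fun x => ?_⟩
  induction x using OnePoint.rec with
  | infty =>
    have : (fun k => lamZ e z f k OnePoint.infty) = onesC := by funext k; exact lamZ_infty z f k
    rw [this]; exact ones_mem_UK hE
  | coe t =>
    rw [mem_UK]
    intro σ hσ
    by_contra hc
    push Not at hc
    have hc' : ∀ i ∈ σ, (t : ℂ) = z i ∨ (toPoly (f i)).eval (t : ℂ) = 0 := by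
      intro i hi
      have h := hc i hi
      rw [lamZ_coe] at h
      rcases mul_eq_zero.1 h with h | h
      · exact absurd h (pow_ne_zero _ (inv_ne_zero (tI_ne t)))
      · rcases mul_eq_zero.1 h with h | h
        · left; exact sub_eq_zero.1 (eq_zero_of_pow_eq_zero h)
        · right; exact h
    by_cases htb : t < b
    · obtain ⟨i, hi, hne⟩ := hf.1 σ hσ t
      rcases hc' i hi with h | h
      · have := hz i
        rw [← h] at this
        simp at this; linarith
      · exact hne h
    · have hall : ∀ i ∈ σ, (t : ℂ) = z i := by
        intro i hi
        rcases hc' i hi with h | h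
        · exact h
        · have := hf.2 i _ h
          simp at this; exact absurd this htb
      have h2 := hρ σ hσ
      obtain ⟨i, hi, j, hj, hij⟩ := Finset.one_lt_card.1 (by omega : 1 < σ.card)
      exact hij (hzi i j t (hall i hi).symm (hall j hj).symm)

/-- moving the points off the real axis -/
def xmv (x : Fin r → ℂ) (τ : ℝ) : Fin r → ℂ := fun k =>
  x k + ((if 0 ≤ (x k).im then |τ| else -|τ| : ℝ) : ℂ) * Complex.I

lemma xmv_cont (x : Fin r → ℂ) : Continuous (xmv x) := by
  refine continuous_pi fun k => ?_
  unfold xmv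
  by_cases h : 0 ≤ (x k).im
  · simp only [if_pos h]; fun_prop
  · simp only [if_neg h]; fun_prop

lemma xmv_re (x : Fin r → ℂ) (τ : ℝ) (k : Fin r) : (xmv x τ k).re = (x k).re := by simp [xmv]
lemma xmv_im_ne (x : Fin r → ℂ) (k : Fin r) : (xmv x 1 k).im ≠ 0 := by
  simp only [xmv, Complex.add_im, Complex.mul_im, Complex.ofReal_re, Complex.ofReal_im, Complex.I_re, Complex.I_im]
  by_cases h : 0 ≤ (x k).im
  · simp only [if_pos h]; simp; positivity
  · simp only [if_neg h]; simp; intro h'; linarith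
lemma xmv_zero (x : Fin r → ℂ) : xmv x 0 = x := by funext k; simp [xmv]
lemma xmv_sep {x : Fin r → ℂ} (hx : Function.Injective x) (τ : ℝ) (k l : Fin r) (t : ℝ)
    (hk : xmv x τ k = t) (hl : xmv x τ l = t) : k = l := by
  have key : ∀ k : Fin r, xmv x τ k = t → x k = t := by
    intro k hk
    have h1 := congrArg Complex.re hk
    have h2 := congrArg Complex.im hk
    rw [xmv_re] at h1
    apply Complex.ext h1
    simp only [xmv, Complex.add_im, Complex.mul_im, Complex.ofReal_re, Complex.ofReal_im, Complex.I_re, Complex.I_im] at h2 ⊢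
    have := abs_nonneg τ
    by_cases h : 0 ≤ (x k).im
    · simp only [if_pos h] at h2; linarith
    · simp only [if_neg h] at h2; linarith
  exact hx ((key k hk).trans (key l hl).symm)

/-- the map `j_1` -/
def j1 (hE : ∅ ∈ K) (b : ℝ) (e : Fin r → ℕ) (hρ : ∀ σ : Finset (Fin r), σ ∉ K → 2 ≤ σ.card) (x : Fin r → ℂ)
    (hxb : ∀ k, b < (x k).re) (hx : Function.Injective x) (f : ↥(Pol' K D b)) : LU hE :=
  mkLoop hE (lamZ e x f.1) (lamZ_good hE hρ hxb (fun k l t h1 h2 => hx (h1.trans h2.symm)) f.2)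

theorem comp_j1 {E : Type*} [NormedAddCommGroup E] [NormedSpace ℝ E]
    (hE : ∅ ∈ K) (b : ℝ) (e : Fin r → ℕ) (hρ : ∀ σ : Finset (Fin r), σ ∉ K → 2 ≤ σ.card) (x : Fin r → ℂ)
    (hxb : ∀ k, b < (x k).re) (hx : Function.Injective x)
    (hι : Comp E (fun f : ↥(Pol' K D b) => (⟨f.1, f.2.1⟩ : ↥(PolSp K D))))
    (hLam : ∀ X : ∀ k, BD (D k), Comp E (Lam (K := K) X hE)) :
    Comp E (j1 (D := D) hE b e hρ x hxb hx) := by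
  let J : ↥(Pol' K D b) × ℝ → LU hE := fun p => mkLoop hE (lamZ e (xmv x p.2) p.1.1)
    (lamZ_good hE hρ (fun k => by rw [xmv_re]; exact hxb k) (fun k l t h1 h2 => xmv_sep hx _ k l t h1 h2) p.1.2)
  have hJ : Continuous J := by
    rw [(emb_isInducing hE).continuous_iff]
    have : Continuous fun p : ↥(Pol' K D b) × ℝ => ((p.1.1, xmv x p.2) : (∀ k : Fin r, Fin (D k) → ℂ) × (Fin r → ℂ)) :=
      (continuous_subtype_val.comp continuous_fst).prodMk ((xmv_cont x).comp continuous_snd)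
    have h2 := (lamZ_cont (D := D) e).comp this
    have h3 : emb hE ∘ J = fun p => lamZ e (xmv x p.2) p.1.1 := by
      funext p
      exact emb_mkLoop hE _ _
    rw [h3]
    exact h2
  have h0 : j1 (D := D) hE b e hρ x hxb hx = fun p => J (p, 0) := by
    funext p
    apply emb_inj
    simp only [J, j1, emb_mkLoop, xmv_zero]
  rw [h0]
  apply comp_of_homotopic hJ
  have := (hLam (fun k => BDz (D k) (e k) (xmv x 1 k) (xmv_im_ne x k))).comp hι
    (Continuous.subtype_mk continuous_subtype_val _) (Lam_cont _ hE)
  exact this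

end Part9

section Part10
lemma toPoly_coeff_of_monic {d : ℕ} {p : Polynomial ℂ} (hp : p.Monic) (hd : p.natDegree = d) :
    toPoly (fun i : Fin d => p.coeff i) = p := by
  subst hd
  conv_rhs => rw [hp.as_sum]
  rw [toPoly, Finset.sum_range]

lemma toPoly_coeff {d : ℕ} (a : Fin d → ℂ) (i : Fin d) : (toPoly a).coeff i = a i := by
  rw [toPoly, Polynomial.coeff_add, Polynomial.coeff_X_pow, if_neg (by omega), zero_add, Polynomial.finsetSum_coeff]
  simp only [Polynomial.coeff_C_mul, Polynomial.coeff_X_pow]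
  rw [Finset.sum_eq_single i]
  · simp
  · intro j _ hj
    rw [if_neg (fun h => hj (Fin.ext h.symm)), mul_zero]
  · simp

lemma toPoly_inj {d : ℕ} {a b : Fin d → ℂ} (h : toPoly a = toPoly b) : a = b := by
  funext i
  rw [← toPoly_coeff a, h, toPoly_coeff]

lemma toPoly_deg_lt {d : ℕ} (a : Fin d → ℂ) :
    (∑ i : Fin d, Polynomial.C (a i) * Polynomial.X ^ (i : ℕ) : Polynomial ℂ).degree < d := by
  refine (Polynomial.degree_sum_le _ _).trans_lt ?_
  rw [Finset.sup_lt_iff (by exact WithBot.bot_lt_coe d)]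
  intro i _
  exact (Polynomial.degree_C_mul_X_pow_le _ _).trans_lt (by exact_mod_cast i.2)

lemma toPoly_monic {d : ℕ} (a : Fin d → ℂ) : (toPoly a).Monic :=
  Polynomial.monic_X_pow_add (toPoly_deg_lt a)

lemma toPoly_natDegree {d : ℕ} (a : Fin d → ℂ) : (toPoly a).natDegree = d := by
  apply Polynomial.natDegree_eq_of_degree_eq_some
  rw [toPoly, Polynomial.degree_add_eq_left_of_degree_lt]
  · simp
  · rw [Polynomial.degree_X_pow]; exact toPoly_deg_lt a

lemma toPoly_root_bound {d : ℕ} (a : Fin d → ℂ) {w : ℂ} (h : (toPoly a).eval w = 0) :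
    ‖w‖ ≤ 1 + ∑ i, ‖a i‖ := by
  by_contra hc
  push Not at hc
  have hS : 0 ≤ ∑ i, ‖a i‖ := Finset.sum_nonneg fun _ _ => norm_nonneg _
  have h1 : 1 ≤ ‖w‖ := by linarith
  rw [toPoly_eval] at h
  rcases Nat.eq_zero_or_pos d with rfl | hd
  · simp at h
  have h2 : ‖w‖ ^ d ≤ (∑ i, ‖a i‖) * ‖w‖ ^ (d - 1) := by
    rw [← norm_pow, eq_neg_of_add_eq_zero_left h, norm_neg, Finset.sum_mul]
    refine (norm_sum_le _ _).trans (Finset.sum_le_sum fun i _ => ?_)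
    rw [norm_mul, norm_pow]
    exact mul_le_mul_of_nonneg_left (pow_le_pow_right₀ h1 (by omega)) (norm_nonneg _)
  have h3 : ‖w‖ ^ d = ‖w‖ * ‖w‖ ^ (d - 1) := by
    rw [← pow_succ']; congr 1; omega
  rw [h3] at h2
  have := le_of_mul_le_mul_right h2 (by positivity)
  linarith

/-- shift of a polynomial -/
def shc {d : ℕ} (c : ℂ) (a : Fin d → ℂ) : Fin d → ℂ := fun n =>
  c ^ (d - n) * (d.choose n : ℂ) + ∑ i : Fin d, a i * (c ^ ((i : ℕ) - n) * ((i : ℕ).choose n : ℂ))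

lemma toPoly_shc {d : ℕ} (c : ℂ) (a : Fin d → ℂ) :
    toPoly (shc c a) = (toPoly a).comp (Polynomial.X + Polynomial.C c) := by
  have h1 : ((toPoly a).comp (Polynomial.X + Polynomial.C c)).Monic :=
    (toPoly_monic a).comp_X_add_C c
  have h2 : ((toPoly a).comp (Polynomial.X + Polynomial.C c)).natDegree = d := by
    rw [Polynomial.natDegree_comp, toPoly_natDegree, Polynomial.natDegree_X_add_C, mul_one]
  rw [← toPoly_coeff_of_monic h1 h2]
  congr 1
  funext n
  simp only [shc, toPoly, Polynomial.add_comp, Polynomial.X_pow_comp, Polynomial.sum_comp,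
    Polynomial.mul_comp, Polynomial.C_comp, Polynomial.coeff_add, Polynomial.finsetSum_coeff,
    Polynomial.coeff_C_mul, Polynomial.coeff_X_add_C_pow]

lemma shc_eval {d : ℕ} (c : ℂ) (a : Fin d → ℂ) (w : ℂ) :
    (toPoly (shc c a)).eval w = (toPoly a).eval (w + c) := by
  rw [toPoly_shc, Polynomial.eval_comp]; simp

variable {r : ℕ} {K : Set (Finset (Fin r))} {D : Fin r → ℕ}

def shD (c : ℝ) (f : ∀ k : Fin r, Fin (D k) → ℂ) : ∀ k : Fin r, Fin (D k) → ℂ := fun k => shc (c : ℂ) (f k)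

lemma shD_cont : Continuous fun p : ℝ × (∀ k : Fin r, Fin (D k) → ℂ) => shD p.1 p.2 := by
  refine continuous_pi fun k => continuous_pi fun n => ?_
  unfold shD shc
  have h : ∀ i, Continuous fun p : ℝ × (∀ k : Fin r, Fin (D k) → ℂ) => p.2 k i := fun i => by fun_prop
  have hc : Continuous fun p : ℝ × (∀ k : Fin r, Fin (D k) → ℂ) => (p.1 : ℂ) := by fun_prop
  exact ((hc.pow _).mul continuous_const).add
    (continuous_finsetSum _ fun i _ => (h i).mul ((hc.pow _).mul continuous_const))

lemma shD_contOn {X : Type*} [TopologicalSpace X] {s : Set X} {c : X → ℝ} {f : X → ∀ k : Fin r, Fin (D k) → ℂ}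
    (hc : ContinuousOn c s) (hf : ContinuousOn f s) : ContinuousOn (fun x => shD (c x) (f x)) s :=
  shD_cont.comp_continuousOn (f := fun x => (c x, f x)) (hc.prodMk hf)

lemma shD_mem (c : ℝ) {f : ∀ k : Fin r, Fin (D k) → ℂ} (hf : f ∈ PolSp K D) : shD c f ∈ PolSp K D := by
  intro σ hσ t
  obtain ⟨k, hk, h⟩ := hf σ hσ (t + c)
  refine ⟨k, hk, ?_⟩
  rw [shD, shc_eval]
  simpa using h

lemma shD_mem' {b c M : ℝ} {f : ∀ k : Fin r, Fin (D k) → ℂ} (hf : f ∈ PolSp K D)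
    (hM : ∀ k, ∀ w : ℂ, (toPoly (f k)).eval w = 0 → w.re < M) (hc : M - c ≤ b) : shD c f ∈ Pol' K D b := by
  refine ⟨shD_mem c hf, fun k w hw => ?_⟩
  rw [shD, shc_eval] at hw
  have := hM k _ hw
  simp at this
  linarith

lemma shD_zero (f : ∀ k : Fin r, Fin (D k) → ℂ) : shD 0 f = f := by
  funext k
  apply toPoly_inj
  rw [shD, toPoly_shc]; simp

theorem comp_incl {E : Type*} [NormedAddCommGroup E] [NormedSpace ℝ E] [FiniteDimensional ℝ E] (b : ℝ) :
    Comp E (fun f : ↥(Pol' K D b) => (⟨f.1, f.2.1⟩ : ↥(PolSp K D))) := by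
  refine comp_of_solv ?_
  intro g β hg hβ hgβ
  have hgc : ContinuousOn (fun x => (g x).1) (Bl E) := continuous_subtype_val.comp_continuousOn hg
  have hbd : ∃ M : ℝ, ∀ x ∈ Bl E, ∀ k, 1 + ∑ i, ‖(g x).1 k i‖ < M := by
    have hcomp : IsCompact (Bl E) := isCompact_closedBall _ _
    have hF : ContinuousOn (fun x => 1 + ∑ k, ∑ i, ‖(g x).1 k i‖) (Bl E) := by
      refine continuousOn_const.add (continuousOn_finsetSum _ fun k _ => continuousOn_finsetSum _ fun i _ => ?_)
      have h : Continuous fun p : (∀ k : Fin r, Fin (D k) → ℂ) => ‖p k i‖ := by fun_prop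
      exact h.comp_continuousOn hgc
    obtain ⟨M, hM⟩ := hcomp.bddAbove_image hF
    refine ⟨M + 1, fun x hx k => ?_⟩
    have h1 : 1 + ∑ k, ∑ i, ‖(g x).1 k i‖ ≤ M := hM ⟨x, hx, rfl⟩
    have h2 : ∑ i, ‖(g x).1 k i‖ ≤ ∑ k, ∑ i, ‖(g x).1 k i‖ :=
      Finset.single_le_sum (f := fun k => ∑ i, ‖(g x).1 k i‖)
        (fun k _ => Finset.sum_nonneg fun _ _ => norm_nonneg _) (Finset.mem_univ k)
    linarith
  obtain ⟨M, hM⟩ := hbd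
  have hroot : ∀ x ∈ Bl E, ∀ k, ∀ w : ℂ, (toPoly ((g x).1 k)).eval w = 0 → w.re < M := by
    intro x hx k w hw
    exact (Complex.re_le_norm w).trans_lt ((toPoly_root_bound _ hw).trans_lt (hM x hx k))
  set L : ℝ := |M - b| with hL
  have hL1 : M - L ≤ b := by have := le_abs_self (M - b); linarith
  have hL0 : 0 ≤ L := abs_nonneg _
  let c : E → E := fun x => if x ∈ Bl E then x else 0
  have hc : ∀ x, c x ∈ Bl E := by
    intro x
    by_cases h : x ∈ Bl E
    · simpa only [c, if_pos h] using h
    · simp only [c, if_neg h]; simp [mem_Bl]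
  have hc' : ∀ x ∈ Bl E, c x = x := fun x hx => if_pos hx
  let G : E → ↥(Pol' K D b) := fun x => ⟨shD L (g (c x)).1, shD_mem' (g (c x)).2 (hroot _ (hc x)) hL1⟩
  have hGval : ∀ x ∈ Bl E, (G x).1 = shD L (g x).1 := by
    intro x hx; simp only [G, hc' x hx]
  have hGc : ContinuousOn G (Bl E) := by
    rw [Topology.IsInducing.subtypeVal.continuousOn_iff]
    refine ContinuousOn.congr (f := fun x => shD L (g x).1) ?_ (fun x hx => hGval x hx)
    exact shD_contOn continuousOn_const hgc
  have hmem : ∀ (τ : ℝ) (p : ↥(Pol' K D b)), 0 ≤ τ → shD (τ * L) p.1 ∈ Pol' K D b := by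
    intro τ p hτ
    exact shD_mem' p.2.1 p.2.2 (by nlinarith [mul_nonneg hτ hL0])
  refine ⟨G, hGc, fun q => ⟨shD (q.1 * L) (g q.2).1, shD_mem _ (g q.2).2⟩,
    fun q => ⟨shD (|q.1| * L) (β q.2).1, hmem _ _ (abs_nonneg _)⟩, ?_, ?_, ?_, ?_, ?_, ?_, ?_⟩
  · rw [Topology.IsInducing.subtypeVal.continuousOn_iff]
    refine shD_contOn (c := fun q : ℝ × E => q.1 * L) (f := fun q : ℝ × E => (g q.2).1) (by fun_prop) ?_
    exact hgc.comp continuousOn_snd (fun p hp => hp.2)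
  · rw [Topology.IsInducing.subtypeVal.continuousOn_iff]
    refine shD_contOn (c := fun q : ℝ × E => |q.1| * L) (f := fun q : ℝ × E => (β q.2).1) (by fun_prop) ?_
    exact continuous_subtype_val.comp_continuousOn (hβ.comp continuousOn_snd (fun p hp => hp.2))
  · intro x hx
    apply Subtype.ext
    simp only [zero_mul, shD_zero]
  · intro x hx
    apply Subtype.ext
    simp only [one_mul, hGval x hx]
  · intro a ha
    apply Subtype.ext
    simp only [abs_zero, zero_mul, shD_zero]
  · intro a ha
    apply Subtype.ext
    rw [hGval a (Sp_sub_Bl ha), ← hgβ a ha]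
    simp only [abs_one, one_mul]
  · intro τ hτ a ha
    apply Subtype.ext
    simp only [abs_of_nonneg hτ.1, ← hgβ a ha]

/-! the homeomorphism Φ -/

def rho {d : ℕ} (w : Fin d → ℂ) : Fin d → ℂ := fun i =>
  (∏ j, (Polynomial.X - Polynomial.C (w j)) : Polynomial ℂ).coeff i

lemma toPoly_rho {d : ℕ} (w : Fin d → ℂ) : toPoly (rho w) = ∏ j, (Polynomial.X - Polynomial.C (w j)) := by
  refine toPoly_coeff_of_monic (Polynomial.monic_prod_of_monic _ _ fun j _ => Polynomial.monic_X_sub_C _) ?_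
  rw [Polynomial.natDegree_prod_of_monic _ _ fun j _ => Polynomial.monic_X_sub_C _]
  simp

lemma rho_cont {d : ℕ} : Continuous (rho (d := d)) := by
  refine continuous_pi fun i => ?_
  unfold rho
  have : ∀ (s : Finset (Fin d)) (n : ℕ), Continuous fun w : Fin d → ℂ =>
      (∏ j ∈ s, (Polynomial.X - Polynomial.C (w j)) : Polynomial ℂ).coeff n := by
    intro s
    induction s using Finset.induction_on with
    | empty => intro n; simp only [Finset.prod_empty]; exact continuous_const
    | insert j s hj ih =>
      intro n
      simp only [Finset.prod_insert hj, Polynomial.coeff_mul]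
      refine continuous_finsetSum _ fun p _ => Continuous.mul ?_ (ih _)
      simp only [Polynomial.coeff_sub, Polynomial.coeff_C]
      by_cases h : p.1 = 0
      · simp only [if_pos h]; fun_prop
      · simp only [if_neg h]; fun_prop
  exact this _ _

lemma rho_roots {d : ℕ} (w : Fin d → ℂ) : (toPoly (rho w)).roots = Finset.univ.val.map w := by
  rw [toPoly_rho, Polynomial.roots_prod _ _ (Finset.prod_ne_zero_iff.2 fun j _ => Polynomial.X_sub_C_ne_zero _)]
  simp only [Polynomial.roots_X_sub_C]
  exact Multiset.bind_singleton _ _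

lemma rho_surj {d : ℕ} : Function.Surjective (rho (d := d)) := by
  intro a
  have hs : (toPoly a).Splits := IsAlgClosed.splits _
  obtain ⟨l, hl⟩ := Quotient.exists_rep (toPoly a).roots
  have hlen : l.length = d := by
    have h := hs.natDegree_eq_card_roots
    rw [toPoly_natDegree, ← hl] at h
    exact h.symm
  subst hlen
  refine ⟨l.get, toPoly_inj ?_⟩
  rw [toPoly_rho]
  have h2 := hs.eq_prod_roots_of_monic (toPoly_monic a)
  rw [h2, ← hl]
  simp only [Multiset.quot_mk_to_coe, Multiset.map_coe, Multiset.prod_coe]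
  rw [← List.prod_ofFn]
  congr 1
  conv_rhs => rw [← List.ofFn_get l, List.map_ofFn]
  rfl

lemma rho_closed {d : ℕ} : IsClosedMap (rho (d := d)) := by
  have : IsProperMap (rho (d := d)) := by
    rw [isProperMap_iff_isCompact_preimage]
    refine ⟨rho_cont, fun {S} hS => ?_⟩
    refine Metric.isCompact_of_isClosed_isBounded (hS.isClosed.preimage rho_cont) ?_
    obtain ⟨M, hM⟩ := hS.bddAbove_image (f := fun a : Fin d → ℂ => 1 + ∑ i, ‖a i‖) (by fun_prop)
    rw [isBounded_iff_forall_norm_le]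
    refine ⟨max M 0, fun w hw => ?_⟩
    rw [pi_norm_le_iff_of_nonneg (le_max_right _ _)]
    intro j
    refine le_trans (toPoly_root_bound (rho w) ?_) ((hM ⟨rho w, hw, rfl⟩).trans (le_max_left _ _))
    rw [toPoly_rho, Polynomial.eval_prod]
    exact Finset.prod_eq_zero (Finset.mem_univ j) (by simp)
  exact this.isClosedMap

def Pm {d : ℕ} (φ : ℂ → ℂ) (a : Fin d → ℂ) : Fin d → ℂ := fun i =>
  ((((toPoly a).roots.map φ).map fun α => Polynomial.X - Polynomial.C α).prod).coeff i

lemma Pm_rho {d : ℕ} (φ : ℂ → ℂ) (w : Fin d → ℂ) : Pm φ (rho w) = rho (fun j => φ (w j)) := by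
  funext i
  rw [Pm, rho_roots, rho]
  simp only [Multiset.map_map]
  rfl

lemma toPoly_Pm {d : ℕ} (φ : ℂ → ℂ) (a : Fin d → ℂ) :
    toPoly (Pm φ a) = (((toPoly a).roots.map φ).map fun α => Polynomial.X - Polynomial.C α).prod := by
  obtain ⟨w, rfl⟩ := rho_surj a
  rw [Pm_rho, toPoly_rho, rho_roots]
  simp only [Multiset.map_map]
  rfl

lemma rho_eval {d : ℕ} (w : Fin d → ℂ) (z : ℂ) : (toPoly (rho w)).eval z = 0 ↔ ∃ j, z = w j := by
  rw [toPoly_rho, Polynomial.eval_prod, Finset.prod_eq_zero_iff]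
  simp [sub_eq_zero]

lemma Pm_root {d : ℕ} (φ : ℂ → ℂ) (a : Fin d → ℂ) (z : ℂ) :
    (toPoly (Pm φ a)).eval z = 0 ↔ ∃ w, (toPoly a).eval w = 0 ∧ z = φ w := by
  obtain ⟨w, rfl⟩ := rho_surj a
  rw [Pm_rho, rho_eval]
  constructor
  · rintro ⟨j, rfl⟩; exact ⟨w j, (rho_eval w _).2 ⟨j, rfl⟩, rfl⟩
  · rintro ⟨v, hv, rfl⟩
    obtain ⟨j, rfl⟩ := (rho_eval w _).1 hv
    exact ⟨j, rfl⟩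

lemma Pm_Pm {d : ℕ} (φ ψ : ℂ → ℂ) (a : Fin d → ℂ) (h : ∀ w, (toPoly a).eval w = 0 → ψ (φ w) = w) :
    Pm ψ (Pm φ a) = a := by
  obtain ⟨w, rfl⟩ := rho_surj a
  rw [Pm_rho, Pm_rho]
  congr 1
  funext j
  exact h _ ((rho_eval w _).2 ⟨j, rfl⟩)

lemma Pm_contOn {d : ℕ} {φ : ℂ → ℂ} {T : Set ℂ} (hφ : ContinuousOn φ T) :
    ContinuousOn (Pm (d := d) φ) {a | ∀ w, (toPoly a).eval w = 0 → w ∈ T} := by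
  set S : Set (Fin d → ℂ) := {a | ∀ w, (toPoly a).eval w = 0 → w ∈ T} with hS
  rw [continuousOn_iff_continuous_domRestrict]
  have hq : Topology.IsQuotientMap (S.restrictPreimage (rho (d := d))) :=
    (rho_closed.restrictPreimage S).isQuotientMap (rho_cont.restrictPreimage)
      (S.restrictPreimage_surjective rho_surj)
  rw [hq.continuous_iff]
  have h1 : (S.domRestrict (Pm φ)) ∘ (S.restrictPreimage rho) = fun w : ↥(rho ⁻¹' S) => rho (fun j => φ (w.1 j)) := by
    funext w
    exact Pm_rho φ w.1
  rw [h1]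
  refine rho_cont.comp (continuous_pi fun j => ?_)
  refine hφ.comp_continuous ((continuous_apply j).comp continuous_subtype_val) ?_
  intro w
  exact w.2 _ ((rho_eval w.1 _).2 ⟨j, rfl⟩)

def PmD (φ : ℂ → ℂ) (f : ∀ k : Fin r, Fin (D k) → ℂ) : ∀ k : Fin r, Fin (D k) → ℂ := fun k => Pm φ (f k)

lemma PmD_mem {b : ℝ} {φ : ℂ → ℂ} (hφ : AdmissiblePhi b φ) {f : ∀ k : Fin r, Fin (D k) → ℂ}
    (hf : f ∈ PolSp K D) : PmD φ f ∈ Pol' K D b := by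
  obtain ⟨h1, h2, h3, h4, h5⟩ := hφ
  refine ⟨?_, ?_⟩
  · intro σ hσ t
    by_contra hc
    push Not at hc
    rcases σ.eq_empty_or_nonempty with rfl | ⟨k₀, hk₀⟩
    · obtain ⟨k, hk, -⟩ := hf _ hσ 0
      simp at hk
    · obtain ⟨w, hw, htw⟩ := (Pm_root φ (f k₀) t).1 (hc k₀ hk₀)
      have ht : (t : ℂ) ∈ φ '' {z : ℂ | z.im = 0} := by
        rw [h5]
        refine ⟨by simp, ?_⟩
        have : φ w ∈ Set.range φ := ⟨w, rfl⟩
        rw [h4, ← htw] at this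
        exact this
      obtain ⟨v, hv, hvt⟩ := ht
      have hv' : ((v.re : ℝ) : ℂ) = v := by
        apply Complex.ext
        · simp
        · simp only [Complex.ofReal_im]; exact hv.symm
      obtain ⟨k, hk, hne⟩ := hf σ hσ v.re
      obtain ⟨w', hw', htw'⟩ := (Pm_root φ (f k) t).1 (hc k hk)
      have : w' = v := h2 (htw'.symm.trans hvt.symm)
      rw [hv', ← this] at hne
      exact hne hw'
  · intro k w hw
    obtain ⟨v, hv, rfl⟩ := (Pm_root φ (f k) w).1 hw
    have : φ v ∈ Set.range φ := ⟨v, rfl⟩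
    rw [h4] at this
    exact this

lemma PmD_mem_inv {b : ℝ} {φ ψ : ℂ → ℂ} (hφ : AdmissiblePhi b φ) (hψ : ∀ w : ℂ, w.re < b → φ (ψ w) = w)
    {f : ∀ k : Fin r, Fin (D k) → ℂ}
    (hf : f ∈ Pol' K D b) : PmD ψ f ∈ PolSp K D := by
  obtain ⟨h1, h2, h3, h4, h5⟩ := hφ
  intro σ hσ t
  by_contra hc
  push Not at hc
  have ht : φ t ∈ {z : ℂ | z.im = 0 ∧ z.re < b} := by
    rw [← h5]
    exact ⟨t, by simp, rfl⟩
  have hv' : (((φ t).re : ℝ) : ℂ) = φ t := by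
    apply Complex.ext
    · simp
    · simp only [Complex.ofReal_im]; exact ht.1.symm
  obtain ⟨k, hk, hne⟩ := hf.1 σ hσ (φ t).re
  obtain ⟨w, hw, htw⟩ := (Pm_root ψ (f k) t).1 (hc k hk)
  rw [hv', htw, hψ w (hf.2 k w hw)] at hne
  exact hne hw

def PhiMap {b : ℝ} {φ : ℂ → ℂ} (hφ : AdmissiblePhi b φ) (f : ↥(PolSp K D)) : ↥(Pol' K D b) :=
  ⟨PmD φ f.1, PmD_mem hφ f.2⟩

lemma PhiMap_cont {b : ℝ} {φ : ℂ → ℂ} (hφ : AdmissiblePhi b φ) :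
    Continuous (PhiMap (K := K) (D := D) hφ) := by
  refine Continuous.subtype_mk (continuous_pi fun k => ?_) _
  have h : Continuous (Pm (d := D k) φ) := by
    rw [← continuousOn_univ]
    exact (Pm_contOn (T := Set.univ) hφ.1.continuousOn).mono (fun a _ w _ => Set.mem_univ _)
  exact h.comp ((continuous_apply k).comp continuous_subtype_val)

theorem comp_Phi {E : Type*} [NormedAddCommGroup E] [NormedSpace ℝ E] {b : ℝ} {φ : ℂ → ℂ} (hφ : AdmissiblePhi b φ) :
    Comp E (PhiMap (K := K) (D := D) hφ) := by
  set ψ := Function.invFun φ with hψd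
  have hl : Function.LeftInverse ψ φ := Function.leftInverse_invFun hφ.2.1
  have hψ : ∀ w : ℂ, w.re < b → φ (ψ w) = w := by
    intro w hw
    have : w ∈ Set.range φ := by rw [hφ.2.2.2.1]; exact hw
    exact Function.invFun_eq this
  have hψc : ContinuousOn ψ {w : ℂ | w.re < b} := by
    rw [← hφ.2.2.2.1]
    exact hφ.2.2.1.continuousOn_range_of_leftInverse hl
  refine comp_of_inverse (i := fun f : ↥(Pol' K D b) => (⟨PmD ψ f.1, PmD_mem_inv hφ hψ f.2⟩ : ↥(PolSp K D))) ?_ ?_ ?_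
  · refine Continuous.subtype_mk (continuous_pi fun k => ?_) _
    refine (Pm_contOn (d := D k) hψc).comp_continuous ((continuous_apply k).comp continuous_subtype_val) ?_
    intro f w hw
    exact f.2.2 k w hw
  · intro p
    apply Subtype.ext
    funext k
    exact Pm_Pm φ ψ _ (fun w _ => hl w)
  · intro p
    apply Subtype.ext
    funext k
    exact Pm_Pm ψ φ _ (fun w hw => hψ w (p.2.2 k w hw))

end Part10

section Part11
variable {n r : ℕ}

lemma zr_inj {v w : Fin n → ℤ} (h : zr v = zr w) : v = w := by
  funext i
  have := congrFun h i
  simp only [zr] at this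
  exact_mod_cast this

lemma gen_in_basis {F : Fan n} {N : Fin r → Fin n → ℤ} (hN : IsPrimGens F N) {Z : Finset (Fin r)}
    (hZ : Z ∈ KC F N) {b : Module.Basis (Fin n) ℤ (Fin n → ℤ)} {s : Finset (Fin n)}
    (hb : coneIdx N Z = {x | ∃ lam : Fin n → ℝ, (∀ i, 0 ≤ lam i) ∧ x = ∑ i ∈ s, lam i • zr (b i)})
    {i : Fin r} (hi : i ∈ Z) : ∃ l, b l = N i := by
  have hsub : ray (zr (N i)) ⊆ coneIdx N Z := by
    rintro x ⟨t, ht, rfl⟩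
    refine ⟨fun k => if k = i then t else 0, fun k => by dsimp only; split_ifs <;> simp [ht], ?_⟩
    rw [Finset.sum_eq_single i]
    · simp
    · intro k _ hk; simp [hk]
    · intro h; exact absurd hi h
  obtain ⟨L, hL, hLe⟩ := F.inter_face _ hZ _ (hN.ray_mem i)
  rw [Set.inter_eq_right.2 hsub] at hLe
  have hself : zr (N i) ∈ ray (zr (N i)) := ⟨1, zero_le_one, by simp⟩
  have hL0 : L (zr (N i)) = 0 := by
    have := hself
    rw [hLe] at this
    exact this.2
  have hmem := hsub hself
  rw [hb] at hmem
  obtain ⟨lam, hlam, hx⟩ := hmem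
  have hbl : ∀ l ∈ s, zr (b l) ∈ coneIdx N Z := by
    intro l hl
    rw [hb]
    refine ⟨fun k => if k = l then 1 else 0, fun k => by dsimp only; split_ifs <;> simp, ?_⟩
    rw [Finset.sum_eq_single l]
    · simp
    · intro k _ hk; simp [hk]
    · intro h; exact absurd hl h
  have hsum : ∑ l ∈ s, lam l * L (zr (b l)) = 0 := by
    rw [← hL0]
    conv_rhs => rw [hx, map_sum]
    exact Finset.sum_congr rfl fun l _ => by rw [map_smul, smul_eq_mul]
  have hz := (Finset.sum_eq_zero_iff_of_nonneg (fun l hl => mul_nonneg (hlam l) (hL _ (hbl l hl)))).1 hsum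
  have hex : ∃ l ∈ s, lam l ≠ 0 := by
    by_contra hc
    push Not at hc
    apply hN.ne_zero i
    apply zr_inj
    rw [hx, Finset.sum_eq_zero (fun l hl => by rw [hc l hl, zero_smul])]
    funext j; simp [zr]
  obtain ⟨l, hl, hne⟩ := hex
  have hLl : L (zr (b l)) = 0 := (mul_eq_zero.1 (hz l hl)).resolve_left hne
  have hray : zr (b l) ∈ ray (zr (N i)) := by
    rw [hLe]; exact ⟨hbl l hl, hLl⟩
  have hlat : zr (b l) ∈ ray (zr (N i)) ∩ {x | IsLatticePoint x} := ⟨hray, fun j => ⟨b l j, rfl⟩⟩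
  rw [hN.primitive i] at hlat
  obtain ⟨c, hc⟩ := hlat
  have hc' : b l = (c : ℤ) • N i := by
    apply zr_inj
    rw [hc]
    funext j
    simp [zr]
  have h1 : (1 : ℤ) = (c : ℤ) * b.repr (N i) l := by
    have := congrArg (fun v => b.repr v l) hc'
    simp only [map_smul, Finsupp.smul_apply, smul_eq_mul, Module.Basis.repr_self, Finsupp.single_eq_same] at this
    exact this
  have h2 : (c : ℤ) = 1 := by
    have := Int.isUnit_iff.1 (IsUnit.of_mul_eq_one _ h1.symm)
    omega
  exact ⟨l, by rw [hc', h2, one_smul]⟩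

lemma exists_split {F : Fan n} (hF : F.NonSingular) {N : Fin r → Fin n → ℤ} (hN : IsPrimGens F N)
    (hC : Cond2 N) {Z : Finset (Fin r)} (hZ : Z ∈ KC F N) :
    ∃ m : Fin r → Fin n → ℤ, (∀ (v : Fin n → ℤ) (j : Fin n), ∑ k, (∑ l, v l * m k l) * N k j = v j) ∧
      ∀ i ∈ Z, ∀ k, ∑ l, N i l * m k l = if k = i then 1 else 0 := by
  obtain ⟨b, s, hb⟩ := hF _ hZ
  have hl : ∀ i ∈ Z, ∃ l, b l = N i := fun i hi => gen_in_basis hN hZ hb hi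
  have ha : ∀ l : Fin n, ∃ a : Fin r → ℤ, (∑ k, a k • N k = b l) ∧
      ∀ i ∈ Z, b l = N i → ∀ k, a k = if k = i then 1 else 0 := by
    intro l
    by_cases h : ∃ i ∈ Z, b l = N i
    · obtain ⟨i, hi, hbi⟩ := h
      refine ⟨fun k => if k = i then 1 else 0, by simp [hbi], ?_⟩
      intro i' _ hbi' k
      have : i = i' := hN.inj (hbi.symm.trans hbi')
      rw [this]
    · have : b l ∈ Submodule.span ℤ (Set.range N) := by rw [hC]; trivial
      obtain ⟨a, ha⟩ := (Submodule.mem_span_range_iff_exists_fun ℤ).1 this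
      exact ⟨a, ha, fun i hi hbi => absurd ⟨i, hi, hbi⟩ h⟩
  choose a ha1 ha2 using ha
  have hval : ∀ (v : Fin n → ℤ) (k : Fin r),
      ∑ j, v j * (∑ l, b.repr (Pi.single j 1) l * a l k) = ∑ l, b.repr v l * a l k := by
    intro v k
    have h1 : v = ∑ j, v j • (Pi.single j (1:ℤ) : Fin n → ℤ) := by
      funext i
      simp [Finset.sum_apply, Pi.single_apply]
    conv_rhs => rw [h1]
    simp only [map_sum, map_smul, Finsupp.coe_finsetSum, Finset.sum_apply, Finsupp.smul_apply, smul_eq_mul,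
      Finset.mul_sum, Finset.sum_mul]
    rw [Finset.sum_comm]
    exact Finset.sum_congr rfl fun _ _ => Finset.sum_congr rfl fun _ _ => by ring
  refine ⟨fun k j => ∑ l, b.repr (Pi.single j 1) l * a l k, ?_, ?_⟩
  · intro v j
    simp only [hval]
    have h2 : v = ∑ l, b.repr v l • b l := (b.sum_repr v).symm
    conv_rhs => rw [h2]
    simp only [← ha1, Finset.sum_apply, Pi.smul_apply, smul_eq_mul, Finset.sum_mul, Finset.mul_sum]
    rw [Finset.sum_comm]
    exact Finset.sum_congr rfl fun _ _ => Finset.sum_congr rfl fun _ _ => by ring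
  · intro i hi k
    simp only [hval]
    obtain ⟨l, hl⟩ := hl i hi
    rw [← hl]
    simp only [Module.Basis.repr_self]
    rw [Finset.sum_eq_single l]
    · simp only [Finsupp.single_eq_same, one_mul]
      exact ha2 l i hi hl k
    · intro l' _ hne
      rw [Finsupp.single_apply, if_neg (fun h => hne h.symm), zero_mul]
    · simp

def UZ (Z : Finset (Fin r)) : Set (Fin r → ℂ) := {x | ∀ j ∉ Z, x j ≠ 0}

lemma prod_zpow_sum {ι : Type*} (s : Finset ι) {x : ℂ} (hx : x ≠ 0) (f : ι → ℤ) :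
    ∏ i ∈ s, x ^ f i = x ^ ∑ i ∈ s, f i := by
  induction s using Finset.induction_on with
  | empty => simp
  | insert i s hi ih => rw [Finset.prod_insert hi, Finset.sum_insert hi, ih, zpow_add₀ hx]

theorem nu_exists {F : Fan n} (hF : F.NonSingular) {N : Fin r → Fin n → ℤ} (hN : IsPrimGens F N)
    (hC : Cond2 N) {Z : Finset (Fin r)} (hZ : Z ∈ KC F N) :
    ∃ ν : (Fin r → ℂ) → (Fin r → ℂ), ContinuousOn ν (UZ Z) ∧ (∀ x ∈ UZ Z, ν x ∈ GSet N) ∧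
      ∀ x ∈ UZ Z, ∀ μ ∈ GSet N, ∀ k, ν (fun i => μ i * x i) k * μ k = ν x k := by
  obtain ⟨m, h1, h2⟩ := exists_split hF hN hC hZ
  let A : Fin r → Fin r → ℤ := fun k k' => (if k' = k then 1 else 0) - ∑ l, N k l * m k' l
  have hA : ∀ i ∈ Z, ∀ k, A i k = 0 := fun i hi k => by simp only [A, h2 i hi k, sub_self]
  let y : (Fin r → ℂ) → Fin r → ℂ := fun x k => if k ∈ Z then 1 else x k
  have hy : ∀ x ∈ UZ Z, ∀ k, y x k ≠ 0 := by
    intro x hx k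
    by_cases h : k ∈ Z
    · simp [y, h]
    · simpa [y, h] using hx k h
  have hyc : ∀ k, Continuous fun x => y x k := by
    intro k
    by_cases h : k ∈ Z
    · simp only [y, if_pos h]; exact continuous_const
    · simp only [y, if_neg h]; exact continuous_apply k
  refine ⟨fun x k' => ∏ k, y x k ^ (-A k k'), ?_, ?_, ?_⟩
  · refine continuousOn_pi.2 fun k' => continuousOn_finsetProd _ fun k _ => ?_
    exact ContinuousOn.zpow₀ (hyc k).continuousOn _ (fun x hx => Or.inl (hy x hx k))
  · intro x hx
    refine ⟨fun k' => Finset.prod_ne_zero_iff.2 fun k _ => zpow_ne_zero _ (hy x hx k), fun mm => ?_⟩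
    have : ∀ k', (∏ k, y x k ^ (-A k k')) ^ (∑ j, N k' j * mm j)
        = ∏ k, y x k ^ (-A k k' * ∑ j, N k' j * mm j) := by
      intro k'
      rw [← Finset.prod_zpow]
      exact Finset.prod_congr rfl fun k _ => (zpow_mul _ _ _).symm
    simp only [this]
    rw [Finset.prod_comm]
    refine Finset.prod_eq_one fun k _ => ?_
    rw [prod_zpow_sum _ (hy x hx k)]
    have h0 : ∑ k', -A k k' * ∑ j, N k' j * mm j = 0 := by
      have e1 : ∑ k', (if k' = k then (1:ℤ) else 0) * ∑ j, N k' j * mm j = ∑ j, N k j * mm j := by simp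
      have e2 : ∑ k', (∑ l, N k l * m k' l) * ∑ j, N k' j * mm j = ∑ j, N k j * mm j := by
        simp only [Finset.mul_sum]
        rw [Finset.sum_comm]
        refine Finset.sum_congr rfl fun j _ => ?_
        rw [← h1 (N k) j, Finset.sum_mul]
        exact Finset.sum_congr rfl fun _ _ => by ring
      simp only [A, neg_sub, sub_mul, Finset.sum_sub_distrib, e1, e2, sub_self]
    rw [h0, zpow_zero]
  · intro x hx μ hμ k'
    have hyy : ∀ k, y (fun i => μ i * x i) k ^ (-A k k') = μ k ^ (-A k k') * y x k ^ (-A k k') := by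
      intro k
      by_cases h : k ∈ Z
      · rw [hA k h]; simp
      · rw [← mul_zpow]; simp only [y, if_neg h]
    simp only [hyy, Finset.prod_mul_distrib]
    have hμ' : ∏ k, μ k ^ (-A k k') = (μ k')⁻¹ := by
      have e : ∀ k, μ k ^ (-A k k') = (if k' = k then (μ k')⁻¹ else 1) * μ k ^ (∑ l, N k l * m k' l) := by
        intro k
        simp only [A, neg_sub]
        rw [sub_eq_neg_add, zpow_add₀ (hμ.1 k)]
        by_cases h : k' = k
        · subst h; simp
        · simp [h]
      simp only [e, Finset.prod_mul_distrib, hμ.2 (m k'), mul_one]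
      simp
    rw [hμ']
    have := hμ.1 k'
    field_simp

end Part11

section Part12
variable {n r : ℕ} {N : Fin r → Fin n → ℤ} {K : Set (Finset (Fin r))}

lemma one_mem_G : (fun _ => 1 : Fin r → ℂ) ∈ GSet N := ⟨fun _ => one_ne_zero, fun m => by simp⟩
lemma mul_mem_G {μ μ' : Fin r → ℂ} (h : μ ∈ GSet N) (h' : μ' ∈ GSet N) : (fun k => μ k * μ' k) ∈ GSet N :=
  ⟨fun k => mul_ne_zero (h.1 k) (h'.1 k), fun m => by
    simp only [mul_zpow, Finset.prod_mul_distrib, h.2 m, h'.2 m, mul_one]⟩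
lemma inv_mem_G {μ : Fin r → ℂ} (h : μ ∈ GSet N) : (fun k => (μ k)⁻¹) ∈ GSet N :=
  ⟨fun k => inv_ne_zero (h.1 k), fun m => by
    simp only [inv_zpow, Finset.prod_inv_distrib, h.2 m, inv_one]⟩

lemma toricRel_equiv : Equivalence (toricRel N K) where
  refl x := ⟨_, one_mem_G, by funext i; simp⟩
  symm := by
    rintro x y ⟨μ, hμ, h⟩
    refine ⟨_, inv_mem_G hμ, ?_⟩
    rw [← h]
    funext i
    have := hμ.1 i
    field_simp
  trans := by
    rintro x y z ⟨μ, hμ, h⟩ ⟨μ', hμ', h'⟩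
    refine ⟨_, mul_mem_G hμ' hμ, ?_⟩
    rw [← h', ← h]
    funext i
    ring

lemma qmap_eq_iff {x y : ↥(UK K)} : qmap N K x = qmap N K y ↔ toricRel N K x y := by
  constructor
  · intro h
    exact (Equivalence.eqvGen_iff toricRel_equiv).1 (Quot.eqvGen_exact h)
  · exact fun h => Quot.sound h

lemma mul_mem_UK {μ x : Fin r → ℂ} (hμ : ∀ k, μ k ≠ 0) (hx : x ∈ UK K) : (fun k => μ k * x k) ∈ UK K := by
  rw [mem_UK] at hx ⊢
  intro σ hσ
  obtain ⟨i, hi, h⟩ := hx σ hσ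
  exact ⟨i, hi, mul_ne_zero (hμ i) h⟩

def act (μ : Fin r → ℂ) (u : ↥(UK K)) : ↥(UK K) :=
  if h : (fun k => μ k * u.1 k) ∈ UK K then ⟨_, h⟩ else u

lemma act_val {μ : Fin r → ℂ} (hμ : ∀ k, μ k ≠ 0) (u : ↥(UK K)) : (act μ u).1 = fun k => μ k * u.1 k := by
  rw [act, dif_pos (mul_mem_UK hμ u.2)]

lemma act_contOn {Y : Type*} [TopologicalSpace Y] {T : Set Y} {μ : Y → Fin r → ℂ} {L : Y → ↥(UK K)}
    (hμ : ContinuousOn μ T) (hL : ContinuousOn L T) (h0 : ∀ p ∈ T, ∀ k, μ p k ≠ 0) :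
    ContinuousOn (fun p => act (μ p) (L p)) T := by
  rw [Topology.IsInducing.subtypeVal.continuousOn_iff]
  refine ContinuousOn.congr (f := fun p k => μ p k * (L p).1 k) ?_ (fun p hp => act_val (h0 p hp) _)
  refine continuousOn_pi.2 fun k => ContinuousOn.mul ?_ ?_
  · exact (continuous_apply k).comp_continuousOn hμ
  · exact ((continuous_apply k).comp continuous_subtype_val).comp_continuousOn hL

lemma qmap_act {μ : Fin r → ℂ} (hμ : μ ∈ GSet N) (u : ↥(UK K)) : qmap N K (act μ u) = qmap N K u :=
  (qmap_eq_iff.2 ⟨μ, hμ, (act_val hμ.1 u).symm⟩).symm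

/-- the bundle data -/
def HNu (N : Fin r → Fin n → ℤ) (K : Set (Finset (Fin r))) : Prop :=
  ∀ Z ∈ K, ∃ ν : (Fin r → ℂ) → (Fin r → ℂ), ContinuousOn ν (UZ Z) ∧ (∀ x ∈ UZ Z, ν x ∈ GSet N) ∧
      ∀ x ∈ UZ Z, ∀ μ ∈ GSet N, ∀ k, ν (fun i => μ i * x i) k * μ k = ν x k

lemma isOpen_UZ (Z : Finset (Fin r)) : IsOpen (UZ Z) := by
  have : UZ Z = ⋂ j : Fin r, {x | j ∉ Z → x j ≠ 0} := by ext x; simp [UZ]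
  rw [this]
  refine isOpen_iInter_of_finite fun j => ?_
  by_cases h : j ∈ Z
  · simp [h]
  · simp only [h, not_false_eq_true, forall_const]
    exact isOpen_ne_fun (continuous_apply j) continuous_const

lemma exists_Z (u : ↥(UK K)) : ∃ Z ∈ K, u.1 ∈ UZ Z := by
  refine ⟨Finset.univ.filter fun k => u.1 k = 0, ?_, ?_⟩
  · by_contra hc
    obtain ⟨i, hi, h⟩ := mem_UK.1 u.2 _ hc
    simp at hi
    exact h hi
  · intro j hj
    simpa using hj

lemma UZ_act {Z : Finset (Fin r)} {μ x : Fin r → ℂ} (hμ : ∀ k, μ k ≠ 0) :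
    (fun k => μ k * x k) ∈ UZ Z ↔ x ∈ UZ Z := by
  simp [UZ, hμ]

lemma local_section (h : HNu N K) (p : XS N K) :
    ∃ (V : Set (XS N K)) (s : XS N K → ↥(UK K)), IsOpen V ∧ p ∈ V ∧ ContinuousOn s V ∧
      ∀ v ∈ V, qmap N K (s v) = v := by
  obtain ⟨u, rfl⟩ : ∃ u, qmap N K u = p := Quot.exists_rep p
  obtain ⟨Z, hZ, hu⟩ := exists_Z u
  obtain ⟨ν, h1, h2, h3⟩ := h Z hZ
  set W : Set ↥(UK K) := {x | x.1 ∈ UZ Z} with hW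
  have hWo : IsOpen W := (isOpen_UZ Z).preimage continuous_subtype_val
  have hsat : ∀ x y : ↥(UK K), qmap N K x = qmap N K y → x ∈ W → y ∈ W := by
    intro x y hxy hx
    obtain ⟨μ, hμ, e⟩ := qmap_eq_iff.1 hxy
    show y.1 ∈ UZ Z
    rw [← e, UZ_act hμ.1]; exact hx
  have hpre : qmap N K ⁻¹' (qmap N K '' W) = W := by
    ext y
    constructor
    · rintro ⟨x, hx, hxy⟩; exact hsat x y hxy hx
    · exact fun hy => ⟨y, hy, rfl⟩
  have hq : Topology.IsQuotientMap (qmap N K) := isQuotientMap_quot_mk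
  have hVo : IsOpen (qmap N K '' W) := by
    rw [← hq.isOpen_preimage, hpre]; exact hWo
  let σ : ↥(UK K) → ↥(UK K) := fun x => act (ν x.1) x
  have hσc : ContinuousOn σ W := by
    refine act_contOn (μ := fun x : ↥(UK K) => ν x.1) (L := fun x => x) ?_ continuousOn_id (fun p hp => (h2 _ hp).1)
    exact h1.comp continuous_subtype_val.continuousOn (fun x hx => hx)
  have hσi : ∀ x ∈ W, ∀ y, qmap N K x = qmap N K y → σ x = σ y := by
    intro x hx y hxy
    have hy := hsat x y hxy hx
    obtain ⟨μ, hμ, e⟩ := qmap_eq_iff.1 hxy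
    apply Subtype.ext
    rw [act_val (h2 _ hx).1, act_val (h2 _ hy).1]
    funext k
    rw [← h3 x.1 hx μ hμ k, ← e]
    ring
  let s : XS N K → ↥(UK K) := fun v => σ (Quot.out v)
  have hout : ∀ v, qmap N K (Quot.out v) = v := fun v => Quot.out_eq v
  have hs : ∀ x ∈ W, s (qmap N K x) = σ x := fun x hx => (hσi x hx _ (hout _).symm).symm
  refine ⟨qmap N K '' W, s, hVo, ⟨u, hu, rfl⟩, ?_, ?_⟩
  · rw [hq.continuousOn_isOpen_iff hVo, hpre]
    exact hσc.congr hs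
  · rintro _ ⟨x, hx, rfl⟩
    rw [hs x hx]
    exact qmap_act (h2 _ hx) x

lemma ratio (h : HNu N K) {Y : Type*} [TopologicalSpace Y] {T : Set Y} {L L' : Y → ↥(UK K)}
    (hL : ContinuousOn L T) (hL' : ContinuousOn L' T) (he : ∀ p ∈ T, qmap N K (L p) = qmap N K (L' p)) :
    ∃ μ : Y → Fin r → ℂ, ContinuousOn μ T ∧ ∀ p ∈ T, μ p ∈ GSet N ∧ L' p = act (μ p) (L p) := by
  have hex : ∀ p, ∃ μ : Fin r → ℂ, p ∈ T → μ ∈ GSet N ∧ L' p = act μ (L p) := by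
    intro p
    by_cases hp : p ∈ T
    · obtain ⟨μ, hμ, e⟩ := qmap_eq_iff.1 (he p hp)
      refine ⟨μ, fun _ => ⟨hμ, Subtype.ext ?_⟩⟩
      rw [act_val hμ.1, ← e]
    · exact ⟨0, fun h => absurd h hp⟩
  choose μ hμ using hex
  refine ⟨μ, ?_, hμ⟩
  intro p hp
  obtain ⟨Z, hZ, hu⟩ := exists_Z (L p)
  obtain ⟨ν, h1, h2, h3⟩ := h Z hZ
  have hLv : ContinuousOn (fun q => (L q).1) T := continuous_subtype_val.comp_continuousOn hL
  have hLv' : ContinuousOn (fun q => (L' q).1) T := continuous_subtype_val.comp_continuousOn hL'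
  have key : ∀ q ∈ T, (L q).1 ∈ UZ Z → (L' q).1 ∈ UZ Z ∧ μ q = fun k => ν (L q).1 k / ν (L' q).1 k := by
    intro q hq hqZ
    obtain ⟨hG, e⟩ := hμ q hq
    have e' : (L' q).1 = fun k => μ q k * (L q).1 k := by rw [e, act_val hG.1]
    have hZ' : (L' q).1 ∈ UZ Z := by rw [e', UZ_act hG.1]; exact hqZ
    refine ⟨hZ', ?_⟩
    funext k
    rw [← h3 _ hqZ _ hG k, ← e', mul_comm, mul_div_cancel_right₀ _ ((h2 _ hZ').1 k)]
  have hev : ∀ᶠ q in nhdsWithin p T, (L q).1 ∈ UZ Z := (hLv p hp).eventually ((isOpen_UZ Z).mem_nhds hu)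
  have hev2 : ∀ᶠ q in nhdsWithin p T, μ q = fun k => ν (L q).1 k / ν (L' q).1 k := by
    filter_upwards [hev, self_mem_nhdsWithin] with q h1 h2
    exact (key q h2 h1).2
  refine ContinuousWithinAt.congr_of_eventuallyEq ?_ hev2 (key p hp hu).2
  have hu' := (key p hp hu).1
  have c1 : ContinuousWithinAt (fun q => ν (L q).1) T p :=
    (h1.continuousAt ((isOpen_UZ Z).mem_nhds hu)).comp_continuousWithinAt (f := fun q => (L q).1) (hLv p hp)
  have c2 : ContinuousWithinAt (fun q => ν (L' q).1) T p :=
    (h1.continuousAt ((isOpen_UZ Z).mem_nhds hu')).comp_continuousWithinAt (f := fun q => (L' q).1) (hLv' p hp)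
  rw [continuousWithinAt_pi] at c1 c2 ⊢
  intro k
  exact (c1 k).div (c2 k) ((h2 _ hu').1 k)

/-! lifting over boxes -/

def HasLift {m : ℕ} (γ : (Fin m → ℝ) → XS N K) (T : Set (Fin m → ℝ)) : Prop :=
  ∃ L : (Fin m → ℝ) → ↥(UK K), ContinuousOn L T ∧ ∀ p ∈ T, qmap N K (L p) = γ p

lemma HasLift.mono {m : ℕ} {γ : (Fin m → ℝ) → XS N K} {T T' : Set (Fin m → ℝ)} (h : HasLift γ T) (hT : T' ⊆ T) :
    HasLift γ T' := by
  obtain ⟨L, h1, h2⟩ := h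
  exact ⟨L, h1.mono hT, fun p hp => h2 p (hT hp)⟩

lemma HasLift.glue (h : HNu N K) {m : ℕ} {γ : (Fin m → ℝ) → XS N K} {l u : Fin m → ℝ} {i : Fin m} {c : ℝ}
    (hlc : l i ≤ c) (hcu : c ≤ u i)
    (h₁ : HasLift γ (Set.Icc l (Function.update u i c))) (h₂ : HasLift γ (Set.Icc (Function.update l i c) u)) :
    HasLift γ (Set.Icc l u) := by
  obtain ⟨L, hL, hL'⟩ := h₁
  obtain ⟨R, hR, hR'⟩ := h₂
  have m1 : ∀ x ∈ Set.Icc l u, x i ≤ c → x ∈ Set.Icc l (Function.update u i c) := by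
    intro x hx hxc
    refine ⟨hx.1, fun j => ?_⟩
    by_cases hj : j = i
    · subst hj; simpa using hxc
    · simpa [hj] using hx.2 j
  have m2 : ∀ x ∈ Set.Icc l u, c ≤ x i → x ∈ Set.Icc (Function.update l i c) u := by
    intro x hx hxc
    refine ⟨fun j => ?_, hx.2⟩
    by_cases hj : j = i
    · subst hj; simpa using hxc
    · simpa [hj] using hx.1 j
  set W : Set (Fin m → ℝ) := {x | x ∈ Set.Icc l u ∧ x i = c} with hW
  obtain ⟨μ, hμc, hμ⟩ := ratio h (T := W) (L := R) (L' := L)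
    (hR.mono fun x hx => m2 x hx.1 hx.2.ge) (hL.mono fun x hx => m1 x hx.1 hx.2.le)
    (fun x hx => by rw [hR' x (m2 x hx.1 hx.2.ge), hL' x (m1 x hx.1 hx.2.le)])
  have hpr : ∀ x ∈ Set.Icc l u, Function.update x i c ∈ W := by
    intro x hx
    refine ⟨⟨fun j => ?_, fun j => ?_⟩, by simp⟩
    · by_cases hj : j = i
      · subst hj; simpa using hlc
      · simpa [hj] using hx.1 j
    · by_cases hj : j = i
      · subst hj; simpa using hcu
      · simpa [hj] using hx.2 j
  have hprc : Continuous fun x : Fin m → ℝ => Function.update x i c := by fun_prop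
  refine ⟨fun x => if x i ≤ c then L x else act (μ (Function.update x i c)) (R x), ?_, ?_⟩
  · refine glue_contOn (s₁ := {x | x i ≤ c}) (s₂ := {x | c ≤ x i}) (f₁ := L)
      (f₂ := fun x => act (μ (Function.update x i c)) (R x))
      (isClosed_le (continuous_apply i) continuous_const) (isClosed_le continuous_const (continuous_apply i))
      (fun x _ => (le_total (x i) c).elim (fun h => Or.inl h) (fun h => Or.inr h)) ?_ ?_ ?_ ?_
    · exact hL.mono fun x hx => m1 x hx.1 hx.2
    · refine act_contOn (μ := fun x => μ (Function.update x i c)) ?_ (hR.mono fun x hx => m2 x hx.1 hx.2)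
        (fun x hx => ((hμ _ (hpr x hx.1)).1).1)
      exact hμc.comp hprc.continuousOn (fun x hx => hpr x hx.1)
    · intro x hx; exact if_pos hx.2
    · intro x hx
      by_cases hxc : x i ≤ c
      · have hxe : x i = c := le_antisymm hxc hx.2
        have : Function.update x i c = x := by rw [← hxe]; simp
        rw [if_pos hxc, this]
        exact (hμ x ⟨hx.1, hxe⟩).2
      · rw [if_neg hxc]
  · intro x hx
    by_cases hxc : x i ≤ c
    · simp only [if_pos hxc]; exact hL' x (m1 x hx hxc)
    · simp only [if_neg hxc]
      rw [qmap_act (hμ _ (hpr x hx)).1]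
      exact hR' x (m2 x hx (le_of_not_ge hxc))

lemma HasLift.boxes (h : HNu N K) {m : ℕ} {γ : (Fin m → ℝ) → XS N K} {Q : Set (Fin m → ℝ)} {δ : ℝ} (hδ : 0 < δ)
    (h0 : ∀ l u, l ≤ u → Set.Icc l u ⊆ Q → (∀ i, u i - l i ≤ δ) → HasLift γ (Set.Icc l u)) (S : Finset (Fin m)) :
    ∀ l u, l ≤ u → Set.Icc l u ⊆ Q → (∀ i ∉ S, u i - l i ≤ δ) → HasLift γ (Set.Icc l u) := by
  induction S using Finset.induction_on with
  | empty => intro l u hlu hQ hs; exact h0 l u hlu hQ fun i => hs i (by simp)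
  | insert i S hi ih =>
    have key : ∀ (k : ℕ) (l u : Fin m → ℝ), l ≤ u → Set.Icc l u ⊆ Q → (∀ j ∉ insert i S, u j - l j ≤ δ) →
        u i - l i ≤ k * δ → HasLift γ (Set.Icc l u) := by
      intro k
      induction k with
      | zero =>
        intro l u hlu hQ hs hk
        refine ih l u hlu hQ fun j hj => ?_
        by_cases hji : j = i
        · subst hji; simp at hk; linarith
        · exact hs j (by simp [hj, hji])
      | succ k ihk =>
        intro l u hlu hQ hs hk
        by_cases hsm : u i - l i ≤ δ
        · refine ih l u hlu hQ fun j hj => ?_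
          by_cases hji : j = i
          · subst hji; exact hsm
          · exact hs j (by simp [hj, hji])
        · push Not at hsm
          have hcu : l i + δ ≤ u i := by linarith
          refine HasLift.glue h (i := i) (c := l i + δ) (by linarith) hcu ?_ ?_
          · have e : Function.update u i (l i + δ) ≤ u := by
              intro j
              by_cases hji : j = i
              · subst hji; simpa using hcu
              · simp [hji]
            refine ih _ _ ?_ (le_trans (Set.Icc_subset_Icc_right e) hQ) fun j hj => ?_
            · intro j
              by_cases hji : j = i
              · subst hji; simp; linarith
              · simpa [hji] using hlu j
            · by_cases hji : j = i
              · subst hji; simp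
              · simpa [hji] using hs j (by simp [hj, hji])
          · have e : l ≤ Function.update l i (l i + δ) := by
              intro j
              by_cases hji : j = i
              · subst hji; simp; linarith
              · simp [hji]
            refine ihk _ _ ?_ (le_trans (Set.Icc_subset_Icc_left e) hQ) (fun j hj => ?_) ?_
            · intro j
              by_cases hji : j = i
              · subst hji; simpa using hcu
              · simpa [hji] using hlu j
            · have hji : j ≠ i := fun h => hj (by simp [h])
              simpa [hji] using hs j hj
            · push_cast at hk
              simp; linarith
    intro l u hlu hQ hs
    obtain ⟨k, hk⟩ := exists_nat_ge ((u i - l i) / δ)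
    exact key k l u hlu hQ hs ((div_le_iff₀ hδ).1 hk)

theorem lift_ball (h : HNu N K) {m : ℕ} {γ : (Fin m → ℝ) → XS N K} (hγ : ContinuousOn γ (Bl (Fin m → ℝ))) :
    HasLift γ (Bl (Fin m → ℝ)) := by
  choose V s hVo hpV hsc hs using local_section h
  have hex : ∀ x : ↥(Bl (Fin m → ℝ)), ∃ ε > 0, ∀ y ∈ Bl (Fin m → ℝ), y ∈ Metric.ball x.1 ε → γ y ∈ V (γ x.1) := by
    intro x
    have := (hγ x.1 x.2).eventually ((hVo (γ x.1)).mem_nhds (hpV _))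
    obtain ⟨ε, hε, hb⟩ := Metric.mem_nhdsWithin_iff.1 this
    exact ⟨ε, hε, fun y hy hyb => hb ⟨hyb, hy⟩⟩
  choose ε hε hb using hex
  obtain ⟨δ, hδ, hL⟩ := lebesgue_number_lemma_of_metric (s := Bl (Fin m → ℝ)) (c := fun x => Metric.ball x.1 (ε x))
    (isCompact_closedBall _ _) (fun x => Metric.isOpen_ball)
    (fun x hx => Set.mem_iUnion.2 ⟨⟨x, hx⟩, Metric.mem_ball_self (hε _)⟩)
  have hBl : Bl (Fin m → ℝ) = Set.Icc (fun _ => -1) (fun _ => 1) := by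
    ext x
    rw [mem_Bl, pi_norm_le_iff_of_nonneg zero_le_one, Set.mem_Icc, Pi.le_def, Pi.le_def, ← forall_and]
    simp only [Real.norm_eq_abs, abs_le]
  rw [hBl]
  refine HasLift.boxes h (Q := Bl (Fin m → ℝ)) (half_pos hδ) ?_ Finset.univ _ _ ?_ hBl.ge (by simp)
  · intro l u hlu hQ hsz
    obtain ⟨x, hx⟩ := hL l (hQ ⟨le_rfl, hlu⟩)
    have hin : ∀ y ∈ Set.Icc l u, γ y ∈ V (γ x.1) := by
      intro y hy
      refine hb x y (hQ hy) (hx ?_)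
      rw [Metric.mem_ball]
      refine lt_of_le_of_lt ?_ (half_lt_self hδ)
      rw [dist_pi_le_iff (half_pos hδ).le]
      intro i
      rw [Real.dist_eq, abs_of_nonneg (by linarith [hy.1 i])]
      linarith [hy.2 i, hsz i]
    exact ⟨fun y => s (γ x.1) (γ y), (hsc _).comp (hγ.mono hQ) hin, fun y hy => hs _ _ (hin y hy)⟩
  · intro i; norm_num

end Part12

section Part13
variable {n r : ℕ} {N : Fin r → Fin n → ℤ} {K : Set (Finset (Fin r))}

lemma const_of_exp_one {Y : Type*} [TopologicalSpace Y] {T : Set Y} (hT : IsPreconnected T) {δ : Y → ℂ}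
    (hδ : ContinuousOn δ T) (h1 : ∀ y ∈ T, Complex.exp (δ y) = 1) : ∀ x ∈ T, ∀ y ∈ T, δ x = δ y := by
  have hex : ∀ y, ∃ m : ℤ, y ∈ T → δ y = m * (2 * Real.pi * Complex.I) := by
    intro y
    by_cases hy : y ∈ T
    · obtain ⟨m, hm⟩ := Complex.exp_eq_one_iff.1 (h1 y hy)
      exact ⟨m, fun _ => hm⟩
    · exact ⟨0, fun h => absurd h hy⟩
  choose m hm using hex
  have hne : (2 * Real.pi * Complex.I : ℂ) ≠ 0 := Complex.two_pi_I_ne_zero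
  have hmc : ContinuousOn m T := by
    rw [Int.isClosedEmbedding_coe_real.isInducing.continuousOn_iff]
    have : ContinuousOn (fun y => (δ y / (2 * Real.pi * Complex.I)).re) T :=
      Complex.continuous_re.comp_continuousOn (hδ.div_const _)
    refine this.congr fun y hy => ?_
    dsimp only [Function.comp]
    rw [hm y hy, mul_div_cancel_right₀ _ hne]
    simp
  intro x hx y hy
  rw [hm x hx, hm y hy, hT.constant hmc hx hy]

lemma log_space {E : Type*} [NormedAddCommGroup E] [NormedSpace ℝ E] {g : E → ℂ} (hg : Continuous g)
    (h0 : ∀ x, g x ≠ 0) : ∃ l : E → ℂ, Continuous l ∧ ∀ x, Complex.exp (l x) = g x := by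
  have hs : IsSimplyConnected (Set.univ : Set E) := by
    have : ContractibleSpace (Set.univ : Set E) := (Homeomorph.Set.univ E).contractibleSpace
    show SimplyConnectedSpace _
    infer_instance
  obtain ⟨f, h1, h2⟩ := Complex.exists_continuousOn_eqOn_exp_comp hs isOpen_univ hg.continuousOn
    (by rintro ⟨x, -, hx⟩; exact h0 x hx)
  exact ⟨f, continuousOn_univ.1 h1, fun x => h2 (Set.mem_univ x)⟩

def ret {E : Type*} [NormedAddCommGroup E] [NormedSpace ℝ E] (x : E) : E := (max 1 ‖x‖)⁻¹ • x

lemma ret_cont {E : Type*} [NormedAddCommGroup E] [NormedSpace ℝ E] : Continuous (ret : E → E) := by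
  unfold ret
  refine Continuous.smul (Continuous.inv₀ (by fun_prop) fun x => ?_) continuous_id
  exact (lt_of_lt_of_le one_pos (le_max_left _ _)).ne'

lemma ret_mem {E : Type*} [NormedAddCommGroup E] [NormedSpace ℝ E] (x : E) : ret x ∈ Bl E := by
  have h : 0 < max 1 ‖x‖ := lt_of_lt_of_le one_pos (le_max_left _ _)
  rw [mem_Bl, ret, norm_smul, norm_inv, Real.norm_eq_abs, abs_of_pos h, inv_mul_le_iff₀ h, mul_one]
  exact le_max_right _ _

lemma ret_eq {E : Type*} [NormedAddCommGroup E] [NormedSpace ℝ E] {x : E} (hx : x ∈ Bl E) : ret x = x := by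
  rw [ret, max_eq_left (mem_Bl.1 hx), inv_one, one_smul]

/-- chart of a hemisphere -/
def psiv {q : ℕ} (s : ℝ) (y : Fin q → ℝ) : Fin (q+1) → ℝ := Fin.cons (s * (1 - ‖y‖)) y

lemma psiv_cont {q : ℕ} (s : ℝ) : Continuous (psiv s : (Fin q → ℝ) → _) := by
  unfold psiv
  refine continuous_pi fun i => ?_
  refine Fin.cases ?_ (fun i => ?_) i
  · simp only [Fin.cons_zero]; fun_prop
  · simp only [Fin.cons_succ]; fun_prop

lemma psiv_ne {q : ℕ} {s : ℝ} (hs : s ≠ 0) (y : Fin q → ℝ) : psiv s y ≠ 0 := by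
  intro h
  have h0 : s * (1 - ‖y‖) = 0 := by simpa [psiv] using congrFun h 0
  have h1 : y = 0 := by
    funext i
    simpa [psiv] using congrFun h i.succ
  subst h1
  simp [hs] at h0

def chart {q : ℕ} (x : Fin (q+1) → ℝ) : Fin q → ℝ := (|x 0| + ‖Fin.tail x‖)⁻¹ • Fin.tail x

lemma tail_cont {q : ℕ} : Continuous (Fin.tail : (Fin (q+1) → ℝ) → (Fin q → ℝ)) :=
  continuous_pi fun i => continuous_apply i.succ

lemma den_pos {q : ℕ} {x : Fin (q+1) → ℝ} (hx : x ∈ Sp (Fin (q+1) → ℝ)) : 0 < |x 0| + ‖Fin.tail x‖ := by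
  by_contra hc
  have h1 : |x 0| = 0 := le_antisymm (by linarith [norm_nonneg (Fin.tail x), abs_nonneg (x 0)]) (abs_nonneg _)
  have h2 : ‖Fin.tail x‖ = 0 := le_antisymm (by linarith [norm_nonneg (Fin.tail x), abs_nonneg (x 0)]) (norm_nonneg _)
  have : x = 0 := by
    funext i
    refine Fin.cases (abs_eq_zero.1 h1) (fun i => ?_) i
    exact congrFun (norm_eq_zero.1 h2) i
  rw [mem_Sp, this] at hx
  simp at hx

lemma chart_contOn {q : ℕ} : ContinuousOn (chart : (Fin (q+1) → ℝ) → (Fin q → ℝ)) (Sp _) := by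
  unfold chart
  have := @tail_cont q
  refine ContinuousOn.smul (ContinuousOn.inv₀ (by fun_prop) fun x hx => (den_pos hx).ne') this.continuousOn

lemma chart_spec {q : ℕ} {s : ℝ} {x : Fin (q+1) → ℝ} (hx : x ∈ Sp (Fin (q+1) → ℝ)) (hs : s * |x 0| = x 0) :
    ‖psiv s (chart x)‖⁻¹ • psiv s (chart x) = x := by
  have hc := den_pos hx
  have h1 : psiv s (chart x) = (|x 0| + ‖Fin.tail x‖)⁻¹ • x := by
    funext i
    refine Fin.cases ?_ (fun i => ?_) i
    · simp only [psiv, chart, Fin.cons_zero, norm_smul, norm_inv, Real.norm_eq_abs, abs_of_pos hc, Pi.smul_apply, smul_eq_mul]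
      field_simp
      linarith
    · simp [psiv, chart, Fin.tail]
  rw [h1, norm_smul, mem_Sp.1 hx, smul_smul, norm_inv, Real.norm_eq_abs, abs_of_pos hc, mul_one, inv_inv,
    mul_inv_cancel₀ hc.ne', one_smul]

lemma log_hemi {q : ℕ} {f : (Fin (q+1) → ℝ) → ℂ} (hf : ContinuousOn f (Sp _)) (h0 : ∀ x ∈ Sp (Fin (q+1) → ℝ), f x ≠ 0)
    {s : ℝ} (hs : s ≠ 0) : ∃ l : (Fin (q+1) → ℝ) → ℂ, ContinuousOn l (Sp _) ∧
      ∀ x ∈ Sp (Fin (q+1) → ℝ), s * |x 0| = x 0 → Complex.exp (l x) = f x := by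
  have hm : ∀ y : Fin q → ℝ, ‖psiv s y‖⁻¹ • psiv s y ∈ Sp (Fin (q+1) → ℝ) := by
    intro y
    have := norm_pos_iff.2 (psiv_ne hs y)
    rw [mem_Sp, norm_smul, norm_inv, norm_norm, inv_mul_cancel₀ this.ne']
  have hgc : Continuous fun y : Fin q → ℝ => f (‖psiv s y‖⁻¹ • psiv s y) := by
    refine hf.comp_continuous (f := fun y : Fin q → ℝ => ‖psiv s y‖⁻¹ • psiv s y) ?_ hm
    exact ((psiv_cont s).norm.inv₀ fun y => (norm_pos_iff.2 (psiv_ne hs y)).ne').smul (psiv_cont s)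
  obtain ⟨l, h1, h2⟩ := log_space hgc (fun y => h0 _ (hm y))
  refine ⟨fun x => l (chart x), h1.comp_continuousOn chart_contOn, fun x hx hxs => ?_⟩
  rw [h2, chart_spec hx hxs]

lemma sp_preconn {q : ℕ} (hq : 2 ≤ q) : IsPreconnected (Sp (Fin q → ℝ)) := by
  refine isPreconnected_sphere ?_ _ _
  rw [rank_fun']
  simp
  omega

theorem log_sphere {q : ℕ} (hq : 2 ≤ q) {f : (Fin (q+1) → ℝ) → ℂ} (hf : ContinuousOn f (Sp _))
    (h0 : ∀ x ∈ Sp (Fin (q+1) → ℝ), f x ≠ 0) :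
    ∃ l : (Fin (q+1) → ℝ) → ℂ, ContinuousOn l (Sp _) ∧ ∀ x ∈ Sp (Fin (q+1) → ℝ), Complex.exp (l x) = f x := by
  obtain ⟨l, l1, l2⟩ := log_hemi hf h0 (s := 1) one_ne_zero
  obtain ⟨l', l1', l2'⟩ := log_hemi hf h0 (s := -1) (by norm_num)
  have hcm : ∀ y ∈ Sp (Fin q → ℝ), (Fin.cons 0 y : Fin (q+1) → ℝ) ∈ Sp (Fin (q+1) → ℝ) := by
    intro y hy
    rw [mem_Sp] at hy ⊢
    apply le_antisymm
    · refine (pi_norm_le_iff_of_nonneg zero_le_one).2 fun i => ?_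
      refine Fin.cases ?_ (fun i => ?_) i
      · simp
      · simpa [hy] using norm_le_pi_norm y i
    · rw [← hy]
      refine (pi_norm_le_iff_of_nonneg (norm_nonneg _)).2 fun i => ?_
      simpa using norm_le_pi_norm (Fin.cons 0 y : Fin (q+1) → ℝ) i.succ
  have hcc : Continuous fun y : Fin q → ℝ => (Fin.cons 0 y : Fin (q+1) → ℝ) := by
    refine continuous_pi fun i => ?_
    refine Fin.cases ?_ (fun i => ?_) i
    · simp only [Fin.cons_zero]; fun_prop
    · simp only [Fin.cons_succ]; fun_prop
  have hconst := const_of_exp_one (sp_preconn hq) (δ := fun y => l (Fin.cons 0 y) - l' (Fin.cons 0 y))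
    ((l1.comp hcc.continuousOn hcm).sub (l1'.comp hcc.continuousOn hcm)) (fun y hy => by
      rw [Complex.exp_sub, l2 _ (hcm y hy) (by simp), l2' _ (hcm y hy) (by simp), div_self (h0 _ (hcm y hy))])
  set y₀ : Fin q → ℝ := fun _ => 1
  have hy₀ : y₀ ∈ Sp (Fin q → ℝ) := by
    have : Nonempty (Fin q) := ⟨⟨0, by omega⟩⟩
    rw [mem_Sp]
    simp [y₀]
  set c := l (Fin.cons 0 y₀) - l' (Fin.cons 0 y₀) with hc
  have hexpc : Complex.exp c = 1 := by
    rw [hc, Complex.exp_sub, l2 _ (hcm _ hy₀) (by simp), l2' _ (hcm _ hy₀) (by simp), div_self (h0 _ (hcm _ hy₀))]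
  refine ⟨fun x => if 0 ≤ x 0 then l x else l' x + c, ?_, ?_⟩
  · refine glue_contOn (s₁ := {x | 0 ≤ x 0}) (s₂ := {x | x 0 ≤ 0}) (f₁ := l) (f₂ := fun x => l' x + c)
      (isClosed_le continuous_const (continuous_apply 0)) (isClosed_le (continuous_apply 0) continuous_const)
      (fun x _ => (le_total 0 (x 0)).elim (fun h => Or.inl h) (fun h => Or.inr h)) ?_ ?_ ?_ ?_
    · exact l1.mono Set.inter_subset_left
    · exact (l1'.mono Set.inter_subset_left).add continuousOn_const
    · intro x hx; exact if_pos hx.2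
    · intro x hx
      by_cases h : 0 ≤ x 0
      · have hx0 : x 0 = 0 := le_antisymm hx.2 h
        have hxe : x = Fin.cons 0 (Fin.tail x) := by
          rw [← hx0]; exact (Fin.cons_self_tail x).symm
        have htm : Fin.tail x ∈ Sp (Fin q → ℝ) := by
          rw [mem_Sp, ← mem_Sp.1 hx.1]
          apply le_antisymm
          · refine (pi_norm_le_iff_of_nonneg (norm_nonneg _)).2 fun i => norm_le_pi_norm x i.succ
          · refine (pi_norm_le_iff_of_nonneg (norm_nonneg _)).2 fun i => ?_
            refine Fin.cases ?_ (fun i => ?_) i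
            · rw [hx0]; simp
            · exact norm_le_pi_norm (Fin.tail x) i
        have := hconst _ htm _ hy₀
        simp only [← hxe] at this
        rw [if_pos h, hc, ← this]
        ring
      · rw [if_neg h]
  · intro x hx
    dsimp only
    split_ifs with h
    · exact l2 x hx (by rw [abs_of_nonneg h, one_mul])
    · rw [Complex.exp_add, hexpc, mul_one]
      exact l2' x hx (by rw [abs_of_neg (not_le.1 h)]; ring)

/-- extension of `G`-valued maps from the sphere to the ball -/
theorem G_extend {q : ℕ} (hq : 2 ≤ q) {μ : (Fin (q+1) → ℝ) → Fin r → ℂ} (hμ : ContinuousOn μ (Sp _))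
    (hG : ∀ x ∈ Sp (Fin (q+1) → ℝ), μ x ∈ GSet N) :
    ∃ μ' : (Fin (q+1) → ℝ) → Fin r → ℂ, ContinuousOn μ' (Bl _) ∧ (∀ x ∈ Bl (Fin (q+1) → ℝ), μ' x ∈ GSet N) ∧
      ∀ x ∈ Sp (Fin (q+1) → ℝ), μ' x = μ x := by
  have hex : ∀ k, ∃ l : (Fin (q+1) → ℝ) → ℂ, ContinuousOn l (Sp _) ∧ ∀ x ∈ Sp (Fin (q+1) → ℝ), Complex.exp (l x) = μ x k :=
    fun k => log_sphere hq (continuousOn_pi.1 hμ k) (fun x hx => (hG x hx).1 k)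
  choose l l1 l2 using hex
  set x₀ : Fin (q+1) → ℝ := fun _ => 1
  have hx₀ : x₀ ∈ Sp (Fin (q+1) → ℝ) := by
    rw [mem_Sp]
    simp [x₀]
  set lam : (Fin (q+1) → ℝ) → ℝ := fun x => max 0 (2 * ‖x‖ - 1) with hlam
  set L : Fin r → (Fin (q+1) → ℝ) → ℂ := fun k x => (lam x : ℂ) * l k (kap x) + (1 - lam x : ℂ) * l k x₀ with hL
  have hlc : Continuous fun x => (lam x : ℂ) := Complex.continuous_ofReal.comp (by fun_prop)
  have hLc : ∀ k, ContinuousOn (L k) (Bl _) := by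
    intro k
    refine glue_contOn (s₁ := {x | 1/2 ≤ ‖x‖}) (s₂ := {x | ‖x‖ ≤ 1/2}) (f₁ := L k) (f₂ := fun _ => l k x₀)
      (isClosed_le continuous_const continuous_norm) (isClosed_le continuous_norm continuous_const)
      (fun x _ => (le_total (1/2) ‖x‖).elim (fun h => Or.inl h) (fun h => Or.inr h)) ?_ continuousOn_const ?_ ?_
    · refine ContinuousOn.add (ContinuousOn.mul hlc.continuousOn ?_) ?_
      · exact (l1 k).comp kap_cont.continuousOn (fun x hx => kap_sp hx.2)
      · exact ((continuous_const.sub hlc).mul continuous_const).continuousOn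
    · intro x _; rfl
    · intro x hx
      have : lam x = 0 := max_eq_left (by have := hx.2; simp only [Set.mem_ofPred_eq] at this; linarith)
      simp [hL, this]
  refine ⟨fun x k => Complex.exp (L k x), continuousOn_pi.2 fun k => Complex.continuous_exp.comp_continuousOn (hLc k),
    fun x hx => ⟨fun k => Complex.exp_ne_zero _, fun m => ?_⟩, fun x hx => ?_⟩
  · have hexp1 : ∀ y ∈ Sp (Fin (q+1) → ℝ), Complex.exp (∑ k, ((∑ j, N k j * m j : ℤ) : ℂ) * l k y) = 1 := by
      intro y hy
      rw [Complex.exp_sum, ← (hG y hy).2 m]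
      refine Finset.prod_congr rfl fun k _ => ?_
      rw [Complex.exp_int_mul, l2 k y hy]
    have hconst := const_of_exp_one (sp_preconn (by omega : 2 ≤ q + 1))
      (δ := fun y => ∑ k, ((∑ j, N k j * m j : ℤ) : ℂ) * l k y)
      (continuousOn_finsetSum _ fun k _ => continuousOn_const.mul (l1 k)) hexp1
    have hsum : ∑ k, ((∑ j, N k j * m j : ℤ) : ℂ) * L k x = ∑ k, ((∑ j, N k j * m j : ℤ) : ℂ) * l k x₀ := by
      have e1 : ∑ k, ((∑ j, N k j * m j : ℤ) : ℂ) * L k x = (lam x : ℂ) * (∑ k, ((∑ j, N k j * m j : ℤ) : ℂ) * l k (kap x))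
          + (1 - lam x : ℂ) * ∑ k, ((∑ j, N k j * m j : ℤ) : ℂ) * l k x₀ := by
        rw [Finset.mul_sum, Finset.mul_sum, ← Finset.sum_add_distrib]
        refine Finset.sum_congr rfl fun k _ => ?_
        simp only [hL]
        ring
      rw [e1]
      by_cases h : 1/2 ≤ ‖x‖
      · rw [hconst _ (kap_sp h) _ hx₀]; ring
      · have : lam x = 0 := max_eq_left (by linarith)
        simp [this]
    rw [← hexp1 x₀ hx₀, ← hsum, Complex.exp_sum]
    refine Finset.prod_congr rfl fun k _ => ?_
    rw [Complex.exp_int_mul]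
  · funext k
    have : lam x = 1 := by
      simp only [hlam]; rw [mem_Sp.1 hx]; norm_num
    simp only [hL, this, kap_eq hx]
    simp [l2 k x hx]

theorem lift_rel (h : HNu N K) {q : ℕ} (hq : 2 ≤ q) {γ : (Fin (q+1) → ℝ) → XS N K} (hγ : ContinuousOn γ (Bl _))
    {b : (Fin (q+1) → ℝ) → ↥(UK K)} (hb : ContinuousOn b (Sp _))
    (hqb : ∀ x ∈ Sp (Fin (q+1) → ℝ), qmap N K (b x) = γ x) :
    ∃ L : (Fin (q+1) → ℝ) → ↥(UK K), ContinuousOn L (Bl _) ∧ (∀ x ∈ Bl (Fin (q+1) → ℝ), qmap N K (L x) = γ x) ∧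
      ∀ x ∈ Sp (Fin (q+1) → ℝ), L x = b x := by
  obtain ⟨L₀, h1, h2⟩ := lift_ball h hγ
  obtain ⟨μ, m1, m2⟩ := ratio h (T := Sp _) (h1.mono Sp_sub_Bl) hb
    (fun p hp => by rw [h2 p (Sp_sub_Bl hp), hqb p hp])
  obtain ⟨μ', n1, n2, n3⟩ := G_extend hq m1 (fun x hx => (m2 x hx).1)
  refine ⟨fun x => act (μ' x) (L₀ x), act_contOn n1 h1 (fun p hp => (n2 p hp).1), fun x hx => ?_, fun x hx => ?_⟩
  · rw [qmap_act (n2 x hx), h2 x hx]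
  · dsimp only
    rw [n3 x hx, (m2 x hx).2]

end Part13

section Part14
variable {n r : ℕ} {N : Fin r → Fin n → ℤ} {K : Set (Finset (Fin r))}

def par (t : ℝ) : OnePoint ℝ := if |t| < 1 then ((t / (1 - |t|) : ℝ) : OnePoint ℝ) else OnePoint.infty

def parinv (s : OnePoint ℝ) : ℝ := OnePoint.elim s 1 (fun y : ℝ => y / (1 + |y|))

lemma parinv_infty : parinv OnePoint.infty = 1 := rfl
lemma parinv_coe (y : ℝ) : parinv (y : OnePoint ℝ) = y / (1 + |y|) := rfl

lemma par_of_one_le {t : ℝ} (h : 1 ≤ |t|) : par t = OnePoint.infty := if_neg (not_lt.2 h)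

lemma abs_parinv_coe (y : ℝ) : |parinv (y : OnePoint ℝ)| < 1 := by
  have h := abs_nonneg y
  rw [parinv_coe, abs_div, abs_of_pos (by linarith : 0 < 1 + |y|), div_lt_one (by linarith)]
  linarith

lemma par_parinv (s : OnePoint ℝ) : par (parinv s) = s := by
  induction s using OnePoint.rec with
  | infty => exact par_of_one_le (by rw [parinv_infty]; simp)
  | coe y =>
    have h := abs_nonneg y
    rw [par, if_pos (abs_parinv_coe y), parinv_coe, abs_div, abs_of_pos (by linarith : 0 < 1 + |y|)]
    congr 1
    have : 1 + |y| ≠ 0 := by linarith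
    field_simp
    ring

lemma parinv_par {t : ℝ} (h : |t| < 1) : parinv (par t) = t := by
  rw [par, if_pos h, parinv_coe, abs_div, abs_of_pos (by linarith : 0 < 1 - |t|)]
  have : 1 - |t| ≠ 0 := by linarith
  field_simp
  ring

lemma abs_parinv_le (s : OnePoint ℝ) : |parinv s| ≤ 1 := by
  induction s using OnePoint.rec with
  | infty => rw [parinv_infty]; simp
  | coe y => exact (abs_parinv_coe y).le

lemma par_cont : Continuous par := by
  rw [continuous_iff_continuousAt]
  intro t₀
  by_cases h : |t₀| < 1
  · have hev : ∀ᶠ t in nhds t₀, par t = ((t / (1 - |t|) : ℝ) : OnePoint ℝ) := by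
      filter_upwards [(isOpen_lt continuous_abs continuous_const).mem_nhds h] with t ht
      exact if_pos ht
    refine ContinuousAt.congr_of_eventuallyEq ?_ hev
    refine OnePoint.continuous_coe.continuousAt.comp (f := fun t : ℝ => t / (1 - |t|)) ?_
    exact continuousAt_id.div (by fun_prop) (by linarith)
  · push Not at h
    show Filter.Tendsto par (nhds t₀) (nhds (par t₀))
    rw [par_of_one_le h, OnePoint.hasBasis_nhds_infty.tendsto_right_iff]
    rintro s ⟨-, hs⟩
    obtain ⟨M, hM⟩ := hs.isBounded.exists_norm_le
    have ho : IsOpen {t : ℝ | (max M 0) * (1 - |t|) < |t|} := isOpen_lt (by fun_prop) (by fun_prop)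
    have hm : t₀ ∈ {t : ℝ | (max M 0) * (1 - |t|) < |t|} := by
      have : (max M 0) * (1 - |t₀|) ≤ 0 := mul_nonpos_of_nonneg_of_nonpos (le_max_right _ _) (by linarith)
      simp only [Set.mem_ofPred_eq]
      linarith
    filter_upwards [ho.mem_nhds hm] with t ht
    by_cases h1 : |t| < 1
    · left
      rw [par, if_pos h1]
      refine ⟨_, fun hts => ?_, rfl⟩
      have h2 := hM _ hts
      have h3 : 0 < 1 - |t| := by linarith
      rw [Real.norm_eq_abs, abs_div, abs_of_pos h3, div_le_iff₀ h3] at h2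
      have := mul_le_mul_of_nonneg_right (le_max_left M 0) h3.le
      have ht' : (max M 0) * (1 - |t|) < |t| := ht
      linarith
    · right
      exact par_of_one_le (not_lt.1 h1)

lemma norm_cons' {q : ℕ} (t : ℝ) (x : Fin q → ℝ) : ‖(Fin.cons t x : Fin (q+1) → ℝ)‖ = max |t| ‖x‖ := by
  apply le_antisymm
  · refine (pi_norm_le_iff_of_nonneg (le_max_of_le_left (abs_nonneg _))).2 fun i => ?_
    refine Fin.cases ?_ (fun i => ?_) i
    · simp
    · simpa using Or.inr (norm_le_pi_norm x i)
  · refine max_le ?_ ?_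
    · simpa using norm_le_pi_norm (Fin.cons t x : Fin (q+1) → ℝ) 0
    · refine (pi_norm_le_iff_of_nonneg (norm_nonneg _)).2 fun i => ?_
      simpa using norm_le_pi_norm (Fin.cons t x : Fin (q+1) → ℝ) i.succ

lemma norm_eq_max {q : ℕ} (y : Fin (q+1) → ℝ) : ‖y‖ = max |y 0| ‖Fin.tail y‖ := by
  rw [← norm_cons', Fin.cons_self_tail]

lemma cons_cont {q : ℕ} {Y : Type*} [TopologicalSpace Y] {a : Y → ℝ} {b : Y → Fin q → ℝ} (ha : Continuous a)
    (hb : Continuous b) : Continuous fun y => (Fin.cons (a y) (b y) : Fin (q+1) → ℝ) := by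
  refine continuous_pi fun i => ?_
  refine Fin.cases ?_ (fun i => ?_) i
  · simpa using ha
  · simp only [Fin.cons_succ]
    exact (continuous_apply i).comp hb

lemma loop_eval_contOn {X : Type*} [TopologicalSpace X] {x₀ : X} {Y : Type*} [TopologicalSpace Y] {T : Set Y}
    {g : Y → Loop X x₀} {p : Y → OnePoint ℝ} (hg : ContinuousOn g T) (hp : ContinuousOn p T) :
    ContinuousOn (fun y => (g y).1 (p y)) T := by
  have h1 : ContinuousOn (fun y => (g y).1) T := continuous_subtype_val.comp_continuousOn hg
  have h2 : Continuous fun z : C(OnePoint ℝ, X) × OnePoint ℝ => z.1 z.2 := by fun_prop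
  exact h2.comp_continuousOn (h1.prodMk hp)

theorem comp_loopq (h : HNu N K) (hE : (∅ : Finset (Fin r)) ∈ K) {q : ℕ} (hq : 2 ≤ q) :
    Comp (Fin q → ℝ) (loopMap (x₀ := onesUK hE) (y₀ := baseX N K hE) (qCont N K) rfl) := by
  intro g β hg hβ hgβ
  have tl : Continuous (Fin.tail : (Fin (q+1) → ℝ) → (Fin q → ℝ)) := tail_cont
  have p0 : Continuous fun y : (Fin (q+1) → ℝ) => par (y 0) := par_cont.comp (continuous_apply 0)
  have tailm : ∀ y ∈ Bl (Fin (q+1) → ℝ), Fin.tail y ∈ Bl (Fin q → ℝ) := by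
    intro y hy
    rw [mem_Bl] at hy ⊢
    rw [norm_eq_max] at hy
    exact (le_max_right _ _).trans hy
  have hγ : ContinuousOn (fun y : (Fin (q+1) → ℝ) => (g (Fin.tail y)).1 (par (y 0))) (Bl (Fin (q+1) → ℝ)) :=
    loop_eval_contOn (g := fun y : (Fin (q+1) → ℝ) => g (Fin.tail y)) (hg.comp tl.continuousOn tailm) p0.continuousOn
  have hb1 : ∀ y : (Fin (q+1) → ℝ), |y 0| = 1 → (β (Fin.tail y)).1 (par (y 0)) = onesUK hE := by
    intro y hy
    rw [par_of_one_le hy.ge]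
    exact (β (Fin.tail y)).2
  have hsp : ∀ y ∈ Sp (Fin (q+1) → ℝ), |y 0| = 1 ∨ ‖Fin.tail y‖ = 1 := by
    intro y hy
    rw [mem_Sp, norm_eq_max] at hy
    rcases max_choice |y 0| ‖Fin.tail y‖ with h | h
    · left; rw [← h, hy]
    · right; rw [← h, hy]
  have hb : ContinuousOn (fun y : (Fin (q+1) → ℝ) => (β (Fin.tail y)).1 (par (y 0))) (Sp (Fin (q+1) → ℝ)) := by
    refine glue_contOn (s₁ := {y : (Fin (q+1) → ℝ) | |y 0| = 1}) (s₂ := {y : (Fin (q+1) → ℝ) | ‖Fin.tail y‖ = 1}) (f₁ := fun _ => onesUK hE)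
      (f₂ := fun y : (Fin (q+1) → ℝ) => (β (Fin.tail y)).1 (par (y 0)))
      (isClosed_eq (by fun_prop) (by fun_prop)) (isClosed_eq (by fun_prop) (by fun_prop))
      (fun y hy => hsp y hy) continuousOn_const ?_ (fun y hy => hb1 y hy.2) (fun y hy => rfl)
    refine loop_eval_contOn (g := fun y : (Fin (q+1) → ℝ) => β (Fin.tail y)) ?_ p0.continuousOn
    exact hβ.comp tl.continuousOn (fun y hy => mem_Sp.2 hy.2)
  obtain ⟨L, L1, L2, L3⟩ := lift_rel h hq hγ hb (by
    intro y hy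
    rcases hsp y hy with h1 | h1
    · rw [hb1 y h1, par_of_one_le h1.ge, (g _).2]; rfl
    · rw [← hgβ _ (mem_Sp.2 h1)]; rfl)
  have hones : ∀ (t : ℝ) (x : (Fin q → ℝ)), |t| = 1 → x ∈ Bl (Fin q → ℝ) → L (Fin.cons t x) = onesUK hE := by
    intro t x ht hx
    rw [L3 _ (by rw [mem_Sp, norm_cons', ht]; exact max_eq_left (mem_Bl.1 hx))]
    exact hb1 _ (by simpa using ht)
  -- the two-variable map
  set Fm : (Fin q → ℝ) × OnePoint ℝ → ↥(UK K) := fun z => L (Fin.cons (parinv z.2) (ret z.1)) with hFm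
  have hFc : Continuous Fm := by
    have hprop : IsProperMap (fun t : Set.Icc (-1:ℝ) 1 => par t.1) :=
      (par_cont.comp continuous_subtype_val).isProperMap
    have hpm : IsProperMap (Prod.map (id : (Fin q → ℝ) → (Fin q → ℝ)) (fun t : Set.Icc (-1:ℝ) 1 => par t.1)) :=
      isProperMap_id.prodMap hprop
    have hsurj : Function.Surjective (Prod.map (id : (Fin q → ℝ) → (Fin q → ℝ)) (fun t : Set.Icc (-1:ℝ) 1 => par t.1)) := by
      rintro ⟨x, s⟩
      exact ⟨(x, ⟨parinv s, abs_le.1 (abs_parinv_le s)⟩), Prod.ext rfl (par_parinv s)⟩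
    have hquot := hpm.isClosedMap.isQuotientMap hpm.continuous hsurj
    rw [hquot.continuous_iff]
    have heq : Fm ∘ (Prod.map (id : (Fin q → ℝ) → (Fin q → ℝ)) (fun t : Set.Icc (-1:ℝ) 1 => par t.1))
        = fun z : (Fin q → ℝ) × Set.Icc (-1:ℝ) 1 => L (Fin.cons z.2.1 (ret z.1)) := by
      funext ⟨x, t, ht⟩
      simp only [hFm, Function.comp, Prod.map, id]
      by_cases h1 : |t| < 1
      · rw [parinv_par h1]
      · have : |t| = 1 := le_antisymm (abs_le.2 ht) (not_lt.1 h1)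
        rw [par_of_one_le this.ge, parinv_infty, hones 1 _ abs_one (ret_mem x), hones t _ this (ret_mem x)]
    rw [heq]
    refine L1.comp_continuous (f := fun z : (Fin q → ℝ) × Set.Icc (-1:ℝ) 1 => (Fin.cons z.2.1 (ret z.1) : (Fin (q+1) → ℝ))) ?_ ?_
    · exact cons_cont (by fun_prop) (ret_cont.comp continuous_fst)
    · rintro ⟨x, t, ht⟩
      rw [mem_Bl, norm_cons']
      exact max_le (abs_le.2 ht) (mem_Bl.1 (ret_mem x))
  set Gc : C((Fin q → ℝ), C(OnePoint ℝ, ↥(UK K))) := ContinuousMap.curry ⟨Fm, hFc⟩ with hGc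
  have hGi : ∀ x, Gc x OnePoint.infty = onesUK hE := by
    intro x
    show L (Fin.cons (parinv OnePoint.infty) (ret x)) = _
    exact hones _ _ (by rw [parinv_infty]; simp) (ret_mem x)
  have hmem : ∀ x ∈ Bl (Fin q → ℝ), ∀ s, (Fin.cons (parinv s) x : (Fin (q+1) → ℝ)) ∈ Bl (Fin (q+1) → ℝ) := by
    intro x hx s
    rw [mem_Bl, norm_cons']
    exact max_le (abs_parinv_le s) (mem_Bl.1 hx)
  have hGx : ∀ x ∈ Bl (Fin q → ℝ), ∀ s, Gc x s = L (Fin.cons (parinv s) x) := by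
    intro x hx s
    show L (Fin.cons (parinv s) (ret x)) = _
    rw [ret_eq hx]
  refine ⟨fun x => ⟨Gc x, hGi x⟩, fun z => g z.2, ?_, ?_, ?_, fun x _ => rfl, ?_, fun τ _ a _ => rfl⟩
  · exact (Continuous.subtype_mk Gc.continuous hGi).continuousOn
  · intro a ha
    refine Subtype.ext (ContinuousMap.ext fun s => ?_)
    show Gc a s = (β a).1 s
    rw [hGx a (Sp_sub_Bl ha), L3 _ (by
      rw [mem_Sp, norm_cons', mem_Sp.1 ha]; exact max_eq_right (abs_parinv_le s))]
    simp only [Fin.tail_cons, Fin.cons_zero, par_parinv]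
  · exact hg.comp continuousOn_snd (fun z hz => hz.2)
  · intro x hx
    refine Subtype.ext (ContinuousMap.ext fun s => ?_)
    show (g x).1 s = qmap N K (Gc x s)
    rw [hGx x hx, L2 _ (hmem x hx s)]
    simp only [Fin.tail_cons, Fin.cons_zero, par_parinv]

end Part14

section Part15
lemma j1_cont {r : ℕ} {K : Set (Finset (Fin r))} {D : Fin r → ℕ} (hE : ∅ ∈ K) (b : ℝ) (e : Fin r → ℕ)
    (hρ : ∀ σ : Finset (Fin r), σ ∉ K → 2 ≤ σ.card) (x : Fin r → ℂ)
    (hxb : ∀ k, b < (x k).re) (hx : Function.Injective x) : Continuous (j1 (D := D) hE b e hρ x hxb hx) := by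
  rw [(emb_isInducing hE).continuous_iff]
  have h3 : emb hE ∘ (j1 (D := D) hE b e hρ x hxb hx) = fun p => lamZ e x p.1 := by
    funext p
    exact emb_mkLoop hE _ _
  rw [h3]
  have : Continuous fun p : ↥(Pol' K D b) => ((p.1, x) : (∀ k : Fin r, Fin (D k) → ℂ) × (Fin r → ℂ)) :=
    continuous_subtype_val.prodMk continuous_const
  have h2 := (lamZ_cont (D := D) e).comp this
  exact h2

lemma exists_primitive {r : ℕ} {K : Set (Finset (Fin r))} (σ : Finset (Fin r)) (hσ : σ ∉ K) :
    ∃ τ ⊆ σ, PrimitiveSet K τ := by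
  induction σ using Finset.strongInduction with
  | H σ ih =>
    by_cases h : ∀ t ⊂ σ, t ∈ K
    · exact ⟨σ, subset_rfl, hσ, h⟩
    · push Not at h
      obtain ⟨t, h1, h2⟩ := h
      obtain ⟨τ, h3, h4⟩ := ih t h1 h2
      exact ⟨τ, h3.trans h1.subset, h4⟩

lemma rmin_le_card {r : ℕ} {K : Set (Finset (Fin r))} (σ : Finset (Fin r)) (hσ : σ ∉ K) : rmin K ≤ σ.card := by
  obtain ⟨τ, h1, h2⟩ := exists_primitive σ hσ
  have h3 : rmin K ≤ τ.card := Nat.sInf_le ⟨τ, h2, rfl⟩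
  exact h3.trans (Finset.card_le_card h1)

/-- the monomials `(z^{-d_k})` with `∑ d_k n_k = 0` lie in the group -/
lemma pow_mem_G {n r : ℕ} {N : Fin r → Fin n → ℤ} (d : Fin r → ℕ) (hd : ∑ k, (d k : ℤ) • N k = 0) {w : ℂ} (hw : w ≠ 0) :
    (fun k => w ^ d k) ∈ GSet N := by
  refine ⟨fun k => pow_ne_zero _ hw, fun m => ?_⟩
  have h1 : ∀ k, (w ^ d k) ^ (∑ j, N k j * m j) = w ^ ((d k : ℤ) * ∑ j, N k j * m j) := by
    intro k
    rw [← zpow_natCast, ← zpow_mul]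
  simp only [h1]
  have h2 : ∀ s : Finset (Fin r), ∏ k ∈ s, w ^ ((d k : ℤ) * ∑ j, N k j * m j) = w ^ (∑ k ∈ s, (d k : ℤ) * ∑ j, N k j * m j) := by
    intro s
    induction s using Finset.induction_on with
    | empty => simp
    | insert a s ha ih => rw [Finset.prod_insert ha, Finset.sum_insert ha, zpow_add₀ hw, ih]
  rw [h2]
  have h3 : ∑ k, (d k : ℤ) * ∑ j, N k j * m j = 0 := by
    have : ∀ j, ∑ k, (d k : ℤ) * N k j = 0 := by
      intro j
      have := congrFun hd j
      simpa [Finset.sum_apply] using this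
    simp only [Finset.mul_sum]
    rw [Finset.sum_comm]
    refine Finset.sum_eq_zero fun j _ => ?_
    have h4 : ∀ k, (d k : ℤ) * (N k j * m j) = (d k * N k j) * m j := fun k => by ring
    simp only [h4]
    rw [← Finset.sum_mul, this j, zero_mul]
  rw [h3, zpow_zero]

lemma composite_eq {n r : ℕ} {N : Fin r → Fin n → ℤ} {K : Set (Finset (Fin r))} (hE : (∅ : Finset (Fin r)) ∈ K)
    {D : Fin r → ℕ} {dstar : Fin r → ℕ} (hdsum : ∑ k, (dstar k : ℤ) • N k = 0)
    {m₀ : ℕ} (hm₀ : ∀ k, D k < m₀ * dstar k) {b : ℝ}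
    {φ : ℂ → ℂ} (hφ : AdmissiblePhi b φ)
    {xpt : Fin r → ℂ} (hx : ∀ k, b < (xpt k).re) (hxinj : Function.Injective xpt)
    (j₀ : ↥(PolSp K fun k => m₀ * dstar k) → Loop ↥(UK K) (onesUK hE))
    (hj₀ : IsLiftOfID N K hE (fun k => m₀ * dstar k) j₀)
    (s₀ : ↥(PolSp K D) → ↥(PolSp K fun k => m₀ * dstar k))
    (hs₀ : StabSpec K φ xpt D (fun k => m₀ * dstar k) s₀)
    (hρ : ∀ σ : Finset (Fin r), σ ∉ K → 2 ≤ σ.card) (f : ↥(PolSp K D)) :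
    loopMap (x₀ := onesUK hE) (y₀ := baseX N K hE) (qCont N K) rfl (j₀ (s₀ f)) =
      loopMap (x₀ := onesUK hE) (y₀ := baseX N K hE) (qCont N K) rfl
        (j1 (D := D) hE b (fun k => m₀ * dstar k - D k) hρ xpt hx hxinj (PhiMap hφ f)) := by
  refine Subtype.ext (ContinuousMap.ext fun s => ?_)
  induction s using OnePoint.rec with
  | infty =>
    exact (loopMap (x₀ := onesUK hE) (y₀ := baseX N K hE) (qCont N K) rfl (j₀ (s₀ f))).2.trans
      (loopMap (x₀ := onesUK hE) (y₀ := baseX N K hE) (qCont N K) rfl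
        (j1 (D := D) hE b (fun k => m₀ * dstar k - D k) hρ xpt hx hxinj (PhiMap hφ f))).2.symm
  | coe t =>
    refine (hj₀ (s₀ f) t).trans ?_
    show _ = qmap N K _
    rw [qmap_eq_iff]
    have hsum : ∑ k, ((m₀ * dstar k : ℕ) : ℤ) • N k = 0 := by
      have : ∀ k, ((m₀ * dstar k : ℕ) : ℤ) • N k = (m₀ : ℤ) • ((dstar k : ℤ) • N k) := by
        intro k; rw [smul_smul]; push_cast; rfl
      simp only [this]
      rw [← Finset.smul_sum, hdsum, smul_zero]
    refine ⟨_, pow_mem_G (fun k => m₀ * dstar k) hsum (inv_ne_zero (tI_ne t)), ?_⟩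
    funext k
    show _ = lamZ (fun k => m₀ * dstar k - D k) xpt (PmD φ f.1) k (t : S1)
    rw [lamZ_coe, Nat.add_sub_cancel' (hm₀ k).le]
    congr 1
    dsimp only
    rw [hs₀ f k, PmD, toPoly_Pm, Polynomial.eval_mul, mul_comm]
    simp

theorem comp_total
    {n r : ℕ} (F : Fan n) (N : Fin r → Fin n → ℤ)
    (hPG : IsPrimGens F N) (hNS : F.NonSingular) (h2 : Cond2 N)
    (D : Fin r → ℕ) (hD : ∀ k, 0 < D k)
    (dstar : Fin r → ℕ)
    (hdsum : ∑ k, (dstar k : ℤ) • N k = 0)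
    (m₀ : ℕ) (hm₀ : ∀ k, D k < m₀ * dstar k)
    (φ : ℂ → ℂ) (hφ : AdmissiblePhi ((∑ k, D k : ℕ) : ℝ) φ)
    (xpt : Fin r → ℂ) (hx : ∀ k, ((∑ k, D k : ℕ) : ℝ) < (xpt k).re)
    (hxinj : Function.Injective xpt)
    (j₀ : C(↥(PolSp (KC F N) fun k => m₀ * dstar k),
        Loop ↥(UK (KC F N)) (onesUK (empty_mem_KC F N))))
    (hj₀ : IsLiftOfID N (KC F N) (empty_mem_KC F N) (fun k => m₀ * dstar k) ⇑j₀)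
    (s₀ : C(↥(PolSp (KC F N) D), ↥(PolSp (KC F N) fun k => m₀ * dstar k)))
    (hs₀ : StabSpec (KC F N) φ xpt D (fun k => m₀ * dstar k) ⇑s₀)
    (q : ℕ) (hq : 2 ≤ q) (hqb : (q : ℤ) ≤ dBound (KC F N) D + 1) :
    Comp (Fin q → ℝ)
      ((loopMap (y₀ := baseX N (KC F N) (empty_mem_KC F N)) (qCont N (KC F N)) rfl).comp (j₀.comp s₀)) := by
  have hE := empty_mem_KC F N
  have hb : (q : ℤ) + 1 ≤ 2 * ((rmin (KC F N) : ℤ) - 1) * (dmin D : ℤ) := by unfold dBound at hqb; linarith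
  have hρ2 : 2 ≤ rmin (KC F N) := by
    by_contra hc
    have h1 : (rmin (KC F N) : ℤ) - 1 ≤ 0 := by omega
    have : 2 * ((rmin (KC F N) : ℤ) - 1) * (dmin D : ℤ) ≤ 0 :=
      mul_nonpos_of_nonpos_of_nonneg (by linarith) (by positivity)
    omega
  have hs : 0 < dmin D := by
    rcases Nat.eq_zero_or_pos (dmin D) with h | h
    · rw [h] at hb; simp at hb; omega
    · exact h
  have hr : 0 < r := by
    rcases Nat.eq_zero_or_pos r with h | h
    · subst h
      have : dmin D = 0 := by unfold dmin; simp
      omega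
    · exact h
  have hsD : ∀ k, dmin D ≤ D k := fun k => Nat.sInf_le ⟨k, rfl⟩
  have hρ : ∀ σ : Finset (Fin r), σ ∉ (KC F N) → 2 ≤ σ.card := fun σ hσ => hρ2.trans (rmin_le_card σ hσ)
  have hdim : Module.finrank ℝ (Fin q → ℝ) < dmin D * (2 * rmin (KC F N) - 2) := by
    rw [Module.finrank_fin_fun]
    zify [show 2 ≤ 2 * rmin (KC F N) by omega]
    have : 2 * ((rmin (KC F N) : ℤ) - 1) * (dmin D : ℤ) = (dmin D : ℤ) * (2 * rmin (KC F N) - 2) := by ring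
    linarith
  have hnu : HNu N (KC F N) := fun Z hZ => nu_exists hNS hPG h2 hZ
  have c1 : Comp (Fin q → ℝ) (j1 (K := (KC F N)) (D := D) hE ((∑ k, D k : ℕ) : ℝ) (fun k => m₀ * dstar k - D k) hρ xpt hx hxinj) :=
    comp_j1 hE _ _ hρ xpt hx hxinj (comp_incl _)
      (fun X => comp_Lam X hE hr hs hsD (fun σ hσ => rmin_le_card σ hσ) hρ2 hdim)
  have c2 := c1.comp (comp_Phi hφ) (PhiMap_cont hφ) (j1_cont _ _ _ _ _ _ _)
  have c3 := (comp_loopq hnu hE hq).comp c2 ((j1_cont _ _ _ _ _ _ _).comp (PhiMap_cont hφ)) (ContinuousMap.continuous _)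
  convert! c3 using 1
  funext f
  exact composite_eq hE hdsum hm₀ hφ hx hxinj j₀ hj₀ s₀ hs₀ hρ f

end Part15

/-- When `∑ d_k n_k ≠ 0`, the map `i_D = (Ω q_Σ) ∘ j_D` (with
`j_D = j_{D₀} ∘ s_{D,D₀}`) induces an isomorphism on `π_k` for `2 ≤ k ≤ d(D,Σ)`. -/
theorem polSpace_iD_composite_pi_iso
    {n r : ℕ} (F : Fan n) (N : Fin r → Fin n → ℤ)
    (hPG : IsPrimGens F N) (hNS : F.NonSingular)
    (h1 : Cond1 N) (h2 : Cond2 N)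
    (D : Fin r → ℕ) (hD : ∀ k, 0 < D k)
    (hsum : ∑ k, (D k : ℤ) • N k ≠ 0)
    (dstar : Fin r → ℕ) (hds : ∀ k, 0 < dstar k)
    (hdsum : ∑ k, (dstar k : ℤ) • N k = 0)
    (m₀ : ℕ) (hm₀ : ∀ k, D k < m₀ * dstar k)
    (φ : ℂ → ℂ) (hφ : AdmissiblePhi ((∑ k, D k : ℕ) : ℝ) φ)
    (xpt : Fin r → ℂ) (hx : ∀ k, ((∑ k, D k : ℕ) : ℝ) < (xpt k).re)
    (hxinj : Function.Injective xpt)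
    (j₀ : C(↥(PolSp (KC F N) fun k => m₀ * dstar k),
        Loop ↥(UK (KC F N)) (onesUK (empty_mem_KC F N))))
    (hj₀ : IsLiftOfID N (KC F N) (empty_mem_KC F N) (fun k => m₀ * dstar k) ⇑j₀)
    (s₀ : C(↥(PolSp (KC F N) D), ↥(PolSp (KC F N) fun k => m₀ * dstar k)))
    (hs₀ : StabSpec (KC F N) φ xpt D (fun k => m₀ * dstar k) ⇑s₀) :
    ∀ k : ℕ, 2 ≤ k → (k : ℤ) ≤ dBound (KC F N) D →
      ∀ f₀ : ↥(PolSp (KC F N) D),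
        Function.Bijective
          (piMap k ((loopMap (qCont N (KC F N)) rfl).comp (j₀.comp s₀)) f₀) := by
  intro k hk hkb f₀
  refine ⟨piMap_inj _ _ ?_, piMap_surj _ _ ?_⟩
  · exact comp_total F N hPG hNS h2 D hD dstar hdsum m₀ hm₀ φ hφ xpt hx hxinj j₀ hj₀ s₀ hs₀ (k+1) (by omega)
      (by push_cast; linarith)
  · exact comp_total F N hPG hNS h2 D hD dstar hdsum m₀ hm₀ φ hφ xpt hx hxinj j₀ hj₀ s₀ hs₀ k hk (by linarith)

end Toric
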